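/- There does not exist a closed (compact without boundary) nonsingular real analytic Levi-flat real hypersurface in the complex projective space CP^n for any n ≥ 3. -/

import Mathlib

/- STATEMENT 15 (Lins Neto; Siu): There does not exist a closed (compact without
boundary) nonsingular real analytic Levi-flat real hypersurface in ℂℙⁿ for any n ≥ 3.

A subset of ℂℙⁿ is encoded by the cone over it in ℂ^{n+1} ∖ {0} (a set invariant under
multiplication by nonzero complex scalars); it is a closed real analytic Levi-flat
hypersurface of ℂℙⁿ exactly when the cone is closed in ℂ^{n+1} ∖ {0} and is a real
analytic Levi-flat hypersurface there. -/

open Complex Set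

noncomputable section

/-- The Levi form (up to a positive factor) of the defining function `ρ` at `p`,
evaluated at `w`: `D²ρ(p)(w,w) + D²ρ(p)(Jw,Jw) = 4 ∑ ∂²ρ/∂zⱼ∂z̄ₖ wⱼ w̄ₖ`. -/
def leviForm {m : ℕ} (ρ : (Fin m → ℂ) → ℝ) (p w : Fin m → ℂ) : ℝ :=
  iteratedFDeriv ℝ 2 ρ p ![w, w] + iteratedFDeriv ℝ 2 ρ p ![Complex.I • w, Complex.I • w]

/-- `w` belongs to the complex tangent space at `p` of the hypersurface `{ρ = 0}`. -/
def IsComplexTangent {m : ℕ} (ρ : (Fin m → ℂ) → ℝ) (p w : Fin m → ℂ) : Prop :=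
  fderiv ℝ ρ p w = 0 ∧ fderiv ℝ ρ p (Complex.I • w) = 0

/-- `M` is a real analytic Levi-flat real hypersurface: near each of its points it is
the zero set of a real analytic defining function with nonvanishing gradient whose Levi
form vanishes identically on complex tangent vectors. -/
def IsAnalyticLeviFlatHypersurface {m : ℕ} (M : Set (Fin m → ℂ)) : Prop :=
  ∀ p ∈ M, ∃ V : Set (Fin m → ℂ), IsOpen V ∧ p ∈ V ∧ ∃ ρ : (Fin m → ℂ) → ℝ,
    AnalyticOnNhd ℝ ρ V ∧ (∀ q ∈ V, fderiv ℝ ρ q ≠ 0) ∧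
    (∀ q ∈ V, q ∈ M ↔ ρ q = 0) ∧
    (∀ q ∈ V, ρ q = 0 → ∀ w, IsComplexTangent ρ q w → leviForm ρ q w = 0)

/-- `S` is a cone: it is invariant under multiplication by nonzero complex scalars.
Subsets of `ℂℙⁿ` are encoded by the cones over them in `ℂ^{n+1} ∖ {0}`. -/
def IsCone {m : ℕ} (S : Set (Fin m → ℂ)) : Prop :=
  ∀ c : ℂ, c ≠ 0 → ∀ z ∈ S, c • z ∈ S

/-- The cone `S ⊆ ℂ^{n+1} ∖ {0}` represents a closed (= compact) subset of `ℂℙⁿ`: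
it is closed in the punctured space `ℂ^{n+1} ∖ {0}`. -/
def IsClosedInPunctured {m : ℕ} (S : Set (Fin m → ℂ)) : Prop :=
  ∀ z ∈ closure S, z ≠ 0 → z ∈ S

/-- The cone over a closed subset of `ℂℙⁿ`. -/
def IsProjectiveClosedSet {m : ℕ} (S : Set (Fin m → ℂ)) : Prop :=
  S.Nonempty ∧ (∀ z ∈ S, z ≠ 0) ∧ IsCone S ∧ IsClosedInPunctured S

namespace LeviFlat

open Metric Filter Topology

set_option linter.unusedSectionVars false

section Holomorphic

variable {E F : Type*} [NormedAddCommGroup E] [NormedSpace ℂ E]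
  [NormedAddCommGroup F] [NormedSpace ℂ F]

lemma norm_fderiv_le_of_norm_le_ball {f : E → F} {c : E} {R B : ℝ} (hR : 0 < R)
    (hd : DifferentiableOn ℂ f (ball c R)) (hB : ∀ z ∈ ball c R, ‖f z‖ ≤ B) :
    ‖fderiv ℂ f c‖ ≤ 2 * B / R := by
  refine Complex.norm_fderiv_le_div_of_mapsTo_ball hd (fun z hz => ?_) hR
  rw [mem_closedBall, dist_eq_norm]
  calc ‖f z - f c‖ ≤ ‖f z‖ + ‖f c‖ := norm_sub_le _ _
    _ ≤ B + B := add_le_add (hB z hz) (hB c (mem_ball_self hR))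
    _ = 2 * B := by ring

lemma exists_ball_subset_norm_le {f : E → F} {U : Set E} (hU : IsOpen U)
    (hf : ContinuousOn f U) {p : E} (hp : p ∈ U) :
    ∃ R > 0, ∃ B ≥ 0, ball p R ⊆ U ∧ ∀ z ∈ ball p R, ‖f z‖ ≤ B := by
  have hc : ContinuousAt f p := hf.continuousAt (hU.mem_nhds hp)
  have h1 : ∀ᶠ z in 𝓝 p, ‖f z‖ < ‖f p‖ + 1 :=
    hc.norm.eventually_lt continuousAt_const (by linarith)
  obtain ⟨R, hR, h⟩ := Metric.eventually_nhds_iff_ball.1 (h1.and (hU.mem_nhds hp))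
  exact ⟨R, hR, ‖f p‖ + 1, by positivity, fun z hz => (h z hz).2, fun z hz => (h z hz).1.le⟩

lemma continuousOn_fderiv_of_differentiableOn {f : E → F} {U : Set E} (hU : IsOpen U)
    (hf : DifferentiableOn ℂ f U) : ContinuousOn (fderiv ℂ f) U := by
  intro p hp
  apply ContinuousAt.continuousWithinAt
  obtain ⟨R, hR, B, hB0, hRU, hB⟩ := exists_ball_subset_norm_le hU hf.continuousOn hp
  set r := R / 4 with hr
  have hr0 : 0 < r := by positivity
  have hdU : DifferentiableOn ℂ f (ball p R) := hf.mono hRU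
  have hlip : ∀ z ∈ ball p (2 * r), ‖fderiv ℂ f z‖ ≤ 2 * B / r := by
    intro z hz
    have hsub : ball z r ⊆ ball p R := by
      apply ball_subset_ball'
      rw [mem_ball] at hz; linarith
    exact norm_fderiv_le_of_norm_le_ball hr0 (hdU.mono hsub) (fun w hw => hB w (hsub hw))
  have hL : ∀ z ∈ ball p (2 * r), ∀ w ∈ ball p (2 * r), ‖f w - f z‖ ≤ 2 * B / r * ‖w - z‖ := by
    intro z hz w hw
    refine (convex_ball p (2 * r)).norm_image_sub_le_of_norm_fderiv_le (𝕜 := ℂ)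
      (fun x hx => ?_) hlip hz hw
    exact hdU.differentiableAt (isOpen_ball.mem_nhds (ball_subset_ball (by linarith) hx))
  have key : ∀ z ∈ ball p r, ‖fderiv ℂ f z - fderiv ℂ f p‖ ≤ 2 * (2 * B / r * ‖z - p‖) / r := by
    intro z hz
    have hzn : ‖z - p‖ < r := by rwa [← dist_eq_norm]
    have hshift : DifferentiableOn ℂ (fun w => f (w + (z - p))) (ball p r) := by
      refine hdU.comp (by fun_prop) (fun w hw => ?_)
      rw [mem_ball, dist_eq_norm] at *
      calc ‖w + (z - p) - p‖ = ‖(w - p) + (z - p)‖ := by congr 1; abel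
        _ ≤ ‖w - p‖ + ‖z - p‖ := norm_add_le _ _
        _ < R := by linarith
    have hd2 : DifferentiableOn ℂ (fun w => f (w + (z - p)) - f w) (ball p r) :=
      hshift.sub (hdU.mono (ball_subset_ball (by linarith)))
    have h := norm_fderiv_le_of_norm_le_ball hr0 hd2 (B := 2 * B / r * ‖z - p‖) (fun w hw => ?_)
    · have e1 : fderiv ℂ (fun w => f (w + (z - p)) - f w) p = fderiv ℂ f z - fderiv ℂ f p := by
        rw [fderiv_fun_sub, fderiv_comp_add_right]
        · congr 2; abel
        · exact hshift.differentiableAt (ball_mem_nhds _ hr0)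
        · exact hdU.differentiableAt (ball_mem_nhds _ hR)
      rwa [e1] at h
    · have := hL w (ball_subset_ball (by linarith) hw) (w + (z - p)) (by
        rw [mem_ball, dist_eq_norm] at *
        calc ‖w + (z - p) - p‖ = ‖(w - p) + (z - p)‖ := by congr 1; abel
          _ ≤ ‖w - p‖ + ‖z - p‖ := norm_add_le _ _
          _ < 2 * r := by linarith)
      simpa using this
  rw [ContinuousAt, tendsto_iff_norm_sub_tendsto_zero]
  refine squeeze_zero' (Eventually.of_forall fun _ => norm_nonneg _)
    (Metric.eventually_nhds_iff_ball.2 ⟨r, hr0, key⟩) ?_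
  have : Continuous fun z : E => 2 * (2 * B / r * ‖z - p‖) / r := by fun_prop
  simpa using this.tendsto p

lemma exists_differentiableOn_circleIntegral [CompleteSpace F] {h : E → F} {Ω : Set E}
    (hΩ : IsOpen Ω) (hh : DifferentiableOn ℂ h Ω) {p v : E} {ρ : ℝ} {φ : ℂ → ℂ}
    (hφ : ContinuousOn φ (sphere 0 |ρ|)) (hc : ∀ t ∈ sphere (0 : ℂ) |ρ|, p + t • v ∈ Ω) :
    ∃ ε > 0, (∀ z ∈ ball p ε, ∀ t ∈ sphere (0 : ℂ) |ρ|, z + t • v ∈ Ω) ∧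
      DifferentiableOn ℂ (fun z => ∮ t in C(0, ρ), φ t • h (z + t • v)) (ball p ε) := by
  have hcf := continuousOn_fderiv_of_differentiableOn hΩ hh
  set K : Set E := (fun t : ℂ => p + t • v) '' sphere (0 : ℂ) |ρ| with hK
  have hKc : IsCompact K := (isCompact_sphere 0 |ρ|).image (by fun_prop)
  have hKΩ : K ⊆ Ω := by rintro _ ⟨t, ht, rfl⟩; exact hc t ht
  obtain ⟨C, hC⟩ := hKc.exists_bound_of_continuousOn (hcf.mono hKΩ)
  have hopen : IsOpen (Ω ∩ {z | ‖fderiv ℂ h z‖ < C + 1}) :=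
    hcf.norm.isOpen_inter_preimage hΩ isOpen_Iio
  obtain ⟨ε, hε, hthick⟩ := hKc.exists_thickening_subset_open hopen
    (fun z hz => ⟨hKΩ hz, lt_of_le_of_lt (hC z hz) (lt_add_one _)⟩)
  have hmem : ∀ z ∈ ball p ε, ∀ t ∈ sphere (0 : ℂ) |ρ|,
      z + t • v ∈ Ω ∩ {z | ‖fderiv ℂ h z‖ < C + 1} := by
    intro z hz t ht
    apply hthick
    rw [mem_thickening_iff]
    refine ⟨p + t • v, ⟨t, ht, rfl⟩, ?_⟩
    simpa using hz
  obtain ⟨Cφ, hCφ⟩ := (isCompact_sphere (0 : ℂ) |ρ|).exists_bound_of_continuousOn hφ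
  refine ⟨ε, hε, fun z hz t ht => (hmem z hz t ht).1, ?_⟩
  intro z₀ hz₀
  apply DifferentiableAt.differentiableWithinAt
  simp only [circleIntegral]
  have hcm : ∀ θ, circleMap 0 ρ θ ∈ sphere (0 : ℂ) |ρ| := fun θ => circleMap_mem_sphere' 0 ρ θ
  have hcφ : Continuous fun θ => φ (circleMap 0 ρ θ) :=
    hφ.comp_continuous (continuous_circleMap 0 ρ) hcm
  have hcd : Continuous fun θ => deriv (circleMap 0 ρ) θ := by
    simp only [deriv_circleMap]
    exact (continuous_circleMap 0 ρ).mul continuous_const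
  have hch : ∀ z ∈ ball p ε, Continuous fun θ => h (z + circleMap 0 ρ θ • v) := fun z hz =>
    hh.continuousOn.comp_continuous
      (continuous_const.add ((continuous_circleMap 0 ρ).smul continuous_const))
      (fun θ => (hmem z hz _ (hcm θ)).1)
  have hchf : ∀ z ∈ ball p ε, Continuous fun θ => fderiv ℂ h (z + circleMap 0 ρ θ • v) :=
    fun z hz => hcf.comp_continuous
      (continuous_const.add ((continuous_circleMap 0 ρ).smul continuous_const))
      (fun θ => (hmem z hz _ (hcm θ)).1)
  have hcF : ∀ z ∈ ball p ε, Continuous fun θ =>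
      deriv (circleMap 0 ρ) θ • φ (circleMap 0 ρ θ) • h (z + circleMap 0 ρ θ • v) :=
    fun z hz => hcd.smul (hcφ.smul (hch z hz))
  refine (intervalIntegral.hasFDerivAt_integral_of_dominated_of_fderiv_le (𝕜 := ℂ)
    (s := ball p ε) (bound := fun _ => |ρ| * (Cφ * (C + 1)))
    (F' := fun z θ => deriv (circleMap 0 ρ) θ • φ (circleMap 0 ρ θ) •
      fderiv ℂ h (z + circleMap 0 ρ θ • v)) (isOpen_ball.mem_nhds hz₀)
    ?_ ?_ ?_ ?_ ?_ ?_).differentiableAt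
  · filter_upwards [isOpen_ball.mem_nhds hz₀] with z hz
    exact (hcF z hz).aestronglyMeasurable
  · exact (hcF z₀ hz₀).intervalIntegrable _ _
  · exact (hcd.smul (hcφ.smul (hchf z₀ hz₀))).aestronglyMeasurable
  · refine Eventually.of_forall fun θ _ z hz => ?_
    rw [norm_smul, norm_smul]
    have h1 : ‖deriv (circleMap 0 ρ) θ‖ = |ρ| := by simp
    rw [h1]
    have h2 := hCφ _ (hcm θ)
    have h3 : ‖fderiv ℂ h (z + circleMap 0 ρ θ • v)‖ ≤ C + 1 := (hmem z hz _ (hcm θ)).2.le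
    have := (norm_nonneg _).trans h2
    gcongr
  · exact intervalIntegrable_const
  · refine Eventually.of_forall fun θ _ z hz => ?_
    have hda : HasFDerivAt h (fderiv ℂ h (z + circleMap 0 ρ θ • v)) (z + circleMap 0 ρ θ • v) :=
      (hh.differentiableAt (hΩ.mem_nhds (hmem z hz _ (hcm θ)).1)).hasFDerivAt
    have : HasFDerivAt (fun x => h (x + circleMap 0 ρ θ • v))
        (fderiv ℂ h (z + circleMap 0 ρ θ • v)) z := by
      exact hda.comp z ((hasFDerivAt_id z).add_const (circleMap 0 ρ θ • v))
    exact (this.const_smul _).const_smul _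

lemma differentiableOn_fderiv_apply [CompleteSpace F] {f : E → F} {U : Set E} (hU : IsOpen U)
    (hf : DifferentiableOn ℂ f U) (v : E) : DifferentiableOn ℂ (fun z => fderiv ℂ f z v) U := by
  intro p hp
  apply DifferentiableAt.differentiableWithinAt
  obtain ⟨R, hR, hRU⟩ := Metric.isOpen_iff.1 hU p hp
  set ρ : ℝ := R / (2 * (‖v‖ + 1)) with hρ
  have hρ0 : 0 < ρ := by positivity
  have hρv : ρ * ‖v‖ < R / 2 := by
    rw [hρ, div_mul_eq_mul_div, div_lt_div_iff₀ (by positivity) (by positivity)]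
    nlinarith [norm_nonneg v]
  have hin : ∀ z ∈ ball p (R / 2), ∀ t ∈ closedBall (0 : ℂ) ρ, z + t • v ∈ U := by
    intro z hz t ht
    apply hRU
    rw [mem_ball, dist_eq_norm] at *
    rw [mem_closedBall, dist_zero_right] at ht
    calc ‖z + t • v - p‖ = ‖(z - p) + t • v‖ := by congr 1; abel
      _ ≤ ‖z - p‖ + ‖t‖ * ‖v‖ := by rw [← norm_smul]; exact norm_add_le _ _
      _ < R := by nlinarith [norm_nonneg v]
  have hcφ : ContinuousOn (fun t : ℂ => 1 / t ^ 2) (sphere 0 |ρ|) := by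
    refine ContinuousOn.div₀ (by fun_prop) (by fun_prop) fun t ht => ?_
    have : ‖t‖ = ρ := by rw [abs_of_pos hρ0] at ht; simpa using ht
    have : t ≠ 0 := by rw [← norm_pos_iff]; linarith
    positivity
  obtain ⟨ε, hε, -, hd⟩ := exists_differentiableOn_circleIntegral hU hf (p := p) (v := v) hcφ
    (fun t ht => hin p (mem_ball_self (by positivity)) t (by
      rw [abs_of_pos hρ0] at ht; exact sphere_subset_closedBall ht))
  have heq : (fun z => fderiv ℂ f z v) =ᶠ[𝓝 p]
      fun z => (2 * Real.pi * I : ℂ)⁻¹ • ∮ t in C(0, ρ), (1 / t ^ 2) • f (z + t • v) := by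
    filter_upwards [ball_mem_nhds p (show 0 < R / 2 by positivity)] with z hz
    have hdiff : ∀ t ∈ closedBall (0 : ℂ) ρ, DifferentiableAt ℂ (fun t : ℂ => f (z + t • v)) t := by
      intro t ht
      have h1 : DifferentiableAt ℂ f (z + t • v) :=
        hf.differentiableAt (hU.mem_nhds (hin z hz t ht))
      exact DifferentiableAt.comp (f := fun t : ℂ => z + t • v) t h1 (by fun_prop)
    have hdc : DiffContOnCl ℂ (fun t : ℂ => f (z + t • v)) (ball 0 ρ) := by
      apply DifferentiableOn.diffContOnCl
      rw [closure_ball _ hρ0.ne']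
      exact fun t ht => (hdiff t ht).differentiableWithinAt
    have hcau := hdc.deriv_eq_smul_circleIntegral hρ0
    have hder : deriv (fun t : ℂ => f (z + t • v)) 0 = fderiv ℂ f z v := by
      have h1 : HasFDerivAt f (fderiv ℂ f z) (z + (0 : ℂ) • v) := by
        rw [zero_smul, add_zero]
        exact (hf.differentiableAt (hU.mem_nhds (by
          simpa using hin z hz 0 (by simpa using hρ0.le)))).hasFDerivAt
      have h2 : HasDerivAt (fun t : ℂ => z + t • v) v 0 := by
        simpa using ((hasDerivAt_id (0 : ℂ)).smul_const v).const_add z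
      exact (h1.comp_hasDerivAt (0 : ℂ) h2).deriv
    simp only [sub_zero] at hcau
    rw [← hder, hcau, smul_smul, inv_mul_cancel₀ Complex.two_pi_I_ne_zero, one_smul]
  exact heq.differentiableAt_iff.2 ((hd.differentiableAt (ball_mem_nhds p hε)).const_smul _)

theorem contDiffOn_of_differentiableOn_complex [FiniteDimensional ℂ E] [CompleteSpace F] {U : Set E}
    (hU : IsOpen U) (n : ℕ) {f : E → F} (hf : DifferentiableOn ℂ f U) : ContDiffOn ℂ n f U := by
  induction n generalizing f with
  | zero => exact contDiffOn_zero.2 hf.continuousOn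
  | succ n ih =>
    push_cast
    rw [contDiffOn_succ_iff_fderiv_of_isOpen hU]
    refine ⟨hf, by simp, ?_⟩
    rw [contDiffOn_clm_apply]
    exact fun v => ih (differentiableOn_fderiv_apply hU hf v)

theorem differentiableOn_fderiv [FiniteDimensional ℂ E] [CompleteSpace F] {U : Set E}
    (hU : IsOpen U) {f : E → F} (hf : DifferentiableOn ℂ f U) :
    DifferentiableOn ℂ (fderiv ℂ f) U := by
  have := (contDiffOn_succ_iff_fderiv_of_isOpen (n := 1) hU).1
    (by simpa [one_add_one_eq_two] using contDiffOn_of_differentiableOn_complex hU 2 hf)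
  exact this.2.2.differentiableOn (by simp)

/-- Identity theorem on convex open sets. -/
theorem eqOn_zero_of_eventually_eq_zero [CompleteSpace F] {U : Set E} (hU : IsOpen U)
    (hc : Convex ℝ U) {f : E → F} (hf : DifferentiableOn ℂ f U) {p : E} (hp : p ∈ U)
    (h0 : ∀ᶠ z in 𝓝 p, f z = 0) : ∀ z ∈ U, f z = 0 := by
  intro z hz
  set L : ℂ → E := fun t => p + t • (z - p) with hL
  have hLc : Continuous L := by fun_prop
  set V := L ⁻¹' U
  have hV : IsOpen V := hU.preimage hLc
  have hVc : Convex ℝ V := by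
    intro s hs t ht a b ha hb hab
    have : L (a • s + b • t) = a • L s + b • L t := by
      have hp' : p = a • p + b • p := by rw [← add_smul, hab, one_smul]
      simp only [hL, smul_add, add_smul, smul_assoc]
      nth_rw 1 [hp']
      abel
    show L _ ∈ U
    rw [this]
    exact hc hs ht ha hb hab
  have hd : DifferentiableOn ℂ (f ∘ L) V := hf.comp (by fun_prop) (mapsTo_preimage _ _)
  have han : AnalyticOnNhd ℂ (f ∘ L) V := hd.analyticOnNhd hV
  have h0V : (0 : ℂ) ∈ V := by simpa [V, hL] using hp
  have h1V : (1 : ℂ) ∈ V := by simpa [V, hL] using hz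
  have hev : (f ∘ L) =ᶠ[𝓝 0] 0 := by
    have : Tendsto L (𝓝 0) (𝓝 p) := by simpa [hL] using hLc.tendsto 0
    exact this.eventually h0
  have := han.eqOn_zero_of_preconnected_of_eventuallyEq_zero hVc.isPreconnected h0V hev h1V
  simpa [hL] using this

end Holomorphic

section Implicit

variable {X : Type*} [NormedAddCommGroup X] [NormedSpace ℂ X] [FiniteDimensional ℂ X]

lemma exists_implicit_function {F : X × ℂ → ℂ} {Ω : Set (X × ℂ)} (hΩ : IsOpen Ω)
    (hF : DifferentiableOn ℂ F Ω) {x₀ : X} {s₀ : ℂ} (h₀ : (x₀, s₀) ∈ Ω)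
    (hne : fderiv ℂ F (x₀, s₀) (0, 1) ≠ 0) :
    ∃ S : X → ℂ, ∃ ε > 0, DifferentiableOn ℂ S (ball x₀ ε) ∧ S x₀ = s₀ ∧
      (∀ x ∈ ball x₀ ε, (x, S x) ∈ Ω ∧ F (x, S x) = F (x₀, s₀)) ∧
      ∀ x ∈ ball x₀ ε, ∀ s ∈ ball s₀ ε, F (x, s) = F (x₀, s₀) → s = S x := by
  have : CompleteSpace X := FiniteDimensional.complete ℂ X
  have cdf : ContDiffAt ℂ (1 : ℕ) F (x₀, s₀) :=
    (contDiffOn_of_differentiableOn_complex hΩ 1 hF).contDiffAt (hΩ.mem_nhds h₀)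
  have pn : ((1 : ℕ) : WithTop ℕ∞) ≠ 0 := by simp
  have hinv : (fderiv ℂ F (x₀, s₀) ∘L .inr ℂ X ℂ).IsInvertible := by
    set c := fderiv ℂ F (x₀, s₀) (0, 1) with hc
    refine ⟨ContinuousLinearEquiv.unitsEquivAut ℂ (Units.mk0 c hne), ?_⟩
    ext
    simp [hc]
  set S := cdf.implicitFunction pn hinv with hS
  have hS0 : S x₀ = s₀ := cdf.implicitFunction_apply_self pn hinv
  have hSd : ContDiffAt ℂ (1 : ℕ) S x₀ := cdf.contDiffAt_implicitFunction pn hinv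
  have h1 : ∀ᶠ x in 𝓝 x₀, DifferentiableAt ℂ S x := by
    filter_upwards [hSd.eventually (by simp)] with x hx
    exact hx.differentiableAt (by simp)
  have h2 : ∀ᶠ x in 𝓝 x₀, F (x, S x) = F (x₀, s₀) := cdf.eventually_apply_implicitFunction pn hinv
  have h3 : ∀ᶠ x in 𝓝 x₀, (x, S x) ∈ Ω := by
    have hc : ContinuousAt (fun x => (x, S x)) x₀ := continuousAt_id.prodMk hSd.continuousAt
    have h₀' : (x₀, S x₀) ∈ Ω := by rw [hS0]; exact h₀
    exact hc.eventually (hΩ.mem_nhds h₀')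
  obtain ⟨ε₁, hε₁, H1⟩ := Metric.eventually_nhds_iff_ball.1 (h1.and (h2.and h3))
  obtain ⟨ε₂, hε₂, H2⟩ := Metric.eventually_nhds_iff_ball.1
    (cdf.eventually_apply_eq_iff_implicitFunction pn hinv)
  refine ⟨S, min ε₁ ε₂, lt_min hε₁ hε₂, fun x hx => ?_, hS0, fun x hx => ?_, fun x hx s hs h => ?_⟩
  · exact (H1 x (ball_subset_ball (min_le_left _ _) hx)).1.differentiableWithinAt
  · have := H1 x (ball_subset_ball (min_le_left _ _) hx)
    exact ⟨this.2.2, this.2.1⟩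
  · have hmem : (x, s) ∈ ball (x₀, s₀) ε₂ := by
      rw [mem_ball, Prod.dist_eq, max_lt_iff]
      exact ⟨lt_of_lt_of_le hx (min_le_right _ _), lt_of_lt_of_le hs (min_le_right _ _)⟩
    exact ((H2 _ hmem).1 h).symm

end Implicit

section Conic

variable {V : Type*} [NormedAddCommGroup V] [InnerProductSpace ℂ V]

/-- A closed cone `M` together with holomorphic functions `f q` on the balls
`ball q (r * ‖q‖)`, `q ∈ M`, without critical points, which define the same foliation on
overlaps, whose level sets through points of `M` stay inside `M`. -/
structure ConicFoliation (M : Set V) (r C : ℝ) (f : V → V → ℂ) : Prop where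
  nonempty : M.Nonempty
  zero_notMem : (0 : V) ∉ M
  smul_mem : ∀ c : ℂ, c ≠ 0 → ∀ z ∈ M, c • z ∈ M
  mem_of_closure : ∀ z ∈ closure M, z ≠ 0 → z ∈ M
  r_pos : 0 < r
  r_le : r ≤ 1 / 10
  differentiableOn : ∀ q ∈ M, DifferentiableOn ℂ (f q) (ball q (r * ‖q‖))
  one_le : ∀ q ∈ M, ∀ z ∈ ball q (r * ‖q‖), 1 ≤ ‖fderiv ℂ (f q) z‖
  le_C : ∀ q ∈ M, ∀ z ∈ ball q (r * ‖q‖), ‖fderiv ℂ (f q) z‖ ≤ C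
  compat : ∀ q ∈ M, ∀ q' ∈ M, ∀ c : ℂ, c ≠ 0 → ∀ z ∈ ball q (r * ‖q‖),
    c • z ∈ ball q' (r * ‖q'‖) → ∃ k : ℂ, fderiv ℂ (f q') (c • z) = k • fderiv ℂ (f q) z
  leaf : ∀ q ∈ M, ∀ q' ∈ M, q' ∈ ball q (r * ‖q‖) → ∀ z ∈ ball q (r * ‖q‖),
    f q z = f q q' → z ∈ M
  radial : ∀ q ∈ M, ∀ z ∈ ball q (r * ‖q‖), fderiv ℂ (f q) z z = 0
  preconnected : IsPreconnected (⋃ q ∈ M, ball q (r * ‖q‖))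

namespace ConicFoliation

variable {M : Set V} {r C : ℝ} {f : V → V → ℂ}

lemma norm_pos (h : ConicFoliation M r C f) {q : V} (hq : q ∈ M) : 0 < ‖q‖ :=
  norm_pos_iff.2 fun h0 => h.zero_notMem (h0 ▸ hq)

lemma radius_pos (h : ConicFoliation M r C f) {q : V} (hq : q ∈ M) : 0 < r * ‖q‖ :=
  mul_pos h.r_pos (h.norm_pos hq)

lemma mem_ball_self (h : ConicFoliation M r C f) {q : V} (hq : q ∈ M) :
    q ∈ ball q (r * ‖q‖) := Metric.mem_ball_self (h.radius_pos hq)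

variable [FiniteDimensional ℂ V]

lemma exists_leaf_disc (h : ConicFoliation M r C f) {q : V} (hq : q ∈ M) {u w : V}
    (hu : fderiv ℂ (f q) q u = 0) (hw : fderiv ℂ (f q) q w ≠ 0) :
    ∃ β : ℂ → ℂ, ∃ ε > 0, DifferentiableOn ℂ β (ball 0 ε) ∧ β 0 = 0 ∧ deriv β 0 = 0 ∧
      ∀ t ∈ ball (0 : ℂ) ε, q + t • u + β t • w ∈ ball q (r * ‖q‖) ∧ q + t • u + β t • w ∈ M := by
  set L : ℂ × ℂ → V := fun x => q + x.1 • u + x.2 • w with hL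
  have hLd : Differentiable ℂ L := by fun_prop
  have hL0 : L (0, 0) = q := by simp [hL]
  have hdq := h.differentiableOn q hq
  have hF : DifferentiableOn ℂ (f q ∘ L) (L ⁻¹' ball q (r * ‖q‖)) :=
    hdq.comp hLd.differentiableOn (mapsTo_preimage _ _)
  have hLder : HasFDerivAt L ((ContinuousLinearMap.fst ℂ ℂ ℂ).smulRight u +
      (ContinuousLinearMap.snd ℂ ℂ ℂ).smulRight w) (0, 0) := by
    have h1 : HasFDerivAt (fun x : ℂ × ℂ => x.1 • u)
        ((ContinuousLinearMap.fst ℂ ℂ ℂ).smulRight u) (0, 0) :=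
      ((ContinuousLinearMap.fst ℂ ℂ ℂ).smulRight u).hasFDerivAt
    have h2 : HasFDerivAt (fun x : ℂ × ℂ => x.2 • w)
        ((ContinuousLinearMap.snd ℂ ℂ ℂ).smulRight w) (0, 0) :=
      ((ContinuousLinearMap.snd ℂ ℂ ℂ).smulRight w).hasFDerivAt
    exact (h1.const_add q).add h2
  have hfq : HasFDerivAt (f q) (fderiv ℂ (f q) q) (L (0, 0)) := by
    rw [hL0]
    exact (hdq.differentiableAt (isOpen_ball.mem_nhds (h.mem_ball_self hq))).hasFDerivAt
  have hcomp := hfq.comp ((0 : ℂ), (0 : ℂ)) hLder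
  obtain ⟨S, ε, hε, hSd, hS0, hS, -⟩ := exists_implicit_function (x₀ := (0 : ℂ)) (s₀ := (0 : ℂ))
    (isOpen_ball.preimage hLd.continuous) hF
    (by rw [mem_preimage, hL0]; exact h.mem_ball_self hq)
    (by rw [hcomp.fderiv]; simpa using hw)
  have hmem : ∀ t ∈ ball (0 : ℂ) ε, q + t • u + S t • w ∈ ball q (r * ‖q‖) ∧
      f q (q + t • u + S t • w) = f q q := by
    intro t ht
    have := hS t ht
    exact ⟨this.1, by simpa [hL] using this.2⟩
  refine ⟨S, ε, hε, hSd, hS0, ?_, fun t ht => ⟨(hmem t ht).1,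
    h.leaf q hq q hq (h.mem_ball_self hq) _ (hmem t ht).1 (hmem t ht).2⟩⟩
  have hSder : HasDerivAt S (deriv S 0) 0 :=
    (hSd.differentiableAt (ball_mem_nhds _ hε)).hasDerivAt
  have hcurve : HasDerivAt (fun t : ℂ => q + t • u + S t • w) (u + deriv S 0 • w) 0 := by
    have h1 : HasDerivAt (fun t : ℂ => q + t • u) u 0 := by
      simpa using ((hasDerivAt_id (0 : ℂ)).smul_const u).const_add q
    exact h1.add (hSder.smul_const w)
  have hfq' : HasFDerivAt (f q) (fderiv ℂ (f q) q) (q + (0 : ℂ) • u + S 0 • w) := by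
    rw [hS0]; simpa [hL] using hfq
  have hc2 := hfq'.comp_hasDerivAt (0 : ℂ) hcurve
  have hc3 : HasDerivAt (f q ∘ fun t : ℂ => q + t • u + S t • w) 0 0 := by
    refine (hasDerivAt_const (0 : ℂ) (f q q)).congr_of_eventuallyEq ?_
    filter_upwards [ball_mem_nhds (0 : ℂ) hε] with t ht
    exact (hmem t ht).2
  have := hc2.unique hc3
  rw [map_add, hu, map_smul, zero_add, smul_eq_mul, mul_eq_zero] at this
  exact this.resolve_right hw

end ConicFoliation

/-- The exterior derivative of a one-form. -/
def extDerivAt (A : V → V →L[ℂ] ℂ) (z v w : V) : ℂ := fderiv ℂ A z v w - fderiv ℂ A z w v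

namespace ConicFoliation

variable {M : Set V} {r C : ℝ} {f : V → V → ℂ} [FiniteDimensional ℂ V]

lemma extDerivAt_eq_smul (h : ConicFoliation M r C f) {A : V → V →L[ℂ] ℂ}
    (hA : Differentiable ℂ A) (hne : ∀ z ∈ M, A z ≠ 0)
    (hpar : ∀ q ∈ M, ∀ z ∈ ball q (r * ‖q‖), ∃ k : ℂ, A z = k • fderiv ℂ (f q) z)
    {z v : V} (hz : z ∈ M) (hv : A z v = 0) : ∃ c : ℂ, ∀ w, extDerivAt A z v w = c * A z w := by
  have : CompleteSpace V := FiniteDimensional.complete ℂ V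
  have hzb := h.mem_ball_self hz
  set G := fderiv ℂ (f z) with hG
  have hGd : DifferentiableOn ℂ G (ball z (r * ‖z‖)) :=
    differentiableOn_fderiv isOpen_ball (h.differentiableOn z hz)
  have hGz : DifferentiableAt ℂ G z := hGd.differentiableAt (isOpen_ball.mem_nhds hzb)
  have hGne : G z ≠ 0 := by
    intro h0
    have := h.one_le z hz z hzb
    rw [← hG, h0, norm_zero] at this
    linarith
  obtain ⟨w₀, hw₀⟩ : ∃ w₀, G z w₀ ≠ 0 := by
    by_contra! hcon
    exact hGne (ContinuousLinearMap.ext hcon)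
  set κ : V → ℂ := fun y => A y w₀ / G y w₀ with hκ
  have hGw : DifferentiableAt ℂ (fun y => G y w₀) z := hGz.clm_apply (differentiableAt_const _)
  have hAw : DifferentiableAt ℂ (fun y => A y w₀) z := (hA z).clm_apply (differentiableAt_const _)
  have hκd : DifferentiableAt ℂ κ z := by
    simp only [hκ, div_eq_mul_inv]
    exact hAw.mul (hGw.fun_inv hw₀)
  have hev : A =ᶠ[𝓝 z] fun y => κ y • G y := by
    filter_upwards [isOpen_ball.mem_nhds hzb, hGw.continuousAt.eventually_ne hw₀] with y hy hy0
    obtain ⟨k, hk⟩ := hpar z hz y hy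
    have : κ y = k := by
      simp only [hκ]
      rw [hk]
      simp only [smul_apply, smul_eq_mul]
      exact mul_div_cancel_right₀ _ hy0
    rw [this, hk]
  have hAz : A z = κ z • G z := hev.eq_of_nhds
  have hκne : κ z ≠ 0 := by
    intro h0
    exact hne z hz (by ext w; rw [hAz, h0, smul_apply, zero_smul, zero_apply])
  have hGv : G z v = 0 := by
    have := hv
    rw [hAz, smul_apply, smul_eq_mul, mul_eq_zero] at this
    exact this.resolve_left hκne
  have hfd : fderiv ℂ A z = κ z • fderiv ℂ G z + (fderiv ℂ κ z).smulRight (G z) := by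
    rw [hev.fderiv_eq]
    exact (hκd.hasFDerivAt.smul hGz.hasFDerivAt).fderiv
  have hsymm : ∀ a b, fderiv ℂ G z a b = fderiv ℂ G z b a := by
    intro a b
    have hc : ContDiffAt ℂ (2 : ℕ) (f z) z :=
      (contDiffOn_of_differentiableOn_complex isOpen_ball 2 (h.differentiableOn z hz)).contDiffAt
        (isOpen_ball.mem_nhds hzb)
    exact (hc.isSymmSndFDerivAt (by simp)) a b
  refine ⟨fderiv ℂ κ z v / κ z, fun w => ?_⟩
  simp only [extDerivAt, hfd, hAz, add_apply, smul_apply,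
    ContinuousLinearMap.smulRight_apply, smul_eq_mul, hGv]
  rw [hsymm v w]
  field_simp
  ring

end ConicFoliation

end Conic

section ClosedForm

variable {V : Type*} [NormedAddCommGroup V] [InnerProductSpace ℂ V] [FiniteDimensional ℂ V]

lemma continuous_fderiv_of_differentiable {F : Type*} [NormedAddCommGroup F] [NormedSpace ℂ F]
    [CompleteSpace F] {A : V → F} (hA : Differentiable ℂ A) : Differentiable ℂ (fderiv ℂ A) := by
  have := differentiableOn_fderiv isOpen_univ hA.differentiableOn
  exact differentiableOn_univ.1 this

lemma extDerivAt_smul_smul {A : V → V →L[ℂ] ℂ} (hA : Differentiable ℂ A) {D : ℕ}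
    (hD : ∀ (c : ℂ) (z : V), A (c • z) = c ^ D • A z) (c s : ℂ) (z v w : V) :
    c * extDerivAt A (c • z) (s • v) w = c ^ D * (s * extDerivAt A z v w) := by
  have key : (fderiv ℂ A (c • z)).comp (c • ContinuousLinearMap.id ℂ V) = c ^ D • fderiv ℂ A z := by
    have h1 : HasFDerivAt (fun y => A (c • y))
        ((fderiv ℂ A (c • z)).comp (c • ContinuousLinearMap.id ℂ V)) z :=
      (hA (c • z)).hasFDerivAt.comp z ((hasFDerivAt_id z).const_smul c)
    have h2 : HasFDerivAt (fun y => A (c • y)) (c ^ D • fderiv ℂ A z) z := by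
      simp only [hD]
      exact (hA z).hasFDerivAt.fun_const_smul _
    exact h1.unique h2
  have k1 : ∀ a b, c * fderiv ℂ A (c • z) a b = c ^ D * fderiv ℂ A z a b := by
    intro a b
    have := congrArg (fun T : V →L[ℂ] V →L[ℂ] ℂ => T a b) key
    simpa using this
  simp only [extDerivAt, map_smul, smul_apply, smul_eq_mul]
  linear_combination s * k1 v w - s * k1 w v

lemma fderiv_self_eq_smul {A : V → V →L[ℂ] ℂ} (hA : Differentiable ℂ A) {D : ℕ}
    (hD : ∀ (c : ℂ) (z : V), A (c • z) = c ^ D • A z) (z : V) :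
    fderiv ℂ A z z = (D : ℂ) • A z := by
  have h1 : HasDerivAt (fun c : ℂ => A (c • z)) (fderiv ℂ A z z) 1 := by
    have h0 : HasDerivAt (fun c : ℂ => c • z) z 1 := by
      simpa using (hasDerivAt_id (1 : ℂ)).smul_const z
    have hf : HasFDerivAt A (fderiv ℂ A z) ((1 : ℂ) • z) := by
      rw [one_smul]; exact (hA z).hasFDerivAt
    exact hf.comp_hasDerivAt (1 : ℂ) h0
  have h2 : HasDerivAt (fun c : ℂ => A (c • z)) ((D : ℂ) • A z) 1 := by
    simp only [hD]
    simpa using (hasDerivAt_pow D (1 : ℂ)).smul_const (A z)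
  exact h1.unique h2

namespace ConicFoliation

variable {M : Set V} {r C : ℝ} {f : V → V → ℂ}

lemma isCompact_inter_sphere (h : ConicFoliation M r C f) : IsCompact (M ∩ sphere 0 1) := by
  have : ProperSpace V := FiniteDimensional.proper ℂ V
  have hc : M ∩ sphere (0 : V) 1 = closure M ∩ sphere 0 1 := by
    ext z
    refine ⟨fun hz => ⟨subset_closure hz.1, hz.2⟩, fun hz => ⟨h.mem_of_closure z hz.1 ?_, hz.2⟩⟩
    exact ne_of_mem_sphere hz.2 one_ne_zero
  rw [hc]
  exact (isCompact_sphere 0 1).inter_left isClosed_closure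

lemma inv_norm_smul_mem (h : ConicFoliation M r C f) {z : V} (hz : z ∈ M) :
    ((‖z‖⁻¹ : ℝ) : ℂ) • z ∈ M ∩ sphere 0 1 := by
  have := (h.norm_pos hz)
  refine ⟨h.smul_mem _ (by exact_mod_cast this.ne'.symm ∘ fun h => by simpa using h.symm) z hz, ?_⟩
  simp [this.ne', norm_smul]

/-- A foliation of this type is not globally given by a homogeneous one-form without zeros
along `M`. -/
theorem false_of_form (h : ConicFoliation M r C f) (hV : 4 ≤ Module.finrank ℂ V)
    {A : V → V →L[ℂ] ℂ} (hA : Differentiable ℂ A) {D : ℕ}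
    (hD : ∀ (c : ℂ) (z : V), A (c • z) = c ^ D • A z) (hne : ∀ z ∈ M, A z ≠ 0)
    (hpar : ∀ q ∈ M, ∀ z ∈ ball q (r * ‖q‖), ∃ k : ℂ, A z = k • fderiv ℂ (f q) z) : False := by
  have : CompleteSpace V := FiniteDimensional.complete ℂ V
  have : ProperSpace V := FiniteDimensional.proper ℂ V
  have hdA := continuous_fderiv_of_differentiable hA
  have hAc := hA.continuous
  have hdAc := hdA.continuous
  have hrad : ∀ q ∈ M, ∀ z ∈ ball q (r * ‖q‖), A z z = 0 := by
    intro q hq z hz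
    obtain ⟨k, hk⟩ := hpar q hq z hz
    rw [hk, smul_apply, h.radial q hq z hz, smul_zero]
  set W : V → V := fun z => (InnerProductSpace.toDual ℂ V).symm (A z) with hW
  have hWc : Continuous W := (InnerProductSpace.toDual ℂ V).symm.continuous.comp hAc
  have hWA : ∀ z y, inner ℂ (W z) y = A z y := fun z y => InnerProductSpace.toDual_symm_apply
  have hWne : ∀ z ∈ M, A z (W z) ≠ 0 := by
    intro z hz h0
    rw [← hWA, inner_self_eq_zero] at h0
    exact hne z hz (by simpa [hW] using h0)
  set g : V × V → ℂ := fun x => extDerivAt A x.1 x.2 (W x.1) / A x.1 (W x.1) with hg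
  set K : Set (V × V) := ((M ∩ sphere 0 1) ×ˢ sphere 0 1) ∩ {x | A x.1 x.2 = 0} with hK
  have hKc : IsCompact K :=
    (h.isCompact_inter_sphere.prod (isCompact_sphere 0 1)).inter_right
      (isClosed_eq (by fun_prop) continuous_const)
  have hgc : ContinuousOn g K := by
    refine ContinuousOn.div ?_ ?_ fun x hx => hWne _ hx.1.1.1
    · simp only [extDerivAt]; fun_prop
    · fun_prop
  have hgw : ∀ z ∈ M, ∀ v, A z v = 0 → ∀ w, extDerivAt A z v w = g (z, v) * A z w := by
    intro z hz v hv w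
    obtain ⟨c, hc⟩ := h.extDerivAt_eq_smul hA hne hpar hz hv
    have : g (z, v) = c := by
      simp only [hg]
      rw [hc]
      exact mul_div_cancel_right₀ _ (hWne z hz)
    rw [this, hc]
  obtain ⟨z₀, hz₀⟩ := h.nonempty
  have hz₁ := h.inv_norm_smul_mem hz₀
  set z₁ := ((‖z₀‖⁻¹ : ℝ) : ℂ) • z₀ with hz₁def
  have hz₁K : (z₁, z₁) ∈ K := ⟨⟨hz₁, hz₁.2⟩, hrad z₁ hz₁.1 z₁ (h.mem_ball_self hz₁.1)⟩
  have hgz₁ : g (z₁, z₁) = D + 1 := by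
    have e1 : ∀ w, fderiv ℂ A z₁ w z₁ + A z₁ w = 0 := by
      intro w
      have h1 : HasFDerivAt (fun y => A y y)
          ((A z₁).comp (ContinuousLinearMap.id ℂ V) + (fderiv ℂ A z₁).flip z₁) z₁ :=
        (hA z₁).hasFDerivAt.clm_apply (hasFDerivAt_id z₁)
      have h2 : HasFDerivAt (fun y => A y y) (0 : V →L[ℂ] ℂ) z₁ := by
        refine (hasFDerivAt_const (0 : ℂ) z₁).congr_of_eventuallyEq ?_
        filter_upwards [isOpen_ball.mem_nhds (h.mem_ball_self hz₁.1)] with y hy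
        exact hrad z₁ hz₁.1 y hy
      have := congrArg (fun T : V →L[ℂ] ℂ => T w) (h1.unique h2)
      simpa [add_comm] using this
    have e2 : extDerivAt A z₁ z₁ (W z₁) = (D + 1) * A z₁ (W z₁) := by
      rw [extDerivAt, fderiv_self_eq_smul hA hD]
      have := e1 (W z₁)
      simp only [smul_apply, smul_eq_mul]
      linear_combination -this
    simp only [hg]
    rw [e2]
    exact mul_div_cancel_right₀ _ (hWne _ hz₁.1)
  obtain ⟨⟨q, v₀⟩, hqK, hmax⟩ := hKc.exists_isMaxOn ⟨_, hz₁K⟩ hgc.norm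
  have hqM : q ∈ M := hqK.1.1.1
  have hq1 : ‖q‖ = 1 := by simpa using hqK.1.1.2
  have hv1 : ‖v₀‖ = 1 := by simpa using hqK.1.2
  have hAv₀ : A q v₀ = 0 := hqK.2
  set μ := ‖g (q, v₀)‖ with hμ
  have hμpos : 0 < μ := by
    have h1 : ‖g (z₁, z₁)‖ ≤ μ := hmax hz₁K
    have h2 : (0 : ℝ) < ‖g (z₁, z₁)‖ := by
      rw [hgz₁, norm_pos_iff]
      exact_mod_cast Nat.succ_ne_zero D
    linarith
  have hbound : ∀ z ∈ M, ∀ v c, A z v = 0 → (∀ w, extDerivAt A z v w = c * A z w) →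
      ‖c‖ * ‖z‖ ≤ μ * ‖v‖ := by
    intro z hz v c hv hc
    rcases eq_or_ne v 0 with rfl | hv0
    · have : c = 0 := by
        have := hc (W z)
        simp only [extDerivAt, map_zero, zero_apply, sub_zero] at this
        exact (mul_eq_zero.1 this.symm).resolve_right (hWne z hz)
      simp [this]
    have hzp := h.norm_pos hz
    have hvp := norm_pos_iff.2 hv0
    set l : ℂ := ((‖z‖⁻¹ : ℝ) : ℂ) with hl
    set s : ℂ := ((‖v‖⁻¹ : ℝ) : ℂ) with hs
    have hl0 : l ≠ 0 := by simp [hl, hzp.ne']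
    have hmem := h.inv_norm_smul_mem hz
    have hA0 : A (l • z) (s • v) = 0 := by simp [hD, hv]
    have hsv : s • v ∈ sphere (0 : V) 1 := by simp [hs, norm_smul, hvp.ne']
    have h1 : ‖g (l • z, s • v)‖ ≤ μ := hmax (⟨⟨hmem, hsv⟩, hA0⟩ : (l • z, s • v) ∈ K)
    have h2 := hgw (l • z) hmem.1 (s • v) hA0 (W z)
    have h3 := extDerivAt_smul_smul hA hD l s z v (W z)
    rw [h2, hc, hD, smul_apply, smul_eq_mul] at h3
    have h4 : l * g (l • z, s • v) = s * c := by
      have hne' : l ^ D * A z (W z) ≠ 0 := mul_ne_zero (pow_ne_zero _ hl0) (hWne z hz)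
      apply mul_right_cancel₀ hne'
      linear_combination h3
    have h5 : ‖z‖⁻¹ * ‖g (l • z, s • v)‖ = ‖v‖⁻¹ * ‖c‖ := by
      have := congrArg norm h4
      simpa [hl, hs] using this
    have h6 : ‖c‖ * ‖z‖ = ‖g (l • z, s • v)‖ * ‖v‖ := by
      field_simp at h5
      linarith
    rw [h6]
    gcongr
  -- a leaf direction orthogonal to `q` along which `v₀` extends to second order
  obtain ⟨u, hu0, hAu, hqu, hdu⟩ : ∃ u : V, u ≠ 0 ∧ A q u = 0 ∧ inner ℂ q u = 0 ∧
      fderiv ℂ A q u v₀ = 0 := by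
    let T : V →ₗ[ℂ] (Fin 3 → ℂ) := LinearMap.pi ![(A q : V →ₗ[ℂ] ℂ), (innerSL ℂ q : V →ₗ[ℂ] ℂ),
      ((fderiv ℂ A q).flip v₀ : V →ₗ[ℂ] ℂ)]
    have hT : LinearMap.ker T ≠ ⊥ := LinearMap.ker_ne_bot_of_finrank_lt (by simp; omega)
    obtain ⟨u, hu, hu0⟩ := (Submodule.ne_bot_iff _).1 hT
    have hu' := LinearMap.mem_ker.1 hu
    refine ⟨u, hu0, ?_, ?_, ?_⟩
    · simpa [T] using congrFun hu' 0
    · simpa [T] using congrFun hu' 1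
    · simpa [T] using congrFun hu' 2
  set w := W q with hw
  have hAw : A q w ≠ 0 := hWne q hqM
  obtain ⟨k, hk⟩ := hpar q hqM q (h.mem_ball_self hqM)
  have hk0 : k ≠ 0 := by
    rintro rfl
    exact hAw (by rw [hk]; simp)
  have hfu : fderiv ℂ (f q) q u = 0 := by
    have := hAu
    rw [hk, smul_apply, smul_eq_mul, mul_eq_zero] at this
    exact this.resolve_left hk0
  have hfw : fderiv ℂ (f q) q w ≠ 0 := by
    intro h0
    exact hAw (by rw [hk, smul_apply, h0, smul_zero])
  obtain ⟨β₁, ε, hε, hβ₁d, hβ₁0, hβ₁', hmem⟩ := h.exists_leaf_disc hqM hfu hfw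
  set Z : ℂ → V := fun t => q + t • u + β₁ t • w with hZ
  have hZ0 : Z 0 = q := by simp [hZ, hβ₁0]
  have hZd : DifferentiableOn ℂ Z (ball 0 ε) := by
    simp only [hZ]
    fun_prop
  have hZder : HasDerivAt Z u 0 := by
    have h1 : HasDerivAt (fun t : ℂ => q + t • u) u 0 := by
      simpa using ((hasDerivAt_id (0 : ℂ)).smul_const u).const_add q
    have h2 : HasDerivAt β₁ (deriv β₁ 0) 0 :=
      (hβ₁d.differentiableAt (ball_mem_nhds _ hε)).hasDerivAt
    simpa [hβ₁'] using h1.fun_add (h2.smul_const w)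
  have hAwc : ∀ᶠ t in 𝓝 (0 : ℂ), A (Z t) w ≠ 0 := by
    have hc : ContinuousAt (fun t => A (Z t) w) 0 :=
      (hAc.continuousAt.comp hZder.continuousAt).clm_apply continuousAt_const
    exact hc.eventually_ne (by simpa [hZ0] using hAw)
  set β : ℂ → ℂ := fun t => A (Z t) v₀ / A (Z t) w with hβ
  have hβ0 : β 0 = 0 := by simp [hβ, hZ0, hAv₀]
  have hAZ : ∀ t, DifferentiableAt ℂ Z t → DifferentiableAt ℂ (fun t => A (Z t)) t :=
    fun t ht => (hA (Z t)).comp t ht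
  have hβder : HasDerivAt β 0 0 := by
    have hAZ0 : HasDerivAt (fun t => A (Z t)) (fderiv ℂ A q u) 0 := by
      have h1 : HasFDerivAt A (fderiv ℂ A q) (Z 0) := by rw [hZ0]; exact (hA q).hasFDerivAt
      exact h1.comp_hasDerivAt (0 : ℂ) hZder
    have h2 : HasDerivAt (fun t => A (Z t) v₀) (fderiv ℂ A q u v₀) 0 := by
      simpa using hAZ0.clm_apply (hasDerivAt_const (0 : ℂ) v₀)
    have h3 : HasDerivAt (fun t => A (Z t) w) (fderiv ℂ A q u w) 0 := by
      simpa using hAZ0.clm_apply (hasDerivAt_const (0 : ℂ) w)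
    have h4 := h2.fun_div h3 (by simpa [hZ0] using hAw)
    simpa [hdu, hZ0, hAv₀] using h4
  set v : ℂ → V := fun t => v₀ - β t • w with hv
  have hAv : ∀ᶠ t in 𝓝 (0 : ℂ), A (Z t) (v t) = 0 := by
    filter_upwards [hAwc] with t ht
    simp only [hv, hβ, map_sub, map_smul, smul_eq_mul]
    rw [div_mul_cancel₀ _ ht, sub_self]
  set c : ℂ → ℂ := fun t => extDerivAt A (Z t) (v t) w / A (Z t) w with hc
  have hcd : ∀ᶠ t in 𝓝 (0 : ℂ), DifferentiableAt ℂ c t := by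
    filter_upwards [hAwc, ball_mem_nhds (0 : ℂ) hε] with t ht htb
    have hZt : DifferentiableAt ℂ Z t := hZd.differentiableAt (isOpen_ball.mem_nhds htb)
    have hβt : DifferentiableAt ℂ β t :=
      ((hAZ t hZt).clm_apply (differentiableAt_const _)).fun_div
        ((hAZ t hZt).clm_apply (differentiableAt_const _)) ht
    have hvt : DifferentiableAt ℂ v t := (hβt.smul_const w).const_sub v₀
    have hdZ : DifferentiableAt ℂ (fun t => fderiv ℂ A (Z t)) t := (hdA (Z t)).comp t hZt
    refine DifferentiableAt.fun_div ?_ ((hAZ t hZt).clm_apply (differentiableAt_const _)) ht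
    exact ((hdZ.clm_apply hvt).clm_apply (differentiableAt_const _)).sub
      ((hdZ.clm_apply (differentiableAt_const _)).clm_apply hvt)
  have hcle : ∀ᶠ t in 𝓝 (0 : ℂ), ‖c t‖ * ‖Z t‖ ≤ μ * ‖v t‖ := by
    filter_upwards [hAwc, hAv, ball_mem_nhds (0 : ℂ) hε] with t ht hvt htb
    refine hbound (Z t) (hmem t htb).2 (v t) (c t) hvt ?_
    obtain ⟨c', hc'⟩ := h.extDerivAt_eq_smul hA hne hpar (hmem t htb).2 hvt
    have : c t = c' := by
      simp only [hc]
      rw [hc']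
      exact mul_div_cancel_right₀ _ ht
    rw [this]
    exact hc'
  have hc0 : ‖c 0‖ = μ := by
    simp only [hc, hμ, hg, hv, hβ0, zero_smul, sub_zero, hZ0, hw]
  have hwq : inner ℂ w q = 0 := by rw [hw, hWA]; exact hrad q hqM q (h.mem_ball_self hqM)
  have hwu : inner ℂ w u = 0 := by rw [hw, hWA]; exact hAu
  have hwv : inner ℂ w v₀ = 0 := by rw [hw, hWA]; exact hAv₀
  have hnZ : ∀ t, 1 + ‖t‖ ^ 2 * ‖u‖ ^ 2 ≤ ‖Z t‖ ^ 2 := by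
    intro t
    have h1 : ‖q + t • u‖ ^ 2 = 1 + ‖t‖ ^ 2 * ‖u‖ ^ 2 := by
      have := norm_add_sq_eq_norm_sq_add_norm_sq_of_inner_eq_zero q (t • u)
        (by rw [inner_smul_right, hqu, mul_zero])
      rw [sq, this, norm_smul, hq1]
      ring
    have h2 : ‖Z t‖ ^ 2 = ‖q + t • u‖ ^ 2 + ‖β₁ t • w‖ ^ 2 := by
      have h0 : inner ℂ (q + t • u) (β₁ t • w) = 0 := by
        rw [inner_smul_right, inner_add_left, inner_smul_left, inner_eq_zero_symm.1 hwq,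
          inner_eq_zero_symm.1 hwu]
        simp
      have := norm_add_sq_eq_norm_sq_add_norm_sq_of_inner_eq_zero _ _ h0
      simp only [hZ, sq]
      exact this
    rw [h2, h1]
    nlinarith [sq_nonneg ‖β₁ t • w‖]
  have hnv : ∀ t, ‖v t‖ ^ 2 = 1 + ‖β t‖ ^ 2 * ‖w‖ ^ 2 := by
    intro t
    have h0 : inner ℂ v₀ (-(β t • w)) = 0 := by
      rw [inner_neg_right, inner_smul_right, inner_eq_zero_symm.1 hwv]
      simp
    have := norm_add_sq_eq_norm_sq_add_norm_sq_of_inner_eq_zero _ _ h0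
    simp only [hv, sub_eq_add_neg]
    rw [sq, this, norm_neg, norm_smul, hv1]
    ring
  have hup : 0 < ‖u‖ := norm_pos_iff.2 hu0
  have hβo : ∀ᶠ t in 𝓝 (0 : ℂ), ‖β t‖ * (2 * (‖w‖ + 1)) ≤ ‖t‖ * ‖u‖ := by
    have h1 := hasDerivAt_iff_isLittleO.1 hβder
    simp only [hβ0, sub_zero, smul_zero] at h1
    have hpos : 0 < ‖u‖ / (2 * (‖w‖ + 1)) := by positivity
    filter_upwards [h1.def hpos] with t ht
    have h2w : 0 < 2 * (‖w‖ + 1) := by positivity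
    calc ‖β t‖ * (2 * (‖w‖ + 1)) ≤ ‖u‖ / (2 * (‖w‖ + 1)) * ‖t‖ * (2 * (‖w‖ + 1)) := by gcongr
      _ = ‖t‖ * ‖u‖ := by field_simp
  have hlt : ∀ᶠ t in 𝓝 (0 : ℂ), t ≠ 0 → ‖v t‖ < ‖Z t‖ := by
    filter_upwards [hβo] with t ht ht0
    have htp : 0 < ‖t‖ := norm_pos_iff.2 ht0
    have htu : 0 < ‖t‖ * ‖u‖ := mul_pos htp hup
    refine lt_of_pow_lt_pow_left₀ 2 (norm_nonneg _) ?_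
    rw [hnv]
    refine lt_of_lt_of_le ?_ (hnZ t)
    have h1 : ‖β t‖ * ‖w‖ < ‖t‖ * ‖u‖ := by
      nlinarith [norm_nonneg (β t), norm_nonneg w, mul_nonneg (norm_nonneg (β t)) (norm_nonneg w)]
    have h2 : 0 ≤ ‖β t‖ * ‖w‖ := by positivity
    nlinarith
  have hle : ∀ᶠ t in 𝓝 (0 : ℂ), t ≠ 0 → ‖c t‖ < μ := by
    filter_upwards [hcle, hlt] with t h1 h2 ht0
    have h3 := h2 ht0
    by_contra! hcon
    have : μ * ‖Z t‖ ≤ ‖c t‖ * ‖Z t‖ := by gcongr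
    nlinarith
  have hlm : IsLocalMax (norm ∘ c) 0 := by
    filter_upwards [hle] with t ht
    rcases eq_or_ne t 0 with rfl | ht0
    · exact le_rfl
    · simp only [Function.comp, hc0]; exact (ht ht0).le
  have hconst := Complex.eventually_eq_of_isLocalMax_norm hcd hlm
  have hfin : ∀ᶠ t in 𝓝[≠] (0 : ℂ), False := by
    filter_upwards [hconst.filter_mono nhdsWithin_le_nhds, hle.filter_mono nhdsWithin_le_nhds,
      self_mem_nhdsWithin] with t h1 h2 h3
    have := h2 h3
    rw [h1, hc0] at this
    exact lt_irrefl _ this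
  exact (eventually_false_iff_eq_bot.1 hfin ▸ (inferInstance : (𝓝[≠] (0 : ℂ)).NeBot)).ne rfl

end ConicFoliation

end ClosedForm

section Sections

variable {V : Type*} [NormedAddCommGroup V] [InnerProductSpace ℂ V] [FiniteDimensional ℂ V]

/-- Local holomorphic functions `σ q` that represent, up to unimodular factors, a section of
the `K`-th power of the conormal bundle which is homogeneous of degree `m`. -/
structure IsSection (M : Set V) (r : ℝ) (f : V → V → ℂ) (K m : ℕ) (σ : V → V → ℂ) : Prop where
  differentiableOn : ∀ q ∈ M, DifferentiableOn ℂ (σ q) (ball q (r * ‖q‖))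
  compat : ∀ q ∈ M, ∀ q' ∈ M, ∀ c : ℂ, c ≠ 0 → ∀ z ∈ ball q (r * ‖q‖),
    c • z ∈ ball q' (r * ‖q'‖) →
    ‖σ q' (c • z)‖ * ‖fderiv ℂ (f q) z‖ ^ K =
      ‖c‖ ^ m * ‖σ q z‖ * ‖fderiv ℂ (f q') (c • z)‖ ^ K

/-- The section `σ` is bounded by `B` on the conic neighbourhood of `M` of aperture `a`. -/
def BoundOn (M : Set V) (r : ℝ) (f : V → V → ℂ) (K m : ℕ) (σ : V → V → ℂ) (a B : ℝ) : Prop :=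
  ∀ q ∈ M, ∀ z ∈ ball q (r * ‖q‖), infDist z M ≤ a * ‖z‖ →
    ‖σ q z‖ ≤ B * ‖z‖ ^ m * ‖fderiv ℂ (f q) z‖ ^ K

variable {M : Set V} {r C : ℝ} {f : V → V → ℂ} {K m : ℕ} {σ : V → V → ℂ} {a B : ℝ}

lemma BoundOn.mono_left {a' : ℝ} (hB : BoundOn M r f K m σ a B) (ha : a' ≤ a) :
    BoundOn M r f K m σ a' B := fun q hq z hz hd =>
  hB q hq z hz (hd.trans (by gcongr))

namespace ConicFoliation

lemma ne_zero_of_mem_ball (h : ConicFoliation M r C f) {q z : V} (hq : q ∈ M)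
    (hz : z ∈ ball q (r * ‖q‖)) : z ≠ 0 := by
  rintro rfl
  have h1 := h.norm_pos hq
  have h2 := h.r_le
  rw [mem_ball, dist_zero_left] at hz
  nlinarith

lemma one_le_C (h : ConicFoliation M r C f) : 1 ≤ C := by
  obtain ⟨q, hq⟩ := h.nonempty
  exact (h.one_le q hq q (h.mem_ball_self hq)).trans (h.le_C q hq q (h.mem_ball_self hq))

lemma fderiv_norm_pos (h : ConicFoliation M r C f) {q z : V} (hq : q ∈ M)
    (hz : z ∈ ball q (r * ‖q‖)) : 0 < ‖fderiv ℂ (f q) z‖ :=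
  zero_lt_one.trans_le (h.one_le q hq z hz)

lemma smul_mem_closure (h : ConicFoliation M r C f) {q : V} (hq : q ∈ M) (c : ℂ) :
    c • q ∈ closure M := by
  have hc : c ∈ closure ({0}ᶜ : Set ℂ) := dense_compl_singleton (0 : ℂ) c
  exact map_mem_closure (f := fun c : ℂ => c • q) (by fun_prop) hc
    fun c hc => h.smul_mem c hc q hq

lemma exists_nearest (h : ConicFoliation M r C f) {z : V} (hz : z ≠ 0)
    (hd : infDist z M ≤ r / 2 * ‖z‖) :
    ∃ q ∈ M, dist z q = infDist z M ∧ z ∈ ball q (r * ‖q‖) ∧ inner ℂ q (z - q) = 0 := by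
  have : ProperSpace V := FiniteDimensional.proper ℂ V
  have hzp := norm_pos_iff.2 hz
  have hr := h.r_le
  have hrp := h.r_pos
  obtain ⟨q, hq, hqd⟩ := isClosed_closure.exists_infDist_eq_dist h.nonempty.closure z
  rw [infDist_closure] at hqd
  have hq0 : q ≠ 0 := by
    rintro rfl
    rw [dist_zero_right] at hqd
    nlinarith
  have hqM := h.mem_of_closure q hq hq0
  refine ⟨q, hqM, hqd.symm, ?_, ?_⟩
  · rw [mem_ball, ← hqd]
    have h1 : ‖z‖ ≤ ‖q‖ + infDist z M := by
      rw [hqd, dist_eq_norm]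
      have := norm_add_le q (z - q)
      simpa using this
    have h2 : r / 2 * ‖z‖ ≤ r / 2 * (‖q‖ + infDist z M) := by gcongr
    have h3 : r * infDist z M ≤ 1 / 10 * infDist z M :=
      mul_le_mul_of_nonneg_right hr infDist_nonneg
    have h4 := h.radius_pos hqM
    nlinarith
  · have hle : ∀ w ∈ Submodule.span ℂ {q}, ‖z - q‖ ≤ ‖z - w‖ := by
      intro w hw
      obtain ⟨c, rfl⟩ := Submodule.mem_span_singleton.1 hw
      rw [← dist_eq_norm, ← dist_eq_norm, ← hqd, ← infDist_closure]
      exact infDist_le_dist_of_mem (h.smul_mem_closure hqM c)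
    have hqs := Submodule.mem_span_singleton_self (R := ℂ) q
    have h1 : ‖z - q‖ = ⨅ w : Submodule.span ℂ {q}, ‖z - w‖ := by
      refine le_antisymm (le_ciInf fun w => hle w w.2) ?_
      exact ciInf_le ⟨0, by rintro _ ⟨w, rfl⟩; exact norm_nonneg _⟩
        (⟨q, hqs⟩ : Submodule.span ℂ {q})
    have h2 := (Submodule.norm_eq_iInf_iff_inner_eq_zero _ hqs).1 h1 q hqs
    exact inner_eq_zero_symm.1 h2

lemma boundOn_of_unit (h : ConicFoliation M r C f) (hσ : IsSection M r f K m σ)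
    (H : ∀ z, ‖z‖ = 1 → infDist z M ≤ a → ∃ q ∈ M, ∃ c : ℂ, c ≠ 0 ∧
      c • z ∈ ball q (r * ‖q‖) ∧
      ‖σ q (c • z)‖ ≤ B * ‖c‖ ^ m * ‖fderiv ℂ (f q) (c • z)‖ ^ K) :
    BoundOn M r f K m σ a B := by
  intro q' hq' z hz hd
  have hz0 := h.ne_zero_of_mem_ball hq' hz
  have hzp := norm_pos_iff.2 hz0
  set s : ℂ := ((‖z‖⁻¹ : ℝ) : ℂ) with hs
  have hsn : ‖s‖ = ‖z‖⁻¹ := by simp [hs]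
  have hs0 : s ≠ 0 := by simp [hs, hz0]
  have hunit : ‖s • z‖ = 1 := by rw [norm_smul, hsn, inv_mul_cancel₀ hzp.ne']
  have hdist : infDist (s • z) M ≤ a := by
    refine le_of_forall_pos_le_add fun ε hε => ?_
    have : infDist z M < (a + ε) * ‖z‖ := by nlinarith
    obtain ⟨y, hy, hyd⟩ := (infDist_lt_iff h.nonempty).1 this
    refine (infDist_le_dist_of_mem (h.smul_mem s hs0 y hy)).trans ?_
    rw [dist_smul₀, hsn]
    calc ‖z‖⁻¹ * dist z y ≤ ‖z‖⁻¹ * ((a + ε) * ‖z‖) := by gcongr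
      _ = a + ε := by field_simp
  obtain ⟨q, hq, c, hc, hcz, hb⟩ := H _ hunit hdist
  rw [smul_smul] at hcz hb
  have hcs : c * s ≠ 0 := mul_ne_zero hc hs0
  have key := hσ.compat q' hq' q hq (c * s) hcs z hz hcz
  have hG := pow_pos (h.fderiv_norm_pos hq hcz) K
  have hG' := pow_pos (h.fderiv_norm_pos hq' hz) K
  have hcp : 0 < ‖c‖ ^ m := pow_pos (norm_pos_iff.2 hc) m
  have h1 : ‖c * s‖ ^ m = ‖c‖ ^ m * (‖z‖ ^ m)⁻¹ := by
    rw [norm_mul, hsn, mul_pow, inv_pow]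
  rw [h1] at key
  have hzm : 0 < ‖z‖ ^ m := pow_pos hzp m
  have h2 : ‖c‖ ^ m * (‖z‖ ^ m)⁻¹ * ‖σ q' z‖ * ‖fderiv ℂ (f q) ((c * s) • z)‖ ^ K ≤
      B * ‖c‖ ^ m * ‖fderiv ℂ (f q) ((c * s) • z)‖ ^ K * ‖fderiv ℂ (f q') z‖ ^ K := by
    rw [← key]; gcongr
  have h3 : (‖c‖ ^ m * (‖z‖ ^ m)⁻¹ * ‖fderiv ℂ (f q) ((c * s) • z)‖ ^ K) * ‖σ q' z‖ ≤
      (‖c‖ ^ m * (‖z‖ ^ m)⁻¹ * ‖fderiv ℂ (f q) ((c * s) • z)‖ ^ K) *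
        (B * ‖z‖ ^ m * ‖fderiv ℂ (f q') z‖ ^ K) := by
    calc _ = ‖c‖ ^ m * (‖z‖ ^ m)⁻¹ * ‖σ q' z‖ * ‖fderiv ℂ (f q) ((c * s) • z)‖ ^ K := by ring
      _ ≤ _ := h2
      _ = _ := by field_simp
  exact le_of_mul_le_mul_left h3 (by positivity)

lemma exists_hull_nhds_of_lt (h : ConicFoliation M r C f) (ha' : a ≤ r / 2) {p : V}
    (hd : infDist p M < a) :
    ∃ a' < a, ∃ Ω ∈ 𝓝 p, ∀ K m σ B, 0 ≤ B → IsSection M r f K m σ → BoundOn M r f K m σ a' B →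
      ∀ z ∈ Ω, ‖z‖ = 1 → ∃ q ∈ M, z ∈ ball q (r * ‖q‖) ∧
        ‖σ q z‖ ≤ C ^ K * 2 ^ m * B * ‖fderiv ℂ (f q) z‖ ^ K := by
  obtain ⟨a', h1, h2⟩ := exists_between hd
  refine ⟨a', h2, {z | infDist z M < a'},
    (isOpen_lt (continuous_infDist_pt M) continuous_const).mem_nhds h1, ?_⟩
  intro K m σ B hB hσ hb z hz hz1
  rw [mem_ofPred_eq] at hz
  have hz0 : z ≠ 0 := norm_ne_zero_iff.1 (by rw [hz1]; exact one_ne_zero)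
  obtain ⟨q, hq, -, hzq, -⟩ := h.exists_nearest hz0 (by rw [hz1]; linarith)
  refine ⟨q, hq, hzq, (hb q hq z hzq (by rw [hz1]; linarith)).trans ?_⟩
  rw [hz1, one_pow, mul_one]
  have hC : 1 ≤ C ^ K * 2 ^ m :=
    one_le_mul_of_one_le_of_one_le (one_le_pow₀ h.one_le_C) (one_le_pow₀ one_le_two)
  gcongr
  exact le_mul_of_one_le_left hB hC

lemma exists_hull_nhds_of_eq (h : ConicFoliation M r C f) (hV : 3 ≤ Module.finrank ℂ V)
    (ha : 0 < a) (ha' : a ≤ r / 2) {p : V} (hp : ‖p‖ = 1) (hd : infDist p M = a) :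
    ∃ a' < a, ∃ Ω ∈ 𝓝 p, ∀ K m σ B, 0 ≤ B → IsSection M r f K m σ → BoundOn M r f K m σ a' B →
      ∀ z ∈ Ω, ‖z‖ = 1 → ∃ q ∈ M, z ∈ ball q (r * ‖q‖) ∧
        ‖σ q z‖ ≤ C ^ K * 2 ^ m * B * ‖fderiv ℂ (f q) z‖ ^ K := by
  have hp0 : p ≠ 0 := norm_ne_zero_iff.1 (by rw [hp]; exact one_ne_zero)
  obtain ⟨q, hq, hqd, hpq, hin⟩ := h.exists_nearest hp0 (by rw [hp, hd]; linarith)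
  set G := fderiv ℂ (f q) q with hG
  have hGq : G q = 0 := h.radial q hq q (h.mem_ball_self hq)
  have hqp : inner ℂ q p ≠ 0 := by
    have h1 : inner ℂ q p = inner ℂ q q := by
      have : p = (p - q) + q := by abel
      rw [this, inner_add_right, hin, zero_add]
    rw [h1]
    exact inner_self_ne_zero.2 (norm_pos_iff.1 (h.norm_pos hq))
  have hpq' : inner ℂ p q ≠ 0 := fun h0 => hqp (inner_eq_zero_symm.1 h0)
  obtain ⟨w, hpw, hGw⟩ : ∃ w, inner ℂ p w = 0 ∧ G w ≠ 0 := by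
    obtain ⟨y, hy⟩ : ∃ y, G y ≠ 0 := by
      by_contra! hcon
      have h1 := h.fderiv_norm_pos hq (h.mem_ball_self hq)
      rw [← hG, show G = 0 from ContinuousLinearMap.ext hcon, norm_zero] at h1
      exact lt_irrefl _ h1
    refine ⟨y - (inner ℂ p y / inner ℂ p q) • q, ?_, ?_⟩
    · rw [inner_sub_right, inner_smul_right, div_mul_cancel₀ _ hpq', sub_self]
    · rw [map_sub, map_smul, hGq, smul_zero, sub_zero]; exact hy
  obtain ⟨u, hu0, hGu, hpu⟩ : ∃ u : V, u ≠ 0 ∧ G u = 0 ∧ inner ℂ p u = 0 := by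
    let T : V →ₗ[ℂ] (Fin 2 → ℂ) := LinearMap.pi ![(G : V →ₗ[ℂ] ℂ), (innerSL ℂ p : V →ₗ[ℂ] ℂ)]
    have hT : LinearMap.ker T ≠ ⊥ := LinearMap.ker_ne_bot_of_finrank_lt (by simp; omega)
    obtain ⟨u, hu, hu0⟩ := (Submodule.ne_bot_iff _).1 hT
    have hu' := LinearMap.mem_ker.1 hu
    refine ⟨u, hu0, ?_, ?_⟩
    · simpa [T] using congrFun hu' 0
    · simpa [T] using congrFun hu' 1
  obtain ⟨β, ε, hε, hβd, hβ0, hβ', hmem⟩ := h.exists_leaf_disc hq hGu hGw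
  set D : ℂ → V := fun t => t • u + β t • w with hD
  have hD0 : D 0 = 0 := by simp [hD, hβ0]
  have hDd : DifferentiableOn ℂ D (ball 0 ε) := by
    simp only [hD]; fun_prop
  have hDder : HasDerivAt D u 0 := by
    have h2 : HasDerivAt β (deriv β 0) 0 :=
      (hβd.differentiableAt (ball_mem_nhds _ hε)).hasDerivAt
    simpa [hβ'] using ((hasDerivAt_id (0 : ℂ)).smul_const u).fun_add (h2.smul_const w)
  have hpD : ∀ t, inner ℂ p (D t) = 0 := by
    intro t
    simp only [hD]
    rw [inner_add_right, inner_smul_right, inner_smul_right, hpu, hpw]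
    simp
  -- a small circle along which the disc stays away from the origin
  have hev1 : ∀ᶠ t in 𝓝[≠] (0 : ℂ), D t ≠ 0 := by
    have := hDder.eventually_ne (c := 0) hu0
    exact this
  have hev1' : ∀ᶠ t in 𝓝 (0 : ℂ), t ≠ 0 → D t ≠ 0 := eventually_nhdsWithin_iff.1 hev1
  obtain ⟨η, hη, hηball⟩ := Metric.isOpen_ball.mem_nhds hpq |> Metric.mem_nhds_iff.1
  have hev2 : ∀ᶠ t in 𝓝 (0 : ℂ), ‖D t‖ < min (η / 2) 1 := by
    have : ContinuousAt (fun t => ‖D t‖) 0 := hDder.continuousAt.norm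
    exact this.eventually_lt continuousAt_const (by rw [hD0, norm_zero]; positivity)
  obtain ⟨τ₀, hτ₀, hτ⟩ := Metric.eventually_nhds_iff_ball.1
    (hev1'.and (hev2.and (ball_mem_nhds (0 : ℂ) hε)))
  set τ := τ₀ / 2 with hτdef
  have hτp : 0 < τ := by positivity
  have hcb : closedBall (0 : ℂ) τ ⊆ ball 0 τ₀ := closedBall_subset_ball (by linarith)
  have hDc : ContinuousOn D (closedBall 0 τ) :=
    hDd.continuousOn.mono fun t ht => (hτ t (hcb ht)).2.2
  have hlt : ∀ t ∈ sphere (0 : ℂ) τ, infDist (p + D t) M < a * ‖p + D t‖ := by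
    intro t ht
    have ht' := hτ t (hcb (sphere_subset_closedBall ht))
    have hDt : D t ≠ 0 := ht'.1 (ne_of_mem_sphere ht hτp.ne')
    have h1 : infDist (p + D t) M ≤ a := by
      have hm : q + D t ∈ M := by
        have := (hmem t ht'.2.2).2
        rwa [add_assoc] at this
      refine (infDist_le_dist_of_mem hm).trans ?_
      rw [dist_add_right, hqd, hd]
    have h2 : 1 < ‖p + D t‖ := by
      have := norm_add_sq_eq_norm_sq_add_norm_sq_of_inner_eq_zero p (D t) (hpD t)
      have h3 := norm_pos_iff.2 hDt
      rw [hp] at this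
      nlinarith [norm_nonneg (p + D t)]
    nlinarith
  obtain ⟨a', ha'a, hΩ⟩ : ∃ a' < a, ∀ᶠ z in 𝓝 p, ∀ t ∈ sphere (0 : ℂ) τ,
      infDist (z + D t) M ≤ a' * ‖z + D t‖ := by
    have hSc : IsCompact (sphere (0 : ℂ) τ) := isCompact_sphere 0 τ
    have hDs : ContinuousOn D (sphere 0 τ) := hDc.mono sphere_subset_closedBall
    have hpos : ∀ t ∈ sphere (0 : ℂ) τ, 0 < ‖p + D t‖ := by
      intro t ht
      have := hlt t ht
      have h0 := infDist_nonneg (s := M) (x := p + D t)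
      nlinarith
    have hcont : ContinuousOn (fun t => infDist (p + D t) M / ‖p + D t‖) (sphere 0 τ) := by
      refine ContinuousOn.div ?_ ?_ fun t ht => (hpos t ht).ne'
      · exact (continuous_infDist_pt M).comp_continuousOn (continuousOn_const.add hDs)
      · exact (continuousOn_const.add hDs).norm
    obtain ⟨t₀, ht₀, hmax⟩ := hSc.exists_isMaxOn
      (NormedSpace.sphere_nonempty.2 hτp.le) hcont
    have h1 : infDist (p + D t₀) M / ‖p + D t₀‖ < a :=
      (div_lt_iff₀ (hpos t₀ ht₀)).2 (hlt t₀ ht₀)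
    obtain ⟨a', h2, h3⟩ := exists_between h1
    refine ⟨a', h3, ?_⟩
    have hlt' : ∀ t ∈ sphere (0 : ℂ) τ, infDist (p + D t) M < a' * ‖p + D t‖ := by
      intro t ht
      rw [← div_lt_iff₀ (hpos t ht)]
      exact (hmax ht).trans_lt h2
    have hcomp : ∀ t : sphere (0 : ℂ) τ, ContinuousAt (fun x : V × sphere (0 : ℂ) τ =>
        x.1 + D x.2) (p, t) := by
      intro t
      have : Continuous (fun t : sphere (0 : ℂ) τ => D t) := hDs.domRestrict
      exact (continuous_fst.add (this.comp continuous_snd)).continuousAt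
    have : ∀ᶠ z in 𝓝 p, ∀ t ∈ (univ : Set (sphere (0 : ℂ) τ)),
        infDist (z + D t) M < a' * ‖z + D t‖ := by
      have : CompactSpace (sphere (0 : ℂ) τ) := isCompact_iff_compactSpace.1 hSc
      refine isCompact_univ.eventually_forall_of_forall_eventually fun t _ => ?_
      refine ContinuousAt.eventually_lt ?_ ?_ (hlt' t t.2)
      · exact ContinuousAt.comp (f := fun x : V × sphere (0 : ℂ) τ => x.1 + D x.2)
          (continuous_infDist_pt M).continuousAt (hcomp t)
      · exact continuousAt_const.mul (hcomp t).norm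
    filter_upwards [this] with z hz t ht
    exact (hz ⟨t, ht⟩ (mem_univ _)).le
  refine ⟨a', ha'a, _, inter_mem (ball_mem_nhds p (half_pos hη)) hΩ, ?_⟩
  rintro K m σ B hB hσ hb z ⟨hzη, hzS⟩ hz1
  have hball : ∀ t ∈ closedBall (0 : ℂ) τ, z + D t ∈ ball q (r * ‖q‖) := by
    intro t ht
    apply hηball
    have h1 := (hτ t (hcb ht)).2.1.trans_le (min_le_left _ _)
    rw [mem_ball, dist_eq_norm] at hzη ⊢
    calc ‖z + D t - p‖ = ‖(z - p) + D t‖ := by congr 1; abel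
      _ ≤ ‖z - p‖ + ‖D t‖ := norm_add_le _ _
      _ < η := by linarith
  have hzq : z ∈ ball q (r * ‖q‖) := by
    have := hball 0 (mem_closedBall_self hτp.le)
    rwa [hD0, add_zero] at this
  refine ⟨q, hq, hzq, ?_⟩
  have hdc : DiffContOnCl ℂ (fun t => σ q (z + D t)) (ball 0 τ) := by
    refine DifferentiableOn.diffContOnCl ?_
    rw [closure_ball _ hτp.ne']
    refine (hσ.differentiableOn q hq).comp ?_ hball
    exact (hDd.mono fun t ht => (hτ t (hcb ht)).2.2).const_add z
  have hfr : ∀ t ∈ frontier (ball (0 : ℂ) τ), ‖σ q (z + D t)‖ ≤ C ^ K * 2 ^ m * B := by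
    intro t ht
    rw [frontier_ball _ hτp.ne'] at ht
    have htc := sphere_subset_closedBall ht
    have h1 := hb q hq (z + D t) (hball t htc) (hzS t ht)
    have h2 : ‖z + D t‖ ≤ 2 := by
      have := (hτ t (hcb htc)).2.1.trans_le (min_le_right _ _)
      have := norm_add_le z (D t)
      linarith
    have h3 := h.le_C q hq _ (hball t htc)
    calc _ ≤ _ := h1
      _ ≤ B * 2 ^ m * C ^ K := by gcongr
      _ = _ := by ring
  have hfin := Complex.norm_le_of_forall_mem_frontier_norm_le isBounded_ball hdc hfr
    (subset_closure (Metric.mem_ball_self hτp))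
  rw [hD0, add_zero] at hfin
  refine hfin.trans (le_mul_of_one_le_right ?_ (one_le_pow₀ (h.one_le q hq z hzq)))
  have := h.one_le_C
  positivity

/-- Pseudoconcavity: bounds on a thin conic neighbourhood of `M` propagate to a wider one. -/
lemma exists_hull (h : ConicFoliation M r C f) (hV : 3 ≤ Module.finrank ℂ V)
    (ha : 0 < a) (ha' : a ≤ r / 2) :
    ∃ a', 0 < a' ∧ a' < a ∧ ∀ K m σ B, 0 ≤ B → IsSection M r f K m σ →
      BoundOn M r f K m σ a' B → BoundOn M r f K m σ a (C ^ K * 2 ^ m * B) := by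
  have : ProperSpace V := FiniteDimensional.proper ℂ V
  have hX : IsCompact (sphere (0 : V) 1 ∩ {z | infDist z M ≤ a}) :=
    (isCompact_sphere 0 1).inter_right
      (isClosed_le (continuous_infDist_pt M) continuous_const)
  have main : ∃ a' < a, ∀ K m σ B, 0 ≤ B → IsSection M r f K m σ → BoundOn M r f K m σ a' B →
      ∀ z ∈ sphere (0 : V) 1 ∩ {z | infDist z M ≤ a}, ‖z‖ = 1 → ∃ q ∈ M, z ∈ ball q (r * ‖q‖) ∧
        ‖σ q z‖ ≤ C ^ K * 2 ^ m * B * ‖fderiv ℂ (f q) z‖ ^ K := by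
    refine hX.induction_on (p := fun S => ∃ a' < a, ∀ K m σ B, 0 ≤ B → IsSection M r f K m σ →
      BoundOn M r f K m σ a' B → ∀ z ∈ S, ‖z‖ = 1 → ∃ q ∈ M, z ∈ ball q (r * ‖q‖) ∧
        ‖σ q z‖ ≤ C ^ K * 2 ^ m * B * ‖fderiv ℂ (f q) z‖ ^ K) ?_ ?_ ?_ ?_
    · exact ⟨0, ha, by simp⟩
    · rintro S T hST ⟨a', h1, h2⟩
      exact ⟨a', h1, fun K m σ B hB hσ hb z hz => h2 K m σ B hB hσ hb z (hST hz)⟩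
    · rintro S T ⟨a₁, h1, h2⟩ ⟨a₂, h3, h4⟩
      refine ⟨max a₁ a₂, max_lt h1 h3, fun K m σ B hB hσ hb z hz => ?_⟩
      rcases hz with hz | hz
      · exact h2 K m σ B hB hσ (hb.mono_left (le_max_left _ _)) z hz
      · exact h4 K m σ B hB hσ (hb.mono_left (le_max_right _ _)) z hz
    · rintro p ⟨hp, hd⟩
      have hp1 : ‖p‖ = 1 := by simpa using hp
      rcases lt_or_eq_of_le (show infDist p M ≤ a from hd) with hd | hd
      · obtain ⟨a', h1, Ω, hΩ, h2⟩ := h.exists_hull_nhds_of_lt ha' hd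
        exact ⟨Ω, mem_nhdsWithin_of_mem_nhds hΩ, a', h1, h2⟩
      · obtain ⟨a', h1, Ω, hΩ, h2⟩ := h.exists_hull_nhds_of_eq hV ha ha' hp1 hd
        exact ⟨Ω, mem_nhdsWithin_of_mem_nhds hΩ, a', h1, h2⟩
  obtain ⟨a', h1, h2⟩ := main
  refine ⟨max a' (a / 2), lt_max_of_lt_right (half_pos ha), max_lt h1 (half_lt_self ha), ?_⟩
  intro K m σ B hB hσ hb
  refine h.boundOn_of_unit hσ fun z hz1 hzd => ?_
  obtain ⟨q, hq, hzq, hbd⟩ := h2 K m σ B hB hσ (hb.mono_left (le_max_left _ _)) z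
    ⟨by simpa using hz1, hzd⟩ hz1
  exact ⟨q, hq, 1, one_ne_zero, by rwa [one_smul], by simpa using hbd⟩

end ConicFoliation

end Sections

section Jets

variable {n : ℕ}

/-- The Taylor polynomial (without factorials) of order less than `h` at the origin. -/
def taylorSum (h : ℕ) (φ : (Fin n → ℂ) → ℂ) (w : Fin n → ℂ) : ℂ :=
  ∑ k ∈ Finset.range h, iteratedFDeriv ℂ k φ 0 fun _ => w

/-- The span of the monomials with all exponents less than `h`. -/
def monomialSpan (n h : ℕ) : Submodule ℂ ((Fin n → ℂ) → ℂ) :=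
  Submodule.span ℂ (Set.range fun (α : Fin n → Fin h) (w : Fin n → ℂ) => ∏ i, w i ^ (α i : ℕ))

lemma finrank_monomialSpan_le (n h : ℕ) : Module.finrank ℂ (monomialSpan n h) ≤ h ^ n := by
  refine (finrank_range_le_card _).trans ?_
  simp

instance (n h : ℕ) : FiniteDimensional ℂ (monomialSpan n h) :=
  FiniteDimensional.span_of_finite ℂ (Set.finite_range _)

lemma iteratedFDeriv_diag_mem {k h : ℕ} (hk : k < h)
    (T : ContinuousMultilinearMap ℂ (fun _ : Fin k => Fin n → ℂ) ℂ) :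
    (fun w : Fin n → ℂ => T fun _ => w) ∈ monomialSpan n h := by
  have key : (fun w : Fin n → ℂ => T fun _ => w) =
      ∑ ρ : Fin k → Fin n, T (fun j => Pi.single (ρ j) 1) •
        fun w : Fin n → ℂ => ∏ i, w i ^ (Finset.univ.filter fun j => ρ j = i).card := by
    funext w
    have hw : w = ∑ i, w i • (Pi.single i 1 : Fin n → ℂ) := by
      funext j
      simp [Finset.sum_apply, Pi.single_apply]
    have h1 : T (fun _ => w) =
        ∑ ρ : Fin k → Fin n, T fun j => w (ρ j) • (Pi.single (ρ j) 1 : Fin n → ℂ) := by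
      conv_lhs => rw [hw]
      exact T.map_sum _
    rw [h1, Finset.sum_apply]
    refine Finset.sum_congr rfl fun ρ _ => ?_
    rw [T.map_smul_univ, Pi.smul_apply, smul_eq_mul, smul_eq_mul, mul_comm]
    congr 1
    rw [← Finset.prod_fiberwise (s := Finset.univ) (g := ρ) (f := fun j => w (ρ j))]
    refine Finset.prod_congr rfl fun i _ => ?_
    rw [← Finset.prod_const]
    exact Finset.prod_congr rfl fun j hj => by rw [(Finset.mem_filter.1 hj).2]
  rw [key]
  refine Submodule.sum_mem _ fun ρ _ => Submodule.smul_mem _ _ (Submodule.subset_span ?_)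
  have hc : ∀ i, (Finset.univ.filter fun j => ρ j = i).card < h := fun i =>
    ((Finset.card_le_univ _).trans (by simp)).trans_lt hk
  exact ⟨fun i => ⟨_, hc i⟩, rfl⟩

lemma taylorSum_mem (h : ℕ) (φ : (Fin n → ℂ) → ℂ) : taylorSum h φ ∈ monomialSpan n h := by
  have : taylorSum h φ =
      ∑ k ∈ Finset.range h, fun w : Fin n → ℂ => iteratedFDeriv ℂ k φ 0 fun _ => w := by
    funext w
    simp [taylorSum]
  rw [this]
  exact Submodule.sum_mem _ fun k hk => iteratedFDeriv_diag_mem (Finset.mem_range.1 hk) _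

lemma iteratedFDeriv_diag_eq_zero {h : ℕ} {φ : (Fin n → ℂ) → ℂ} (h0 : taylorSum h φ = 0)
    {k : ℕ} (hk : k < h) (w : Fin n → ℂ) : iteratedFDeriv ℂ k φ 0 (fun _ => w) = 0 := by
  set P : Polynomial ℂ := ∑ k ∈ Finset.range h,
    Polynomial.monomial k (iteratedFDeriv ℂ k φ 0 fun _ => w) with hP
  have hPz : P = 0 := by
    refine Polynomial.funext fun s => ?_
    have := congrFun h0 (s • w)
    rw [Polynomial.eval_zero, hP, Polynomial.eval_finsetSum]
    rw [taylorSum, Pi.zero_apply] at this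
    rw [← this]
    refine Finset.sum_congr rfl fun k _ => ?_
    rw [Polynomial.eval_monomial]
    have h1 := (iteratedFDeriv ℂ k φ 0).map_smul_univ (fun _ => s) (fun _ => w)
    rw [h1]
    simp [mul_comm]
  have := congrArg (fun Q => Q.coeff k) hPz
  simpa [hP, Polynomial.finsetSum_coeff, Polynomial.coeff_monomial, hk] using this

lemma iteratedDeriv_line {φ : (Fin n → ℂ) → ℂ} {U : Set (Fin n → ℂ)} (hU : IsOpen U)
    (h0 : 0 ∈ U) (hφ : DifferentiableOn ℂ φ U) (k : ℕ) (w : Fin n → ℂ) :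
    iteratedDeriv k (fun t : ℂ => φ (t • w)) 0 = iteratedFDeriv ℂ k φ 0 (fun _ => w) := by
  set g : ℂ →L[ℂ] (Fin n → ℂ) := (ContinuousLinearMap.id ℂ ℂ).smulRight w with hg
  have hgU : IsOpen (g ⁻¹' U) := hU.preimage g.continuous
  have hg0 : g 0 ∈ U := by simpa using h0
  have h1 := g.iteratedFDerivWithin_comp_right
    (contDiffOn_of_differentiableOn_complex hU k hφ) hU.uniqueDiffOn hgU.uniqueDiffOn hg0 le_rfl
  rw [iteratedFDerivWithin_of_isOpen k hgU hg0, iteratedFDerivWithin_of_isOpen k hU hg0] at h1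
  have h2 : (fun t : ℂ => φ (t • w)) = φ ∘ g := by
    funext t; simp [hg]
  rw [iteratedDeriv_eq_iteratedFDeriv, h2, h1]
  simp [hg]

lemma taylorSum_add {φ ψ : (Fin n → ℂ) → ℂ} {U : Set (Fin n → ℂ)} (hU : IsOpen U) (h0 : 0 ∈ U)
    (hφ : DifferentiableOn ℂ φ U) (hψ : DifferentiableOn ℂ ψ U) (h : ℕ) :
    taylorSum h (φ + ψ) = taylorSum h φ + taylorSum h ψ := by
  funext w
  simp only [taylorSum, Pi.add_apply]
  rw [← Finset.sum_add_distrib]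
  refine Finset.sum_congr rfl fun k _ => ?_
  rw [iteratedFDeriv_add_apply
    ((contDiffOn_of_differentiableOn_complex hU k hφ).contDiffAt (hU.mem_nhds h0))
    ((contDiffOn_of_differentiableOn_complex hU k hψ).contDiffAt (hU.mem_nhds h0))]
  rfl

lemma taylorSum_smul {φ : (Fin n → ℂ) → ℂ} {U : Set (Fin n → ℂ)} (hU : IsOpen U) (h0 : 0 ∈ U)
    (hφ : DifferentiableOn ℂ φ U) (h : ℕ) (c : ℂ) :
    taylorSum h (c • φ) = c • taylorSum h φ := by
  funext w
  simp only [taylorSum, Pi.smul_apply]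
  rw [Finset.smul_sum]
  refine Finset.sum_congr rfl fun k _ => ?_
  rw [iteratedFDeriv_const_smul_apply
    ((contDiffOn_of_differentiableOn_complex hU k hφ).contDiffAt (hU.mem_nhds h0))]
  rfl

lemma norm_le_of_taylorSum_eq_zero {φ : (Fin n → ℂ) → ℂ} {U : Set (Fin n → ℂ)} (hU : IsOpen U)
    (h0 : 0 ∈ U) (hφ : DifferentiableOn ℂ φ U) {h : ℕ} (ht : taylorSum (h + 1) φ = 0)
    {w : Fin n → ℂ} {R B : ℝ} (hR : 1 < R)
    (hB : ∀ t ∈ ball (0 : ℂ) R, t • w ∈ U ∧ ‖φ (t • w)‖ ≤ B) :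
    ‖φ w‖ ≤ B * (1 / R) ^ (h + 1) := by
  set g : ℂ → ℂ := fun t => φ (t • w) with hg
  have hRp : 0 < R := by linarith
  have hgd : DifferentiableOn ℂ g (ball 0 R) :=
    hφ.comp (by fun_prop) fun t ht => (hB t ht).1
  have hga : AnalyticAt ℂ g 0 := hgd.analyticAt (ball_mem_nhds _ hRp)
  have hord : ((h + 1 : ℕ) : ℕ∞) ≤ analyticOrderAt g 0 := by
    rw [natCast_le_analyticOrderAt_iff_iteratedDeriv_eq_zero hga]
    intro i hi
    rw [hg, iteratedDeriv_line hU h0 hφ]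
    exact iteratedFDeriv_diag_eq_zero ht hi w
  obtain ⟨G, hG, hGe⟩ := (natCast_le_analyticOrderAt hga).1 hord
  have hg0 : g 0 = 0 := by
    have := hGe.self_of_nhds
    simpa using this
  have hlo : (fun t => g t - g 0) =o[𝓝 0] fun t : ℂ => ‖t - 0‖ ^ h := by
    rw [hg0]
    have h1 : (fun t : ℂ => t ^ (h + 1) * G t) =O[𝓝 0] fun t : ℂ => t ^ (h + 1) * (1 : ℂ) :=
      (Asymptotics.isBigO_refl _ _).mul (hG.continuousAt.isBigO_one ℂ)
    have h2 : (fun t : ℂ => t ^ (h + 1)) =o[𝓝 0] fun t : ℂ => t ^ h :=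
      Asymptotics.isLittleO_pow_pow (Nat.lt_succ_self h)
    have h3 : g =o[𝓝 0] fun t : ℂ => t ^ h := by
      refine (Asymptotics.IsBigO.trans_isLittleO (?_ : g =O[𝓝 0] _) h2)
      refine Asymptotics.IsBigO.congr' h1 ?_ (by simp)
      filter_upwards [hGe] with t ht
      rw [ht]; simp
    refine Asymptotics.IsLittleO.congr' h3.norm_right (by simp) ?_
    simp
  have hmaps : MapsTo g (ball 0 R) (closedBall (g 0) B) := by
    intro t ht
    rw [hg0, mem_closedBall_zero_iff]
    exact (hB t ht).2
  have := dist_le_mul_div_pow_of_mapsTo_ball_of_isLittleO (z := 1) hgd hmaps hlo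
    (by simpa using hR)
  rw [hg0] at this
  simpa [hg] using this

end Jets

section Siegel

variable {V : Type*} [NormedAddCommGroup V] [InnerProductSpace ℂ V] [FiniteDimensional ℂ V]
variable {M : Set V} {r C : ℝ} {f : V → V → ℂ} {a : ℝ} {n : ℕ}

lemma exists_orthogonal_param (hV : Module.finrank ℂ V = n + 1) {x : V} (hx : ‖x‖ = 1) :
    ∃ E : (Fin n → ℂ) →L[ℂ] V, ∀ y, inner ℂ x y = 0 → ∃ w, E w = y := by
  have hx0 : x ≠ 0 := norm_ne_zero_iff.1 (by rw [hx]; exact one_ne_zero)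
  have h1 : Module.finrank ℂ (Submodule.span ℂ {x})ᗮ = n := by
    have h2 := (Submodule.span ℂ {x}).finrank_add_finrank_orthogonal
    rw [finrank_span_singleton hx0] at h2
    omega
  let b := Module.finBasisOfFinrankEq ℂ _ h1
  refine ⟨LinearMap.toContinuousLinearMap
    ((Submodule.span ℂ {x})ᗮ.subtype.comp b.equivFun.symm.toLinearMap), fun y hy => ?_⟩
  have hy' : y ∈ (Submodule.span ℂ {x})ᗮ := Submodule.mem_orthogonal_singleton_iff_inner_right.2 hy
  exact ⟨b.equivFun ⟨y, hy'⟩, by simp⟩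

namespace ConicFoliation

lemma exists_center (h : ConicFoliation M r C f) (hV : Module.finrank ℂ V = n + 1) (ha : a ≤ r / 2)
    {x : V} (hx : ‖x‖ = 1) (hd : infDist x M < a) :
    ∃ q ∈ M, ∃ E : (Fin n → ℂ) →L[ℂ] V, ∃ Ω ∈ 𝓝 x, x ∈ ball q (r * ‖q‖) ∧
      (∀ K m σ, IsSection M r f K m σ → ∃ B, 0 ≤ B ∧ ∀ z ∈ Ω, z ∈ ball q (r * ‖q‖) ∧
        ‖σ q z‖ ≤ B) ∧
      ∀ K m σ B j, 0 ≤ B → IsSection M r f K m σ → BoundOn M r f K m σ a B →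
        taylorSum (j + 1) (fun w => σ q (x + E w)) = 0 → ∀ z ∈ Ω, ‖z‖ = 1 →
        ∃ c : ℂ, 1 ≤ ‖c‖ ∧ c • z ∈ ball q (r * ‖q‖) ∧
          ‖σ q (c • z)‖ ≤ B * 2 ^ m * C ^ K * (1 / 4) ^ (j + 1) := by
  have : ProperSpace V := FiniteDimensional.proper ℂ V
  have hx0 : x ≠ 0 := norm_ne_zero_iff.1 (by rw [hx]; exact one_ne_zero)
  obtain ⟨q, hq, -, hxq, -⟩ := h.exists_nearest hx0 (by rw [hx]; linarith)
  obtain ⟨E, hE⟩ := exists_orthogonal_param hV hx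
  have hev : ∀ᶠ z in 𝓝 x, z ∈ ball q (r * ‖q‖) ∧ infDist z M < a * ‖z‖ :=
    Filter.Eventually.and (isOpen_ball.mem_nhds hxq)
      ((continuous_infDist_pt M).continuousAt.eventually_lt
        (continuousAt_const.mul continuousAt_id.norm) (by simpa [hx] using hd))
  obtain ⟨η₀, hη₀, hη⟩ := Metric.eventually_nhds_iff_ball.1 hev
  set η := min η₀ 1 with hηdef
  have hηp : 0 < η := by positivity
  have hη1 : η ≤ 1 := min_le_right _ _
  have hηs : ∀ z ∈ ball x η, z ∈ ball q (r * ‖q‖) ∧ infDist z M < a * ‖z‖ :=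
    fun z hz => hη z (ball_subset_ball (min_le_left _ _) hz)
  refine ⟨q, hq, E, ball x (η / 16), ball_mem_nhds _ (by positivity), hxq, ?_, ?_⟩
  · intro K m σ hσ
    have hc : ContinuousOn (σ q) (closedBall x (η / 16)) :=
      (hσ.differentiableOn q hq).continuousOn.mono fun z hz =>
        (hηs z (closedBall_subset_ball (by linarith) hz)).1
    obtain ⟨B, hB⟩ := (isCompact_closedBall x (η / 16)).exists_bound_of_continuousOn hc
    refine ⟨max B 0, le_max_right _ _, fun z hz =>
      ⟨(hηs z (ball_subset_ball (by linarith) hz)).1, ?_⟩⟩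
    exact (hB z (ball_subset_closedBall hz)).trans (le_max_left _ _)
  · intro K m σ B j hB hσ hb ht z hz hz1
    set i := inner ℂ x z with hi
    have hzx : ‖z - x‖ < η / 16 := by rwa [mem_ball, dist_eq_norm] at hz
    have hi1 : ‖i - 1‖ < η / 16 := by
      have h1 : i - 1 = inner ℂ x (z - x) := by
        rw [inner_sub_right, inner_self_eq_norm_sq_to_K, hx, ← hi]; simp
      rw [h1]
      refine (norm_inner_le_norm _ _).trans_lt ?_
      rwa [hx, one_mul]
    have hile : ‖i‖ ≤ 1 := by
      have := norm_inner_le_norm (𝕜 := ℂ) x z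
      rwa [hx, hz1, one_mul] at this
    have hige : 1 / 2 ≤ ‖i‖ := by
      have h1 := norm_sub_norm_le (1 : ℂ) i
      rw [norm_one, norm_sub_rev] at h1
      linarith
    have hi0 : i ≠ 0 := norm_pos_iff.1 (by linarith)
    set c := i⁻¹ with hc
    have hc1 : 1 ≤ ‖c‖ := by rw [hc, norm_inv]; exact (one_le_inv₀ (by linarith)).2 hile
    have hc2 : ‖c‖ ≤ 2 := by
      rw [hc, norm_inv]
      exact inv_le_of_inv_le₀ (by norm_num) (by linarith)
    have hci : c * i = 1 := inv_mul_cancel₀ hi0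
    set w₀ := c • z - x with hw₀
    have hw₀n : ‖w₀‖ < η / 4 := by
      have h1 : w₀ = c • ((z - x) - (i - 1) • x) := by
        rw [hw₀, smul_sub, smul_sub, sub_smul, smul_sub, smul_smul, hci]
        simp
      rw [h1, norm_smul]
      have h2 : ‖(z - x) - (i - 1) • x‖ < η / 8 := by
        refine (norm_sub_le _ _).trans_lt ?_
        rw [norm_smul, hx, mul_one]
        linarith
      have h3 := norm_nonneg ((z - x) - (i - 1) • x)
      nlinarith
    have hw₀x : inner ℂ x w₀ = 0 := by
      rw [hw₀, inner_sub_right, inner_smul_right, ← hi, hci, inner_self_eq_norm_sq_to_K, hx]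
      simp
    obtain ⟨w, hw⟩ := hE w₀ hw₀x
    have hball : ∀ t ∈ ball (0 : ℂ) 4, x + t • w₀ ∈ ball x η := by
      intro t ht
      rw [mem_ball_zero_iff] at ht
      rw [mem_ball, dist_eq_norm, add_sub_cancel_left, norm_smul]
      nlinarith [norm_nonneg t, norm_nonneg w₀]
    have hxw : x + E w = c • z := by rw [hw, hw₀]; abel
    have h1 : (1 : ℂ) ∈ ball (0 : ℂ) 4 := by simp
    have hcz : c • z ∈ ball q (r * ‖q‖) := by
      have := (hηs _ (hball 1 h1)).1
      rwa [one_smul, ← hw, hxw] at this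
    refine ⟨c, hc1, hcz, ?_⟩
    have hU : IsOpen ((fun w => x + E w) ⁻¹' ball x η) := isOpen_ball.preimage (by fun_prop)
    have key := norm_le_of_taylorSum_eq_zero (φ := fun w => σ q (x + E w))
      (U := (fun w => x + E w) ⁻¹' ball x η) (R := 4) (B := B * 2 ^ m * C ^ K) (w := w) hU
      (by simpa using hηp)
      ((hσ.differentiableOn q hq).comp (by fun_prop) fun w hw => (hηs _ hw).1) ht (by norm_num) ?_
    · rwa [hxw] at key
    · intro t ht4
      have h2 := hball t ht4
      rw [mem_preimage, map_smul, hw]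
      refine ⟨h2, ?_⟩
      obtain ⟨h3, h4⟩ := hηs _ h2
      have h5 : ‖x + t • w₀‖ ≤ 2 := by
        rw [mem_ball, dist_eq_norm, add_sub_cancel_left] at h2
        have := norm_add_le x (t • w₀)
        linarith
      have h6 := h.le_C q hq _ h3
      refine (hb q hq _ h3 h4.le).trans ?_
      gcongr

/-- A family of sections of large dimension contains a nontrivial element that vanishes. -/
theorem exists_vanishing_section (h : ConicFoliation M r C f) (hV : Module.finrank ℂ V = n + 1)
    (hn : 2 ≤ n) :
    ∃ ν c : ℕ, ∀ (K m : ℕ) (W : Type) [AddCommGroup W] [Module ℂ W] [FiniteDimensional ℂ W]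
      (L : W →ₗ[ℂ] (V → V → ℂ)), (∀ s, IsSection M r f K m (L s)) →
      ν * (c * (K + m) + 1) ^ n < Module.finrank ℂ W →
      ∃ s ≠ 0, ∀ q ∈ M, ∀ z ∈ ball q (r * ‖q‖), L s q z = 0 := by
  classical
  have : ProperSpace V := FiniteDimensional.proper ℂ V
  have hrp := h.r_pos
  have hC := h.one_le_C
  obtain ⟨a', ha'0, ha', hhull⟩ := h.exists_hull (a := r / 2) (by omega) (by positivity) le_rfl
  have hX : IsCompact (sphere (0 : V) 1 ∩ {z | infDist z M ≤ a'}) :=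
    (isCompact_sphere 0 1).inter_right (isClosed_le (continuous_infDist_pt M) continuous_const)
  have hcen : ∀ x : (sphere (0 : V) 1 ∩ {z | infDist z M ≤ a'} : Set V), _ := fun x =>
    h.exists_center (a := r / 2) hV le_rfl (x := x) (by simpa using x.2.1)
      (lt_of_le_of_lt x.2.2 ha')
  choose q hq E Ω hΩ hxq hbdd hsch using hcen
  obtain ⟨t, ht⟩ := hX.elim_nhds_subcover' (fun x hx => Ω ⟨x, hx⟩) fun x hx => hΩ ⟨x, hx⟩
  obtain ⟨c, hc⟩ : ∃ c : ℕ, max (C ^ 2) 4 ≤ 4 ^ c :=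
    ((tendsto_pow_atTop_atTop_of_one_lt (by norm_num : (1 : ℝ) < 4)).eventually_ge_atTop _).exists
  refine ⟨t.card, c, fun K m W _ _ _ L hL hdim => ?_⟩
  set j := c * (K + m) with hj
  have hO : ∀ x : (sphere (0 : V) 1 ∩ {z | infDist z M ≤ a'} : Set V),
      IsOpen ((fun w => (x : V) + E x w) ⁻¹' ball (q x) (r * ‖q x‖)) :=
    fun x => isOpen_ball.preimage (by fun_prop)
  have h0 : ∀ x : (sphere (0 : V) 1 ∩ {z | infDist z M ≤ a'} : Set V),
      (0 : Fin n → ℂ) ∈ (fun w => (x : V) + E x w) ⁻¹' ball (q x) (r * ‖q x‖) :=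
    fun x => by simpa using hxq x
  have hdφ : ∀ (x : (sphere (0 : V) 1 ∩ {z | infDist z M ≤ a'} : Set V)) s,
      DifferentiableOn ℂ (fun w => L s (q x) (x + E x w))
      ((fun w => (x : V) + E x w) ⁻¹' ball (q x) (r * ‖q x‖)) := fun x s =>
    ((hL s).differentiableOn _ (hq x)).comp (by fun_prop) fun w hw => hw
  let J : W →ₗ[ℂ] (t → monomialSpan n (j + 1)) := LinearMap.pi fun x =>
    { toFun := fun s => ⟨taylorSum (j + 1) fun w => L s (q x) (x + E x w), taylorSum_mem _ _⟩
      map_add' := fun s s' => by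
        ext1
        simp only [map_add]
        exact taylorSum_add (hO x) (h0 x) (hdφ x s) (hdφ x s') _
      map_smul' := fun b s => by
        ext1
        simp only [map_smul]
        exact taylorSum_smul (hO x) (h0 x) (hdφ x s) _ b }
  have hJ : LinearMap.ker J ≠ ⊥ := by
    refine LinearMap.ker_ne_bot_of_finrank_lt (lt_of_le_of_lt ?_ hdim)
    rw [Module.finrank_pi_fintype]
    refine (Finset.sum_le_card_nsmul _ _ ((j + 1) ^ n) fun x _ =>
      finrank_monomialSpan_le _ _).trans ?_
    simp
  obtain ⟨s, hs, hs0⟩ := (Submodule.ne_bot_iff _).1 hJ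
  refine ⟨s, hs0, ?_⟩
  have hjet : ∀ x ∈ t, taylorSum (j + 1) (fun w => L s (q x) (x + E x w)) = 0 := by
    intro x hx
    have := congrFun (LinearMap.mem_ker.1 hs) ⟨x, hx⟩
    exact congrArg Subtype.val this
  have hcov : ∀ z : V, ‖z‖ = 1 → infDist z M ≤ a' → ∃ x ∈ t, z ∈ Ω x := by
    intro z hz1 hzd
    have := ht (show z ∈ _ from ⟨by simpa using hz1, hzd⟩)
    simpa using this
  have hfactor : (C ^ K * 2 ^ m) * 2 ^ m * C ^ K * (1 / 4 : ℝ) ^ (j + 1) ≤ 1 / 4 := by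
    have h1 : (C ^ K * 2 ^ m) * 2 ^ m * C ^ K = (C ^ 2) ^ K * 4 ^ m := by
      rw [← pow_mul, show (4 : ℝ) = 2 ^ 2 by norm_num, ← pow_mul]
      ring
    have h2 : (C ^ 2) ^ K * 4 ^ m ≤ (4 : ℝ) ^ j := by
      rw [hj, mul_add, pow_add, pow_mul, pow_mul]
      have := (le_max_left _ _).trans hc
      have := (le_max_right _ _).trans hc
      gcongr
    rw [h1, one_div, inv_pow, pow_succ]
    calc (C ^ 2) ^ K * 4 ^ m * ((4 : ℝ) ^ j * 4)⁻¹ ≤ 4 ^ j * ((4 : ℝ) ^ j * 4)⁻¹ := by gcongr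
      _ = 4⁻¹ := by field_simp
  have hstep : ∀ B, 0 ≤ B → BoundOn M r f K m (L s) a' B → BoundOn M r f K m (L s) a' (B / 4) := by
    intro B hB hb
    have hb' := hhull K m (L s) B hB (hL s) hb
    refine h.boundOn_of_unit (hL s) fun z hz1 hzd => ?_
    obtain ⟨x, hx, hzx⟩ := hcov z hz1 hzd
    obtain ⟨b, hb1, hbz, hle⟩ := hsch x K m (L s) _ j (by positivity) (hL s) hb'
      (hjet x hx) z hzx hz1
    refine ⟨q x, hq x, b, norm_pos_iff.1 (by linarith), hbz, hle.trans ?_⟩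
    have h2 : 1 ≤ ‖b‖ ^ m * ‖fderiv ℂ (f (q x)) (b • z)‖ ^ K :=
      one_le_mul_of_one_le_of_one_le (one_le_pow₀ hb1) (one_le_pow₀ (h.one_le _ (hq x) _ hbz))
    calc C ^ K * 2 ^ m * B * 2 ^ m * C ^ K * (1 / 4) ^ (j + 1)
        = B * ((C ^ K * 2 ^ m) * 2 ^ m * C ^ K * (1 / 4) ^ (j + 1)) := by ring
      _ ≤ B * (1 / 4) := by gcongr
      _ ≤ B * (1 / 4) * (‖b‖ ^ m * ‖fderiv ℂ (f (q x)) (b • z)‖ ^ K) :=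
          le_mul_of_one_le_right (by positivity) h2
      _ = _ := by ring
  obtain ⟨B₀, hB₀, hb₀⟩ : ∃ B, 0 ≤ B ∧ BoundOn M r f K m (L s) a' B := by
    choose B hB hBz using fun x => hbdd x K m (L s) (hL s)
    refine ⟨∑ x ∈ t, B x, Finset.sum_nonneg fun x _ => hB x, ?_⟩
    refine h.boundOn_of_unit (hL s) fun z hz1 hzd => ?_
    obtain ⟨x, hx, hzx⟩ := hcov z hz1 hzd
    refine ⟨q x, hq x, 1, one_ne_zero, by simpa using (hBz x z hzx).1, ?_⟩
    simp only [one_smul, norm_one, one_pow, mul_one]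
    refine (hBz x z hzx).2.trans ((Finset.single_le_sum (fun x _ => hB x) hx).trans ?_)
    exact le_mul_of_one_le_right (Finset.sum_nonneg fun x _ => hB x)
      (one_le_pow₀ (h.one_le _ (hq x) _ (hBz x z hzx).1))
  have hiter : ∀ k : ℕ, BoundOn M r f K m (L s) a' (B₀ / 4 ^ k) := by
    intro k
    induction k with
    | zero => simpa using hb₀
    | succ k ih =>
      have := hstep _ (by positivity) ih
      rwa [div_div, ← pow_succ] at this
  intro y hy z hz
  have hyb := h.mem_ball_self hy
  refine eqOn_zero_of_eventually_eq_zero isOpen_ball (convex_ball _ _)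
    ((hL s).differentiableOn y hy) hyb ?_ z hz
  have hlt : infDist y M < a' * ‖y‖ := by
    rw [infDist_zero_of_mem hy]
    exact mul_pos ha'0 (h.norm_pos hy)
  filter_upwards [isOpen_ball.mem_nhds hyb, (continuous_infDist_pt M).continuousAt.eventually_lt
    (continuousAt_const.mul continuousAt_id.norm) hlt] with p hp hpd
  have hlim : Tendsto (fun k : ℕ => B₀ / 4 ^ k * ‖p‖ ^ m * ‖fderiv ℂ (f y) p‖ ^ K) atTop (𝓝 0) := by
    have h1 : Tendsto (fun k : ℕ => B₀ / (4 : ℝ) ^ k) atTop (𝓝 0) :=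
      tendsto_const_nhds.div_atTop (tendsto_pow_atTop_atTop_of_one_lt (by norm_num))
    simpa using (h1.mul_const (‖p‖ ^ m)).mul_const (‖fderiv ℂ (f y) p‖ ^ K)
  have := ge_of_tendsto' hlim fun k => hiter k y hy p hp hpd.le
  exact norm_le_zero_iff.1 this

end ConicFoliation

end Siegel

section PolynomialFunctions

variable {N : ℕ}

/-- The value of a polynomial at a point of Euclidean space. -/
def polyEval (P : MvPolynomial (Fin N) ℂ) (z : EuclideanSpace ℂ (Fin N)) : ℂ :=
  MvPolynomial.eval (fun i => z i) P

lemma differentiable_polyEval (P : MvPolynomial (Fin N) ℂ) : Differentiable ℂ (polyEval P) := by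
  unfold polyEval
  induction P using MvPolynomial.induction_on with
  | C a => simp
  | add p q hp hq => simpa using hp.fun_add hq
  | mul_X p i hp =>
    simp only [map_mul, MvPolynomial.eval_X]
    exact hp.fun_mul (by fun_prop)

lemma polyEval_smul {P : MvPolynomial (Fin N) ℂ} {m : ℕ} (hP : P.IsHomogeneous m) (c : ℂ)
    (z : EuclideanSpace ℂ (Fin N)) : polyEval P (c • z) = c ^ m * polyEval P z := by
  unfold polyEval
  rw [MvPolynomial.eval_eq, MvPolynomial.eval_eq, Finset.mul_sum]
  refine Finset.sum_congr rfl fun d hd => ?_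
  have hdeg : ∑ i ∈ d.support, d i = m := by
    have := hP (MvPolynomial.mem_support_iff.1 hd)
    rwa [Finsupp.weight_apply, Finsupp.sum, Finset.sum_congr rfl (g := fun i => d i)
      (by simp)] at this
  simp only [PiLp.smul_apply, smul_eq_mul, mul_pow, Finset.prod_mul_distrib]
  rw [Finset.prod_pow_eq_pow_sum, hdeg]
  ring

lemma eq_zero_of_eventually_polyEval {P : MvPolynomial (Fin N) ℂ} {p : EuclideanSpace ℂ (Fin N)}
    (h0 : ∀ᶠ z in 𝓝 p, polyEval P z = 0) : P = 0 := by
  have := eqOn_zero_of_eventually_eq_zero isOpen_univ convex_univ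
    (differentiable_polyEval P).differentiableOn (mem_univ p) h0
  refine MvPolynomial.funext fun x => ?_
  simpa [polyEval] using this (WithLp.toLp 2 x) (mem_univ _)

@[simp] lemma polyEval_mul (P Q : MvPolynomial (Fin N) ℂ) (z : EuclideanSpace ℂ (Fin N)) :
    polyEval (P * Q) z = polyEval P z * polyEval Q z := by simp [polyEval]

@[simp] lemma polyEval_C (a : ℂ) (z : EuclideanSpace ℂ (Fin N)) :
    polyEval (MvPolynomial.C a) z = a := by simp [polyEval]

end PolynomialFunctions

namespace ConicFoliation

section Identity

variable {V : Type*} [NormedAddCommGroup V] [InnerProductSpace ℂ V] [FiniteDimensional ℂ V]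
variable {M : Set V} {r C : ℝ} {f : V → V → ℂ}

lemma smul_mem_ball {q z : V} (hz : z ∈ ball q (r * ‖q‖)) {c : ℂ}
    (hc : c ≠ 0) : c • z ∈ ball (c • q) (r * ‖c • q‖) := by
  rw [mem_ball] at hz ⊢
  rw [dist_smul₀, norm_smul]
  have := norm_pos_iff.2 hc
  nlinarith

/-- Identity theorem on the conic neighbourhood of `M`, for zero sets that are locally given by
holomorphic functions. -/
lemma eq_zero_of_eventually (h : ConicFoliation M r C f) {φ : V → V → ℂ}
    (hφ : ∀ q ∈ M, DifferentiableOn ℂ (φ q) (ball q (r * ‖q‖)))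
    (hc : ∀ q ∈ M, ∀ q' ∈ M, ∀ z ∈ ball q (r * ‖q‖), z ∈ ball q' (r * ‖q'‖) →
      φ q z = 0 → φ q' z = 0)
    {q₀ z₀ : V} (hq₀ : q₀ ∈ M) (hz₀ : z₀ ∈ ball q₀ (r * ‖q₀‖)) (h0 : ∀ᶠ z in 𝓝 z₀, φ q₀ z = 0) :
    ∀ q ∈ M, ∀ z ∈ ball q (r * ‖q‖), φ q z = 0 := by
  set A : Set V := {q | q ∈ M ∧ ∀ z ∈ ball q (r * ‖q‖), φ q z = 0}
  have key : ∀ q ∈ M, ∀ z ∈ ball q (r * ‖q‖), ∀ q' ∈ M, z ∈ ball q' (r * ‖q'‖) →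
      (∀ᶠ z in 𝓝 z, φ q' z = 0) → q ∈ A := by
    intro q hq z hz q' hq' hz' h1
    refine ⟨hq, eqOn_zero_of_eventually_eq_zero isOpen_ball (convex_ball _ _) (hφ q hq) hz ?_⟩
    filter_upwards [h1, isOpen_ball.mem_nhds hz, isOpen_ball.mem_nhds hz'] with w h2 h3 h4
    exact hc q' hq' q hq w h4 h3 h2
  have hsub := h.preconnected.subset_left_of_subset_union
    (u := ⋃ q ∈ A, ball q (r * ‖q‖)) (v := ⋃ q ∈ M \ A, ball q (r * ‖q‖))
    (isOpen_biUnion fun _ _ => isOpen_ball) (isOpen_biUnion fun _ _ => isOpen_ball) ?_ ?_ ?_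
  · intro q hq z hz
    have := hsub (mem_iUnion₂.2 ⟨q, hq, hz⟩)
    obtain ⟨q', hq', hz'⟩ := mem_iUnion₂.1 this
    refine (key q hq z hz q' hq'.1 hz' ?_).2 z hz
    filter_upwards [isOpen_ball.mem_nhds hz'] with w hw using hq'.2 w hw
  · rw [disjoint_left]
    intro z hz1 hz2
    obtain ⟨q', hq', hz'⟩ := mem_iUnion₂.1 hz1
    obtain ⟨q, hq, hz⟩ := mem_iUnion₂.1 hz2
    refine hq.2 (key q hq.1 z hz q' hq'.1 hz' ?_)
    filter_upwards [isOpen_ball.mem_nhds hz'] with w hw using hq'.2 w hw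
  · intro z hz
    obtain ⟨q, hq, hz⟩ := mem_iUnion₂.1 hz
    by_cases hA : q ∈ A
    · exact Or.inl (mem_iUnion₂.2 ⟨q, hA, hz⟩)
    · exact Or.inr (mem_iUnion₂.2 ⟨q, ⟨hq, hA⟩, hz⟩)
  · refine ⟨z₀, mem_iUnion₂.2 ⟨q₀, hq₀, hz₀⟩, mem_iUnion₂.2 ⟨q₀, ?_, hz₀⟩⟩
    exact key q₀ hq₀ z₀ hz₀ q₀ hq₀ hz₀ h0

lemma eq_zero_of_mul_eq_zero (h : ConicFoliation M r C f) {φ ψ : V → V → ℂ}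
    (hφ : ∀ q ∈ M, DifferentiableOn ℂ (φ q) (ball q (r * ‖q‖)))
    (hψ : ∀ q ∈ M, DifferentiableOn ℂ (ψ q) (ball q (r * ‖q‖)))
    (hc : ∀ q ∈ M, ∀ q' ∈ M, ∀ z ∈ ball q (r * ‖q‖), z ∈ ball q' (r * ‖q'‖) →
      ψ q z = 0 → ψ q' z = 0)
    {q₀ z₀ : V} (hq₀ : q₀ ∈ M) (hz₀ : z₀ ∈ ball q₀ (r * ‖q₀‖)) (h0 : φ q₀ z₀ ≠ 0)
    (hmul : ∀ q ∈ M, ∀ z ∈ ball q (r * ‖q‖), φ q z * ψ q z = 0) :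
    ∀ q ∈ M, ∀ z ∈ ball q (r * ‖q‖), ψ q z = 0 := by
  refine h.eq_zero_of_eventually hψ hc hq₀ hz₀ ?_
  have hcont := ((hφ q₀ hq₀).continuousOn.continuousAt (isOpen_ball.mem_nhds hz₀)).eventually_ne h0
  filter_upwards [hcont, isOpen_ball.mem_nhds hz₀] with z h1 h2
  exact (mul_eq_zero.1 (hmul q₀ hq₀ z h2)).resolve_left h1

/-- The conic neighbourhood of `M` on which the foliation is defined. -/
def nbhd (M : Set V) (r : ℝ) : Set V := ⋃ q ∈ M, ball q (r * ‖q‖)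

lemma mem_nbhd {z : V} : z ∈ nbhd M r ↔ ∃ q ∈ M, z ∈ ball q (r * ‖q‖) := by
  simp only [nbhd, mem_iUnion, exists_prop]

lemma isOpen_nbhd : IsOpen (nbhd M r) := isOpen_biUnion fun _ _ => isOpen_ball

lemma smul_mem_nbhd (h : ConicFoliation M r C f) {z : V} (hz : z ∈ nbhd M r) {c : ℂ}
    (hc : c ≠ 0) : c • z ∈ nbhd M r := by
  obtain ⟨q, hq, hz⟩ := mem_nbhd.1 hz
  exact mem_nbhd.2 ⟨c • q, h.smul_mem c hc q hq, smul_mem_ball hz hc⟩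

/-- Holomorphic functions of degree zero on the conic neighbourhood are constant. -/
lemma eq_of_homogeneous_zero {n : ℕ} (h : ConicFoliation M r C f)
    (hV : Module.finrank ℂ V = n + 1) (hn : 2 ≤ n) {y : V → ℂ}
    (hy : DifferentiableOn ℂ y (nbhd M r))
    (hyc : ∀ c : ℂ, c ≠ 0 → ∀ z ∈ nbhd M r, y (c • z) = y z) {z z' : V} (hz : z ∈ nbhd M r)
    (hz' : z' ∈ nbhd M r) : y z = y z' := by
  obtain ⟨ν, c, hνc⟩ := h.exists_vanishing_section hV hn
  set d := ν * (c * (0 + 0) + 1) ^ n + 1 with hd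
  let L : (Fin d → ℂ) →ₗ[ℂ] (V → V → ℂ) :=
    { toFun := fun s _ z => ∑ k, s k * y z ^ (k : ℕ)
      map_add' := by intro s t; ext q z; simp [add_mul, Finset.sum_add_distrib]
      map_smul' := by intro s t; ext q z; simp [mul_assoc, Finset.mul_sum] }
  have hball : ∀ q ∈ M, ball q (r * ‖q‖) ⊆ nbhd M r := fun q hq z hz => mem_nbhd.2 ⟨q, hq, hz⟩
  have hL : ∀ s, IsSection M r f 0 0 (L s) := by
    intro s
    refine ⟨fun q hq => ?_, fun q hq q' hq' c hc z hz hz' => ?_⟩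
    · have := hy.mono (hball q hq)
      simp only [L, LinearMap.coe_mk, AddHom.coe_mk]
      fun_prop
    · simp only [L, LinearMap.coe_mk, AddHom.coe_mk, hyc c hc z (hball q hq hz)]
      simp
  obtain ⟨s, hs0, hs⟩ := hνc 0 0 (Fin d → ℂ) L hL (by simp [hd])
  set p : Polynomial ℂ := ∑ k : Fin d, Polynomial.monomial (k : ℕ) (s k) with hp
  have hp0 : p ≠ 0 := by
    intro h0
    apply hs0
    ext k
    have := congrArg (fun p => Polynomial.coeff p k) h0
    simpa [hp, Polynomial.finsetSum_coeff, Polynomial.coeff_monomial, Fin.val_inj] using this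
  have hroot : ∀ z ∈ nbhd M r, y z ∈ p.rootSet ℂ := by
    intro z hz
    obtain ⟨q, hq, hz⟩ := mem_nbhd.1 hz
    rw [Polynomial.mem_rootSet]
    refine ⟨hp0, ?_⟩
    simpa [hp, L, Polynomial.eval_finsetSum] using hs q hq z hz
  have hfin : (p.rootSet ℂ).Countable := (Polynomial.rootSet_finite p ℂ).countable
  exact hfin.isTotallyDisconnected _ (by rintro _ ⟨w, hw, rfl⟩; exact hroot w hw)
    (h.preconnected.image y hy.continuousOn) ⟨z, hz, rfl⟩ ⟨z', hz', rfl⟩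

end Identity

section Polynomial

variable {N : ℕ} {M : Set (EuclideanSpace ℂ (Fin N))} {r C : ℝ}
  {f : EuclideanSpace ℂ (Fin N) → EuclideanSpace ℂ (Fin N) → ℂ}

/-- Homogeneous holomorphic functions on the conic neighbourhood are polynomials. -/
theorem exists_polynomial (h : ConicFoliation M r C f) (hN : 3 ≤ N) (m : ℕ)
    {y : EuclideanSpace ℂ (Fin N) → ℂ} (hy : DifferentiableOn ℂ y (nbhd M r))
    (hyc : ∀ c : ℂ, c ≠ 0 → ∀ z ∈ nbhd M r, y (c • z) = c ^ m * y z) :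
    ∃ P : MvPolynomial (Fin N) ℂ, P.IsHomogeneous m ∧ ∀ z ∈ nbhd M r, y z = polyEval P z := by
  obtain ⟨n, rfl⟩ : ∃ n, N = n + 1 := ⟨N - 1, by omega⟩
  induction m generalizing y with
  | zero =>
    obtain ⟨q, hq⟩ := h.nonempty
    have hq' : q ∈ nbhd M r := mem_nbhd.2 ⟨q, hq, h.mem_ball_self hq⟩
    refine ⟨MvPolynomial.C (y q), MvPolynomial.isHomogeneous_C _ _, fun z hz => ?_⟩
    rw [polyEval_C]
    exact h.eq_of_homogeneous_zero (n := n) (by simp) (by omega) hy (by simpa using hyc) hz hq'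
  | succ m ih =>
    have hder : ∀ j : Fin (n + 1), ∃ P : MvPolynomial (Fin (n + 1)) ℂ, P.IsHomogeneous m ∧
        ∀ z ∈ nbhd M r, fderiv ℂ y z (EuclideanSpace.single j 1) = polyEval P z := by
      intro j
      refine ih (differentiableOn_fderiv_apply isOpen_nbhd hy _) fun c hc z hz => ?_
      have hd := hy.differentiableAt (isOpen_nbhd.mem_nhds hz)
      have hd' := hy.differentiableAt (isOpen_nbhd.mem_nhds (h.smul_mem_nbhd hz hc))
      have h1 : HasFDerivAt (fun z => y (c • z)) ((fderiv ℂ y (c • z)).comp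
          (c • ContinuousLinearMap.id ℂ _)) z :=
        hd'.hasFDerivAt.comp z ((hasFDerivAt_id z).const_smul c)
      have h2 : HasFDerivAt (fun z => y (c • z)) (c ^ (m + 1) • fderiv ℂ y z) z := by
        refine (hd.hasFDerivAt.const_smul (c ^ (m + 1))).congr_of_eventuallyEq ?_
        filter_upwards [isOpen_nbhd.mem_nhds hz] with w hw using hyc c hc w hw
      have h3 := congrArg (fun T => T (EuclideanSpace.single j (1 : ℂ))) (h1.unique h2)
      simp only [ContinuousLinearMap.comp_apply, smul_apply, ContinuousLinearMap.id_apply,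
        map_smul, smul_eq_mul] at h3
      refine mul_left_cancel₀ hc ?_
      rw [h3]; ring
    choose P hP hPy using hder
    refine ⟨MvPolynomial.C ((m + 1 : ℂ)⁻¹) * ∑ j, MvPolynomial.X j * P j, ?_, fun z hz => ?_⟩
    · have : (∑ j, MvPolynomial.X j * P j).IsHomogeneous (m + 1) := by
        refine MvPolynomial.IsHomogeneous.sum _ _ _ fun j _ => ?_
        rw [add_comm m 1]
        exact (MvPolynomial.isHomogeneous_X _ _).mul (hP j)
      simpa using (MvPolynomial.isHomogeneous_C (Fin (n + 1)) ((m + 1 : ℂ)⁻¹)).mul this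
    · have hd := hy.differentiableAt (isOpen_nbhd.mem_nhds hz)
      have h1 : HasDerivAt (fun c : ℂ => y (c • z)) (fderiv ℂ y z z) 1 := by
        have h0 : HasDerivAt (fun c : ℂ => c • z) z 1 := by
          simpa using (hasDerivAt_id (1 : ℂ)).smul_const z
        refine HasFDerivAt.comp_hasDerivAt (f := fun c : ℂ => c • z) 1 ?_ h0
        rw [one_smul]; exact hd.hasFDerivAt
      have h2 : HasDerivAt (fun c : ℂ => y (c • z)) ((m + 1 : ℂ) * y z) 1 := by
        have h0 : HasDerivAt (fun c : ℂ => c ^ (m + 1) * y z) ((m + 1 : ℂ) * y z) 1 := by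
          simpa using (hasDerivAt_pow (m + 1) (1 : ℂ)).mul_const (y z)
        refine h0.congr_of_eventuallyEq ?_
        filter_upwards [eventually_ne_nhds (one_ne_zero : (1 : ℂ) ≠ 0)] with c hc
        exact hyc c hc z hz
      have h3 := h1.unique h2
      have hzsum : z = ∑ j, z j • EuclideanSpace.single j (1 : ℂ) := by
        ext i
        simp [Finset.sum_apply, Pi.single_apply]
      have h4 : fderiv ℂ y z z = ∑ j, z j * polyEval (P j) z := by
        conv_lhs => rw [hzsum]
        rw [map_sum]
        refine Finset.sum_congr rfl fun j _ => ?_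
        rw [map_smul, ← hPy j z hz, smul_eq_mul, ← hzsum]
      have hm : (m + 1 : ℂ) ≠ 0 := by exact_mod_cast m.succ_ne_zero
      have h5 : polyEval (∑ j, MvPolynomial.X j * P j) z = ∑ j, z j * polyEval (P j) z := by
        simp [polyEval]
      rw [polyEval_mul, polyEval_C, h5, ← h4, h3]
      field_simp

end Polynomial

end ConicFoliation

section Division

/-- Division of holomorphic functions of one variable with bounded quotient. -/
lemma exists_div_one_variable {D : Set ℂ} (hD : IsOpen D) (hDc : Convex ℝ D) {x b : ℂ → ℂ}
    (hx : DifferentiableOn ℂ x D) (hb : DifferentiableOn ℂ b D) {s : ℝ}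
    (hs : ∀ t ∈ D, ‖x t‖ ≤ s * ‖b t‖) {t₁ : ℂ} (ht₁ : t₁ ∈ D) (hb₁ : b t₁ ≠ 0) :
    ∃ y : ℂ → ℂ, DifferentiableOn ℂ y D ∧ ∀ t ∈ D, x t = y t * b t := by
  have hne : ∀ t ∈ D, ∀ᶠ u in 𝓝[≠] t, b u ≠ 0 := by
    intro t ht
    rcases (hb.analyticAt (hD.mem_nhds ht)).eventually_eq_zero_or_eventually_ne_zero with h | h
    · exact absurd (eqOn_zero_of_eventually_eq_zero hD hDc hb ht h t₁ ht₁) hb₁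
    · exact h
  set g : ℂ → ℂ := fun t => x t / b t with hg
  set y : ℂ → ℂ := fun t => limUnder (𝓝[≠] t) g with hy
  have hgd : ∀ t ∈ D, b t ≠ 0 → DifferentiableAt ℂ g t := fun t ht h0 =>
    (hx.differentiableAt (hD.mem_nhds ht)).fun_div (hb.differentiableAt (hD.mem_nhds ht)) h0
  have hyg : ∀ t ∈ D, b t ≠ 0 → y t = g t := fun t ht h0 =>
    ((hgd t ht h0).continuousAt.tendsto.mono_left nhdsWithin_le_nhds).limUnder_eq
  refine ⟨y, fun t ht => ?_, fun t ht => ?_⟩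
  · apply DifferentiableAt.differentiableWithinAt
    obtain ⟨ε, hε, hball⟩ := Metric.mem_nhdsWithin_iff.1
      (inter_mem (hne t ht) (mem_nhdsWithin_of_mem_nhds (hD.mem_nhds ht)))
    have hball' : ∀ u ∈ ball t ε \ {t}, b u ≠ 0 ∧ u ∈ D := fun u hu => hball hu
    have h1 := differentiableOn_update_limUnder_of_bddAbove (f := g) (c := t)
      (ball_mem_nhds t hε) (fun u hu => (hgd u (hball' u hu).2
        (hball' u hu).1).differentiableWithinAt) ⟨s, ?_⟩
    · have h2 := h1.differentiableAt (ball_mem_nhds t hε)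
      refine h2.congr_of_eventuallyEq ?_
      filter_upwards [ball_mem_nhds t hε] with u hu
      by_cases hut : u = t
      · subst hut; simp [hy]
      · rw [Function.update_of_ne hut]
        exact hyg u (hball' u ⟨hu, hut⟩).2 (hball' u ⟨hu, hut⟩).1
    · rintro _ ⟨u, hu, rfl⟩
      have h3 := hball' u hu
      simp only [Function.comp_apply, hg, norm_div]
      rw [div_le_iff₀ (norm_pos_iff.2 h3.1)]
      exact hs u h3.2
  · by_cases h0 : b t = 0
    · have := hs t ht
      rw [h0, norm_zero, mul_zero] at this
      rw [h0, mul_zero, norm_le_zero_iff.1 this]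
    · rw [hyg t ht h0]; simp only [hg]; rw [div_mul_cancel₀ _ h0]

variable {E : Type*} [NormedAddCommGroup E] [NormedSpace ℂ E]

lemma exists_div_nhds {U : Set E} (hU : IsOpen U) {x b : E → ℂ} (hx : DifferentiableOn ℂ x U)
    (hb : DifferentiableOn ℂ b U) {S : E → ℝ} (hS : ContinuousOn S U)
    (hs : ∀ z ∈ U, ‖x z‖ ≤ S z * ‖b z‖) {p : E} (hp : p ∈ U) (hne : ∃ᶠ z in 𝓝 p, b z ≠ 0) :
    ∃ ε > 0, ∃ y : E → ℂ, DifferentiableOn ℂ y (ball p ε) ∧ ball p ε ⊆ U ∧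
      ∀ z ∈ ball p ε, x z = y z * b z := by
  have hev : ∀ᶠ z in 𝓝 p, S z < S p + 1 ∧ z ∈ U :=
    ((hS.continuousAt (hU.mem_nhds hp)).eventually_lt continuousAt_const (by simp)).and
      (hU.mem_nhds hp)
  obtain ⟨R, hR, hball⟩ := Metric.eventually_nhds_iff_ball.1 hev
  have hsub : ball p R ⊆ U := fun z hz => (hball z hz).2
  have hs' : ∀ z ∈ ball p R, ‖x z‖ ≤ (S p + 1) * ‖b z‖ := fun z hz =>
    (hs z (hsub hz)).trans (by gcongr; exact (hball z hz).1.le)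
  obtain ⟨z₁, hbz₁, hz₁⟩ := (hne.and_eventually (ball_mem_nhds p hR)).exists
  set v := z₁ - p with hv
  have hLd : ∀ z : E, Differentiable ℂ fun t : ℂ => z + t • v := fun z => by fun_prop
  have hDo : ∀ z : E, IsOpen ((fun t : ℂ => z + t • v) ⁻¹' ball p R) := fun z =>
    isOpen_ball.preimage (hLd z).continuous
  have hDc : ∀ z : E, Convex ℝ ((fun t : ℂ => z + t • v) ⁻¹' ball p R) := by
    intro z s hs t ht a b ha hb hab
    have h1 : z + (a • s + b • t) • v = a • (z + s • v) + b • (z + t • v) := by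
      have hz : z = a • z + b • z := by rw [← add_smul, hab, one_smul]
      simp only [smul_add, add_smul, smul_assoc]
      nth_rewrite 1 [hz]
      abel
    rw [mem_preimage, h1]
    exact convex_ball p R hs ht ha hb hab
  have hxL : ∀ z, DifferentiableOn ℂ (fun t : ℂ => x (z + t • v))
      ((fun t : ℂ => z + t • v) ⁻¹' ball p R) := fun z =>
    (hx.mono hsub).comp (hLd z).differentiableOn fun t ht => ht
  have hbL : ∀ z, DifferentiableOn ℂ (fun t : ℂ => b (z + t • v))
      ((fun t : ℂ => z + t • v) ⁻¹' ball p R) := fun z =>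
    (hb.mono hsub).comp (hLd z).differentiableOn fun t ht => ht
  have h0mem : (0 : ℂ) ∈ (fun t : ℂ => p + t • v) ⁻¹' ball p R := by simpa using hR
  have h1mem : (1 : ℂ) ∈ (fun t : ℂ => p + t • v) ⁻¹' ball p R := by simpa [hv] using hz₁
  have hne0 : ∀ᶠ t in 𝓝[≠] (0 : ℂ), b (p + t • v) ≠ 0 := by
    rcases ((hbL p).analyticAt ((hDo p).mem_nhds
      h0mem)).eventually_eq_zero_or_eventually_ne_zero with h | h
    · refine absurd (eqOn_zero_of_eventually_eq_zero (hDo p) (hDc p) (hbL p) h0mem h 1 h1mem) ?_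
      simpa [hv] using hbz₁
    · exact h
  obtain ⟨δ, hδ, hδb⟩ := Metric.mem_nhdsWithin_iff.1
    (inter_mem hne0 (mem_nhdsWithin_of_mem_nhds ((hDo p).mem_nhds h0mem)))
  have hδb' : ∀ t ∈ ball (0 : ℂ) δ \ {0}, b (p + t • v) ≠ 0 ∧ p + t • v ∈ ball p R :=
    fun t ht => hδb ht
  set ρ := δ / 2 with hρ
  have hρ0 : 0 < ρ := by positivity
  have hsph : ∀ t ∈ sphere (0 : ℂ) ρ, t ∈ ball (0 : ℂ) δ \ {0} := fun t ht => by
    refine ⟨?_, ne_of_mem_sphere ht hρ0.ne'⟩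
    rw [mem_sphere] at ht; rw [mem_ball, ht]; linarith
  have hρv : ρ * ‖v‖ < R := by
    have := (hδb' ρ (hsph ρ (by simp [abs_of_pos hρ0]))).2
    simpa [norm_smul, abs_of_pos hρ0] using this
  have hΩ : IsOpen (ball p R ∩ {z | b z ≠ 0}) :=
    (hb.mono hsub).continuousOn.isOpen_inter_preimage isOpen_ball isOpen_ne
  have hq : DifferentiableOn ℂ (fun z => x z * (b z)⁻¹) (ball p R ∩ {z | b z ≠ 0}) :=
    (hx.mono fun z hz => hsub hz.1).fun_mul
      ((hb.mono fun z hz => hsub hz.1).fun_inv fun z hz => hz.2)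
  obtain ⟨ε, hε, hΩε, hdiff⟩ := exists_differentiableOn_circleIntegral hΩ hq (p := p) (v := v)
    (ρ := ρ) (φ := fun t => t⁻¹)
    (continuousOn_id.inv₀ fun t ht => ne_of_mem_sphere ht (abs_pos.2 hρ0.ne').ne')
    (fun t ht => by
      rw [abs_of_pos hρ0] at ht
      exact ⟨(hδb' t (hsph t ht)).2, (hδb' t (hsph t ht)).1⟩)
  rw [abs_of_pos hρ0] at hΩε
  set η := min ε (R - ρ * ‖v‖) with hη
  have hη0 : 0 < η := lt_min hε (by linarith)
  refine ⟨η, hη0, fun z => (2 * Real.pi * I : ℂ)⁻¹ •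
    ∮ t in C(0, ρ), t⁻¹ • (x (z + t • v) * (b (z + t • v))⁻¹), ?_, ?_, ?_⟩
  · have h1 := hdiff.mono (ball_subset_ball (min_le_left ε (R - ρ * ‖v‖)))
    exact h1.fun_const_smul (2 * Real.pi * I : ℂ)⁻¹
  · refine (ball_subset_ball ?_).trans hsub
    refine (min_le_right _ _).trans ?_
    have := norm_nonneg v
    nlinarith
  · intro z hz
    have hcb : ∀ t ∈ closedBall (0 : ℂ) ρ, z + t • v ∈ ball p R := by
      intro t ht
      rw [mem_closedBall, dist_zero_right] at ht
      have h1 : dist z p < R - ρ * ‖v‖ := hz.trans_le (min_le_right _ _)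
      rw [dist_eq_norm] at h1
      rw [mem_ball, dist_eq_norm]
      calc ‖z + t • v - p‖ = ‖(z - p) + t • v‖ := by congr 1; abel
        _ ≤ ‖z - p‖ + ‖t‖ * ‖v‖ := by rw [← norm_smul]; exact norm_add_le _ _
        _ ≤ ‖z - p‖ + ρ * ‖v‖ := by gcongr
        _ < R := by linarith
    have hz' : z ∈ ball p ε := ball_subset_ball (min_le_left _ _) hz
    have hρs : (ρ : ℂ) ∈ sphere (0 : ℂ) ρ := by simp [abs_of_pos hρ0]
    obtain ⟨Y, hYd, hY⟩ := exists_div_one_variable (hDo z) (hDc z) (hxL z) (hbL z)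
      (fun t ht => hs' _ ht) (t₁ := ρ) (hcb ρ (sphere_subset_closedBall hρs))
      (hΩε z hz' ρ hρs).2
    have hcau := DifferentiableOn.circleIntegral_sub_inv_smul (hYd.mono hcb)
      (Metric.mem_ball_self hρ0)
    have hcongr : (∮ t in C(0, ρ), t⁻¹ • (x (z + t • v) * (b (z + t • v))⁻¹)) =
        ∮ t in C(0, ρ), (t - 0)⁻¹ • Y t := by
      refine circleIntegral.integral_congr hρ0.le fun t ht => ?_
      have h0 := (hΩε z hz' t ht).2
      have h1 := hY t (hcb t (sphere_subset_closedBall ht))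
      simp only [sub_zero]
      rw [h1, mul_assoc, mul_inv_cancel₀ h0, mul_one]
    have h2 := hY 0 (hcb 0 (mem_closedBall_self hρ0.le))
    simp only [zero_smul, add_zero] at h2
    rw [h2]
    congr 1
    beta_reduce
    rw [hcongr, hcau, smul_smul, inv_mul_cancel₀ Complex.two_pi_I_ne_zero, one_smul]

/-- Division of holomorphic functions with locally bounded quotient. -/
theorem exists_div {U : Set E} (hU : IsOpen U) {x b : E → ℂ} (hx : DifferentiableOn ℂ x U)
    (hb : DifferentiableOn ℂ b U) {S : E → ℝ} (hS : ContinuousOn S U)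
    (hs : ∀ z ∈ U, ‖x z‖ ≤ S z * ‖b z‖) (hne : ∀ p ∈ U, ∃ᶠ z in 𝓝 p, b z ≠ 0) :
    ∃ y : E → ℂ, DifferentiableOn ℂ y U ∧ ∀ z ∈ U, x z = y z * b z := by
  set y : E → ℂ := fun z => limUnder (𝓝[{w | b w ≠ 0}] z) fun w => x w * (b w)⁻¹ with hy
  have key : ∀ p ∈ U, ∃ ε > 0, ∃ y' : E → ℂ, DifferentiableOn ℂ y' (ball p ε) ∧
      (∀ z ∈ ball p ε, x z = y' z * b z) ∧ ∀ z ∈ ball p ε, y z = y' z := by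
    intro p hp
    obtain ⟨ε, hε, y', h1, h2, h3⟩ := exists_div_nhds hU hx hb hS hs hp (hne p hp)
    refine ⟨ε, hε, y', h1, h3, fun z hz => ?_⟩
    have hnb : NeBot (𝓝[{w | b w ≠ 0}] z) :=
      mem_closure_iff_nhdsWithin_neBot.1 (mem_closure_iff_frequently.2 (hne z (h2 hz)))
    refine Tendsto.limUnder_eq ?_
    have hc : Tendsto y' (𝓝[{w | b w ≠ 0}] z) (𝓝 (y' z)) :=
      (h1.continuousOn.continuousAt (isOpen_ball.mem_nhds hz)).tendsto.mono_left
        nhdsWithin_le_nhds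
    refine hc.congr' ?_
    filter_upwards [mem_nhdsWithin_of_mem_nhds (isOpen_ball.mem_nhds hz),
      self_mem_nhdsWithin] with w hw hw0
    rw [h3 w hw, mul_assoc, mul_inv_cancel₀ hw0, mul_one]
  refine ⟨y, fun p hp => ?_, fun p hp => ?_⟩
  · obtain ⟨ε, hε, y', h1, h2, h3⟩ := key p hp
    refine DifferentiableAt.differentiableWithinAt ?_
    refine (h1.differentiableAt (ball_mem_nhds p hε)).congr_of_eventuallyEq ?_
    filter_upwards [ball_mem_nhds p hε] with z hz using h3 z hz
  · obtain ⟨ε, hε, y', h1, h2, h3⟩ := key p hp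
    rw [h3 p (mem_ball_self hε)]
    exact h2 p (mem_ball_self hε)

end Division

lemma norm_mul_le_of_relation {J : ℕ} (hJ : J ≠ 0) {c : ℕ → ℂ} {a b : ℂ}
    (h : ∑ j ∈ Finset.range (J + 1), c j * a ^ j * b ^ (J - j) = 0) :
    ‖c J * a‖ ≤ (1 + ∑ j ∈ Finset.range J, ‖c j * c J ^ (J - 1 - j)‖) * ‖b‖ := by
  have hS : 0 ≤ ∑ j ∈ Finset.range J, ‖c j * c J ^ (J - 1 - j)‖ :=
    Finset.sum_nonneg fun _ _ => norm_nonneg _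
  by_cases hb : b = 0
  · have h1 : c J * a ^ J = 0 := by
      rw [Finset.sum_range_succ, Finset.sum_eq_zero, zero_add] at h
      · simpa using h
      · intro j hj
        have : J - j ≠ 0 := by have := Finset.mem_range.1 hj; omega
        simp [hb, this]
    have h2 : c J * a = 0 := by
      rcases mul_eq_zero.1 h1 with h3 | h3
      · simp [h3]
      · simp [eq_zero_of_pow_eq_zero h3]
    simp [h2, hb]
  · set w := c J * a / b with hw
    have hcw : c J * a = w * b := by rw [hw, div_mul_cancel₀ _ hb]
    have h1 : ∑ j ∈ Finset.range J, c j * c J ^ (J - 1 - j) * w ^ j + w ^ J = 0 := by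
      have h2 : c J ^ (J - 1) / b ^ J *
          ∑ j ∈ Finset.range (J + 1), c j * a ^ j * b ^ (J - j) = 0 := by rw [h, mul_zero]
      rw [Finset.sum_range_succ, mul_add, Finset.mul_sum] at h2
      rw [← h2]
      congr 1
      · refine Finset.sum_congr rfl fun j hj => ?_
        have hj := Finset.mem_range.1 hj
        have e1 : b ^ J = b ^ j * b ^ (J - j) := by rw [← pow_add]; congr 1; omega
        have e2 : c J ^ (J - 1) = c J ^ (J - 1 - j) * c J ^ j := by
          rw [← pow_add]; congr 1; omega
        rw [hw, div_pow, mul_pow, e1, e2]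
        field_simp
      · have e2 : c J ^ J = c J ^ (J - 1) * c J := by
          rw [← pow_succ]; congr 1; omega
        rw [hw, div_pow, mul_pow, e2, Nat.sub_self, pow_zero]
        ring
    rw [hcw, norm_mul]
    refine mul_le_mul_of_nonneg_right ?_ (norm_nonneg b)
    by_contra! hlt
    have hw1 : 1 < ‖w‖ := by linarith
    have h3 : ‖w‖ ^ J ≤ (∑ j ∈ Finset.range J, ‖c j * c J ^ (J - 1 - j)‖) * ‖w‖ ^ (J - 1) := by
      rw [← norm_pow, show w ^ J = -∑ j ∈ Finset.range J, c j * c J ^ (J - 1 - j) * w ^ j by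
        linear_combination h1, norm_neg, Finset.sum_mul]
      refine (norm_sum_le _ _).trans (Finset.sum_le_sum fun j hj => ?_)
      have hj := Finset.mem_range.1 hj
      rw [norm_mul, norm_pow]
      gcongr
      · exact hw1.le
      · omega
    have e : ‖w‖ ^ J = ‖w‖ * ‖w‖ ^ (J - 1) := by rw [← pow_succ']; congr 1; omega
    rw [e] at h3
    have := le_of_mul_le_mul_right h3 (by positivity)
    linarith

namespace ConicFoliation

section

variable {V : Type*} [NormedAddCommGroup V] [InnerProductSpace ℂ V] [FiniteDimensional ℂ V]
variable {M : Set V} {r C : ℝ} {f : V → V → ℂ}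

lemma exists_ne_zero_smul (h : ConicFoliation M r C f) {q q' : V} (hq : q ∈ M) (hq' : q' ∈ M)
    {c : ℂ} (hc : c ≠ 0) {z : V} (hz : z ∈ ball q (r * ‖q‖)) (hz' : c • z ∈ ball q' (r * ‖q'‖)) :
    ∃ k : ℂ, k ≠ 0 ∧ fderiv ℂ (f q') (c • z) = k • fderiv ℂ (f q) z := by
  obtain ⟨k, hk⟩ := h.compat q hq q' hq' c hc z hz hz'
  refine ⟨k, ?_, hk⟩
  rintro rfl
  have := h.fderiv_norm_pos hq' hz'
  have h0 : fderiv ℂ (f q') (c • z) = 0 := by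
    ext w
    rw [hk, smul_apply, zero_smul, zero_apply]
  simp [h0] at this

lemma exists_ne_zero_smul' (h : ConicFoliation M r C f) {q q' : V} (hq : q ∈ M) (hq' : q' ∈ M)
    {z : V} (hz : z ∈ ball q (r * ‖q‖)) (hz' : z ∈ ball q' (r * ‖q'‖)) :
    ∃ k : ℂ, k ≠ 0 ∧ fderiv ℂ (f q') z = k • fderiv ℂ (f q) z := by
  simpa using h.exists_ne_zero_smul hq hq' one_ne_zero hz (by rwa [one_smul])

lemma differentiableOn_form (h : ConicFoliation M r C f) (v : V) :
    ∀ q ∈ M, DifferentiableOn ℂ (fun z => fderiv ℂ (f q) z v) (ball q (r * ‖q‖)) :=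
  fun q hq => differentiableOn_fderiv_apply isOpen_ball (h.differentiableOn q hq) v

lemma frequently_form_ne_zero (h : ConicFoliation M r C f) {v q₀ z₀ : V} (hq₀ : q₀ ∈ M)
    (hz₀ : z₀ ∈ ball q₀ (r * ‖q₀‖)) (h0 : fderiv ℂ (f q₀) z₀ v ≠ 0) {q z : V} (hq : q ∈ M)
    (hz : z ∈ ball q (r * ‖q‖)) : ∃ᶠ w in 𝓝 z, fderiv ℂ (f q) w v ≠ 0 := by
  intro hcon
  refine h0 (h.eq_zero_of_eventually (φ := fun q z => fderiv ℂ (f q) z v)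
    (h.differentiableOn_form v) ?_ hq hz (by simpa using hcon) q₀ hq₀ z₀ hz₀)
  intro q hq q' hq' z hz hz' h1
  obtain ⟨k, -, hk⟩ := h.exists_ne_zero_smul' hq hq' hz hz'
  simp [hk, h1]

end

section Algebraic

variable {n : ℕ} {M : Set (EuclideanSpace ℂ (Fin (n + 1)))} {r C : ℝ}
  {f : EuclideanSpace ℂ (Fin (n + 1)) → EuclideanSpace ℂ (Fin (n + 1)) → ℂ}

/-- The exponent of total degree `n * K` with prescribed last `n` entries. -/
def exponent {K : ℕ} (e : Fin n → Fin (K + 1)) : Fin (n + 1) →₀ ℕ :=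
  Finsupp.equivFunOnFinite.symm (Fin.cons (n * K - ∑ i, (e i : ℕ)) fun i => (e i : ℕ))

lemma exponent_injective {K : ℕ} :
    Function.Injective (exponent : (Fin n → Fin (K + 1)) → Fin (n + 1) →₀ ℕ) := by
  intro e e' h
  ext i
  have := DFunLike.congr_fun h i.succ
  simpa [exponent] using this

lemma degree_exponent {K : ℕ} (e : Fin n → Fin (K + 1)) : (exponent e).degree = n * K := by
  have h1 : ∑ i, (e i : ℕ) ≤ n * K := by
    calc ∑ i, (e i : ℕ) ≤ ∑ _i : Fin n, K := Finset.sum_le_sum fun i _ => by omega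
      _ = n * K := by simp
  rw [Finsupp.degree_eq_sum, Fin.sum_univ_succ]
  simp only [exponent, Finsupp.equivFunOnFinite_symm_apply_apply, Fin.cons_zero, Fin.cons_succ]
  omega

/-- The homogeneous polynomial of degree `n * K` with prescribed coefficients. -/
def boxPolynomial {K : ℕ} (s : (Fin n → Fin (K + 1)) → ℂ) : MvPolynomial (Fin (n + 1)) ℂ :=
  ∑ e, MvPolynomial.monomial (exponent e) (s e)

lemma isHomogeneous_boxPolynomial {K : ℕ} (s : (Fin n → Fin (K + 1)) → ℂ) :
    (boxPolynomial s).IsHomogeneous (n * K) :=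
  MvPolynomial.IsHomogeneous.sum _ _ _ fun e _ =>
    MvPolynomial.isHomogeneous_monomial _ (degree_exponent e)

lemma coeff_boxPolynomial {K : ℕ} (s : (Fin n → Fin (K + 1)) → ℂ) (e : Fin n → Fin (K + 1)) :
    (boxPolynomial s).coeff (exponent e) = s e := by
  simp [boxPolynomial, MvPolynomial.coeff_sum, MvPolynomial.coeff_monomial,
    exponent_injective.eq_iff]

lemma exists_relation (h : ConicFoliation M r C f) (hn : 2 ≤ n)
    (u v : EuclideanSpace ℂ (Fin (n + 1))) :
    ∃ (K m : ℕ) (c : ℕ → MvPolynomial (Fin (n + 1)) ℂ), (∀ j, (c j).IsHomogeneous m) ∧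
      (∃ j ∈ Finset.range (K + 1), c j ≠ 0) ∧ ∀ q ∈ M, ∀ z ∈ ball q (r * ‖q‖),
        ∑ j ∈ Finset.range (K + 1), polyEval (c j) z * fderiv ℂ (f q) z u ^ j *
          fderiv ℂ (f q) z v ^ (K - j) = 0 := by
  obtain ⟨ν, c, hνc⟩ := h.exists_vanishing_section (n := n) (by simp) hn
  set K := ν * (c * (n + 1) + 1) ^ n with hK
  let L : (Fin (K + 1) → (Fin n → Fin (K + 1)) → ℂ) →ₗ[ℂ]
      (EuclideanSpace ℂ (Fin (n + 1)) → EuclideanSpace ℂ (Fin (n + 1)) → ℂ) :=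
    { toFun := fun s q z => ∑ j : Fin (K + 1), polyEval (boxPolynomial (s j)) z *
        fderiv ℂ (f q) z u ^ (j : ℕ) * fderiv ℂ (f q) z v ^ (K - j)
      map_add' := by
        intro s t; ext q z
        simp [polyEval, boxPolynomial, add_mul, Finset.sum_add_distrib]
      map_smul' := by
        intro s t; ext q z
        simp [polyEval, boxPolynomial, Finset.mul_sum, Finset.sum_mul, mul_assoc,
          MvPolynomial.eval_monomial] }
  have hL : ∀ s, IsSection M r f K (n * K) (L s) := by
    intro s
    refine ⟨fun q hq => ?_, fun q hq q' hq' a ha z hz hz' => ?_⟩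
    · simp only [L, LinearMap.coe_mk, AddHom.coe_mk]
      have hu := h.differentiableOn_form u q hq
      have hv := h.differentiableOn_form v q hq
      refine DifferentiableOn.fun_sum fun j _ => ?_
      exact ((differentiable_polyEval _).differentiableOn.fun_mul (hu.fun_pow _)).fun_mul
        (hv.fun_pow _)
    · obtain ⟨k, -, hk⟩ := h.exists_ne_zero_smul hq hq' ha hz hz'
      have h1 : L s q' (a • z) = a ^ (n * K) * k ^ K * L s q z := by
        simp only [L, LinearMap.coe_mk, AddHom.coe_mk, Finset.mul_sum]
        refine Finset.sum_congr rfl fun j _ => ?_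
        have hj : k ^ K = k ^ (j : ℕ) * k ^ (K - j) := by rw [← pow_add]; congr 1; omega
        rw [polyEval_smul (isHomogeneous_boxPolynomial _), hk, hj]
        simp only [smul_apply, smul_eq_mul, mul_pow]
        ring
      rw [h1, hk, norm_smul, norm_mul, norm_mul, norm_pow, norm_pow]
      ring
  have hdim : ν * (c * (K + n * K) + 1) ^ n <
      Module.finrank ℂ (Fin (K + 1) → (Fin n → Fin (K + 1)) → ℂ) := by
    have h1 : Module.finrank ℂ (Fin (K + 1) → (Fin n → Fin (K + 1)) → ℂ) =
        (K + 1) * (K + 1) ^ n := by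
      rw [Module.finrank_pi_fintype]; simp
    rw [h1]
    calc ν * (c * (K + n * K) + 1) ^ n ≤ ν * ((c * (n + 1) + 1) * (K + 1)) ^ n := by
          gcongr; nlinarith
      _ = K * (K + 1) ^ n := by rw [mul_pow, hK]; ring
      _ < _ := by gcongr; omega
  obtain ⟨s, hs0, hs⟩ := hνc K (n * K) _ L hL hdim
  refine ⟨K, n * K, fun j => if hj : j < K + 1 then boxPolynomial (s ⟨j, hj⟩) else 0,
    fun j => ?_, ?_, fun q hq z hz => ?_⟩
  · beta_reduce
    split_ifs
    · exact isHomogeneous_boxPolynomial _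
    · exact MvPolynomial.isHomogeneous_zero _ _ _
  · by_contra! hcon
    refine hs0 (funext fun j => funext fun e => ?_)
    have := hcon j (Finset.mem_range.2 j.2)
    rw [dif_pos j.2] at this
    have h2 := congrArg (MvPolynomial.coeff (exponent e)) this
    rwa [coeff_boxPolynomial] at h2
  · rw [Finset.sum_range]
    simpa [L, Nat.lt_succ_iff.1 (Fin.is_lt _)] using hs q hq z hz

lemma exists_leading_relation (h : ConicFoliation M r C f) (hn : 2 ≤ n)
    (u v : EuclideanSpace ℂ (Fin (n + 1))) {q₀ z₀ : EuclideanSpace ℂ (Fin (n + 1))} (hq₀ : q₀ ∈ M)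
    (hz₀ : z₀ ∈ ball q₀ (r * ‖q₀‖)) (h0 : fderiv ℂ (f q₀) z₀ v ≠ 0) :
    ∃ (J m : ℕ) (c : ℕ → MvPolynomial (Fin (n + 1)) ℂ), J ≠ 0 ∧ (c J).IsHomogeneous m ∧
      c J ≠ 0 ∧ ∀ q ∈ M, ∀ z ∈ ball q (r * ‖q‖),
        ∑ j ∈ Finset.range (J + 1), polyEval (c j) z * fderiv ℂ (f q) z u ^ j *
          fderiv ℂ (f q) z v ^ (J - j) = 0 := by
  classical
  obtain ⟨K, m, c, hcm, ⟨j₀, hj₀, hcj₀⟩, hrel⟩ := h.exists_relation hn u v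
  set S := (Finset.range (K + 1)).filter fun j => c j ≠ 0
  have hS : S.Nonempty := ⟨j₀, Finset.mem_filter.2 ⟨hj₀, hcj₀⟩⟩
  set J := S.max' hS with hJ
  obtain ⟨hJK, hJ0⟩ := Finset.mem_filter.1 (S.max'_mem hS)
  have hJK' : J ≤ K := Nat.lt_succ_iff.1 (Finset.mem_range.1 hJK)
  have hrel' := h.eq_zero_of_mul_eq_zero (φ := fun q z => fderiv ℂ (f q) z v ^ (K - J))
    (ψ := fun q z => ∑ j ∈ Finset.range (J + 1), polyEval (c j) z * fderiv ℂ (f q) z u ^ j *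
          fderiv ℂ (f q) z v ^ (J - j)) (fun q hq => (h.differentiableOn_form v q hq).fun_pow _)
    (fun q hq => DifferentiableOn.fun_sum fun j _ =>
      ((differentiable_polyEval _).differentiableOn.fun_mul
        ((h.differentiableOn_form u q hq).fun_pow _)).fun_mul
        ((h.differentiableOn_form v q hq).fun_pow _)) ?_ hq₀ hz₀ (pow_ne_zero _ h0) ?_
  · refine ⟨J, m, c, ?_, hcm J, hJ0, hrel'⟩
    intro hJz
    refine hJ0 (eq_zero_of_eventually_polyEval (p := z₀) ?_)
    filter_upwards [isOpen_ball.mem_nhds hz₀] with z hz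
    have := hrel' q₀ hq₀ z hz
    rw [← hJ]
    rw [hJz] at this ⊢
    simpa using this
  · intro q hq q' hq' z hz hz' h1
    obtain ⟨k, -, hk⟩ := h.exists_ne_zero_smul' hq hq' hz hz'
    have : ∑ j ∈ Finset.range (J + 1), polyEval (c j) z * fderiv ℂ (f q') z u ^ j *
          fderiv ℂ (f q') z v ^ (J - j) = k ^ J * ∑ j ∈ Finset.range (J + 1),
          polyEval (c j) z * fderiv ℂ (f q) z u ^ j * fderiv ℂ (f q) z v ^ (J - j) := by
      rw [Finset.mul_sum]
      refine Finset.sum_congr rfl fun j hj => ?_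
      have hj := Finset.mem_range.1 hj
      have hkj : k ^ J = k ^ j * k ^ (J - j) := by rw [← pow_add]; congr 1; omega
      rw [hk, hkj]
      simp only [smul_apply, smul_eq_mul, mul_pow]
      ring
    rw [this, h1, mul_zero]
  · intro q hq z hz
    rw [← hrel q hq z hz, Finset.mul_sum]
    have hsub : Finset.range (J + 1) ⊆ Finset.range (K + 1) :=
      Finset.range_subset_range.2 (by omega)
    rw [← Finset.sum_subset hsub]
    · refine Finset.sum_congr rfl fun j hj => ?_
      have hj := Finset.mem_range.1 hj
      rw [show K - j = (K - J) + (J - j) by omega, pow_add]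
      ring
    · intro j hj hj'
      have : c j = 0 := by
        by_contra hne
        have := S.le_max' j (Finset.mem_filter.2 ⟨hj, hne⟩)
        exact hj' (Finset.mem_range.2 (by omega))
      simp [this, polyEval]

/-- The foliation is algebraic: ratios of the components of its defining form are rational. -/
theorem exists_rational (h : ConicFoliation M r C f) (hn : 2 ≤ n)
    (u v : EuclideanSpace ℂ (Fin (n + 1))) {q₀ z₀ : EuclideanSpace ℂ (Fin (n + 1))} (hq₀ : q₀ ∈ M)
    (hz₀ : z₀ ∈ ball q₀ (r * ‖q₀‖)) (h0 : fderiv ℂ (f q₀) z₀ v ≠ 0) :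
    ∃ c P : MvPolynomial (Fin (n + 1)) ℂ, c ≠ 0 ∧ ∀ q ∈ M, ∀ z ∈ ball q (r * ‖q‖),
      polyEval c z * fderiv ℂ (f q) z u = polyEval P z * fderiv ℂ (f q) z v := by
  obtain ⟨J, m, c, hJ, hcm, hcJ, hrel⟩ := h.exists_leading_relation hn u v hq₀ hz₀ h0
  have hfreq := fun q (hq : q ∈ M) z hz => h.frequently_form_ne_zero hq₀ hz₀ h0 hq (z := z) hz
  have hdiv : ∀ q ∈ M, ∃ y : EuclideanSpace ℂ (Fin (n + 1)) → ℂ,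
      DifferentiableOn ℂ y (ball q (r * ‖q‖)) ∧ ∀ z ∈ ball q (r * ‖q‖),
        polyEval (c J) z * fderiv ℂ (f q) z u = y z * fderiv ℂ (f q) z v := by
    intro q hq
    refine exists_div isOpen_ball
      ((differentiable_polyEval (c J)).differentiableOn.fun_mul (h.differentiableOn_form u q hq))
      (h.differentiableOn_form v q hq)
      (S := fun z => 1 + ∑ j ∈ Finset.range J,
        ‖polyEval (c j) z * polyEval (c J) z ^ (J - 1 - j)‖)
      ?_ (fun z hz => norm_mul_le_of_relation (c := fun j => polyEval (c j) z) hJ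
        (hrel q hq z hz)) (hfreq q hq)
    have := fun j => (differentiable_polyEval (c j)).continuous
    fun_prop
  choose! y hyd hy using hdiv
  have hcons : ∀ q ∈ M, ∀ q' ∈ M, ∀ z ∈ ball q (r * ‖q‖), z ∈ ball q' (r * ‖q'‖) →
      y q z = y q' z := by
    intro q hq q' hq' z hz hz'
    set U := ball q (r * ‖q‖) ∩ ball q' (r * ‖q'‖)
    have hU : IsOpen U := isOpen_ball.inter isOpen_ball
    obtain ⟨w, hw0, hw⟩ := ((hfreq q hq z hz).and_eventually (hU.mem_nhds ⟨hz, hz'⟩)).exists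
    have hd : DifferentiableOn ℂ (fun z => y q z - y q' z) U :=
      ((hyd q hq).mono inter_subset_left).fun_sub ((hyd q' hq').mono inter_subset_right)
    refine sub_eq_zero.1 (eqOn_zero_of_eventually_eq_zero hU
      ((convex_ball _ _).inter (convex_ball _ _)) hd hw ?_ z ⟨hz, hz'⟩)
    have hcont := ((h.differentiableOn_form v q hq).continuousOn.continuousAt
      (isOpen_ball.mem_nhds hw.1)).eventually_ne hw0
    filter_upwards [hcont, hU.mem_nhds hw] with x hx0 hx
    obtain ⟨k, hk0, hk⟩ := h.exists_ne_zero_smul' hq hq' hx.1 hx.2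
    have h1 := hy q hq x hx.1
    have h2 := hy q' hq' x hx.2
    simp only [hk, smul_apply, smul_eq_mul] at h2
    have h3 : (y q x - y q' x) * (k * fderiv ℂ (f q) x v) = 0 := by
      linear_combination h2 - k * h1
    exact (mul_eq_zero.1 h3).resolve_right (mul_ne_zero hk0 hx0)
  have hex : ∀ z ∈ nbhd M r, ∃ q ∈ M, z ∈ ball q (r * ‖q‖) := fun z hz => mem_nbhd.1 hz
  choose! Q hQM hQ using hex
  set Y : EuclideanSpace ℂ (Fin (n + 1)) → ℂ := fun z => y (Q z) z with hY
  have hYq : ∀ q ∈ M, ∀ z ∈ ball q (r * ‖q‖), Y z = y q z := by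
    intro q hq z hz
    have hzU : z ∈ nbhd M r := mem_nbhd.2 ⟨q, hq, hz⟩
    exact hcons _ (hQM z hzU) q hq z (hQ z hzU) hz
  have hYd : DifferentiableOn ℂ Y (nbhd M r) := by
    intro z hz
    obtain ⟨q, hq, hz⟩ := mem_nbhd.1 hz
    refine DifferentiableAt.differentiableWithinAt ?_
    refine ((hyd q hq).differentiableAt (isOpen_ball.mem_nhds hz)).congr_of_eventuallyEq ?_
    filter_upwards [isOpen_ball.mem_nhds hz] with w hw using hYq q hq w hw
  have hYh : ∀ a : ℂ, a ≠ 0 → ∀ z ∈ nbhd M r, Y (a • z) = a ^ m * Y z := by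
    intro a ha z hz
    obtain ⟨q, hq, hz⟩ := mem_nbhd.1 hz
    refine sub_eq_zero.1 (h.eq_zero_of_mul_eq_zero (φ := fun q z => fderiv ℂ (f q) z v)
      (ψ := fun _ z => Y (a • z) - a ^ m * Y z) (h.differentiableOn_form v) ?_
      (fun _ _ _ _ _ _ _ h0 => h0) hq₀ hz₀ h0 ?_ q hq z hz)
    · intro q hq z hz
      have hzU : z ∈ nbhd M r := mem_nbhd.2 ⟨q, hq, hz⟩
      have h1 := hYd.differentiableAt (isOpen_nbhd.mem_nhds hzU)
      have h2 := hYd.differentiableAt (isOpen_nbhd.mem_nhds (h.smul_mem_nbhd hzU ha))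
      have h3 : DifferentiableAt ℂ (fun z => Y (a • z)) z :=
        h2.comp z (differentiableAt_id.const_smul a)
      exact (h3.fun_sub (h1.const_mul _)).differentiableWithinAt
    · intro q hq z hz
      have hz' := smul_mem_ball hz ha
      have hq' := h.smul_mem a ha q hq
      obtain ⟨k, hk0, hk⟩ := h.exists_ne_zero_smul hq hq' ha hz hz'
      have h1 := hy q hq z hz
      have h2 := hy _ hq' _ hz'
      simp only [hk, smul_apply, smul_eq_mul, polyEval_smul hcm] at h2
      rw [← hYq q hq z hz] at h1
      rw [← hYq _ hq' _ hz'] at h2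
      refine mul_left_cancel₀ hk0 ?_
      linear_combination k * a ^ m * h1 - h2
  obtain ⟨P, -, hP⟩ := h.exists_polynomial (by omega) m hYd hYh
  refine ⟨c J, P, hcJ, fun q hq z hz => ?_⟩
  rw [hy q hq z hz, ← hYq q hq z hz, hP z (mem_nbhd.2 ⟨q, hq, hz⟩)]

end Algebraic

end ConicFoliation

section CommonDivisors

open Polynomial in
/-- Polynomials over a factorial ring without nontrivial common divisor generate an ideal which
contains a nonzero constant. -/
lemma exists_C_mem_span {R : Type*} [CommRing R] [IsDomain R] [NormalizedGCDMonoid R]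
    {ι : Type*} {p : ι → R[X]} (hp : ∀ d, (∀ i, d ∣ p i) → IsUnit d) :
    ∃ a : R, a ≠ 0 ∧ C a ∈ Ideal.span (range p) := by
  set K := FractionRing R
  obtain ⟨g, hg⟩ := (inferInstance :
    (Ideal.map (mapRingHom (algebraMap R K)) (Ideal.span (range p))).IsPrincipal)
  have hgp : ∀ i, g ∣ map (algebraMap R K) (p i) := by
    intro i
    rw [← Ideal.mem_span_singleton]
    change _ ∈ Submodule.span _ _
    rw [← hg]
    exact Ideal.mem_map_of_mem (mapRingHom (algebraMap R K)) (Ideal.subset_span (mem_range_self i))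
  have hg0 : g ≠ 0 := by
    rintro rfl
    refine not_isUnit_zero (hp 0 fun i => ?_)
    rw [zero_dvd_iff]
    have := zero_dvd_iff.1 (hgp i)
    rwa [Polynomial.map_eq_zero_iff (IsFractionRing.injective R K)] at this
  have hunit : IsUnit g := by
    refine isUnit_or_eq_zero_of_isUnit_integerNormalization_primPart hg0 (hp _ fun i => ?_)
    set G := IsLocalization.integerNormalization (nonZeroDivisors R) g with hG
    refine G.isPrimitive_primPart.dvd_of_fraction_map_dvd_fraction_map (K := K) ?_
    obtain ⟨b, hb, hbG⟩ := IsLocalization.integerNormalization_spec (nonZeroDivisors R) g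
    have h1 : map (algebraMap R K) G.primPart ∣ C (algebraMap R K b) * g := by
      have h2 : map (algebraMap R K) G = C (algebraMap R K b) * g := by
        rw [hG, hbG, ← Polynomial.smul_eq_C_mul, algebraMap_smul]
      rw [← h2]
      exact Polynomial.map_dvd _ (Polynomial.primPart_dvd G)
    have h3 : IsUnit (C (algebraMap R K b)) := by
      rw [Polynomial.isUnit_C, isUnit_iff_ne_zero]
      exact fun h => nonZeroDivisors.ne_zero hb (IsFractionRing.injective R K (by simpa using h))
    exact (h3.dvd_mul_left.1 h1).trans (hgp i)
  have hone : (1 : K[X]) ∈ Ideal.map (mapRingHom (algebraMap R K)) (Ideal.span (range p)) := by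
    rw [hg]
    change _ ∈ Ideal.span {g}
    rw [Ideal.span_singleton_eq_top.2 hunit]
    trivial
  let _ : Algebra R[X] K[X] := Polynomial.algebra R K
  have := Polynomial.isLocalization (nonZeroDivisors R) K
  obtain ⟨⟨x, ⟨_, b, hb, rfl⟩⟩, hx⟩ := (IsLocalization.mem_map_algebraMap_iff
    ((nonZeroDivisors R).map (C : R →+* R[X])) K[X]).1 hone
  rw [one_mul] at hx
  refine ⟨b, nonZeroDivisors.ne_zero hb, ?_⟩
  have h4 : C b = (x : R[X]) :=
    Polynomial.map_injective _ (IsFractionRing.injective R K) hx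
  rw [h4]
  exact x.2

variable {N : ℕ}

lemma polyEval_eq_zero_of_mem_span {ι : Type*} {B : ι → MvPolynomial (Fin N) ℂ}
    {R : MvPolynomial (Fin N) ℂ} (hR : R ∈ Ideal.span (range B)) {z : EuclideanSpace ℂ (Fin N)}
    (hz : ∀ i, polyEval (B i) z = 0) : polyEval R z = 0 := by
  have : Ideal.span (range B) ≤ RingHom.ker (MvPolynomial.eval fun i => z i) := by
    rw [Ideal.span_le]
    rintro _ ⟨i, rfl⟩
    exact hz i
  exact this hR

lemma finSuccEquiv_rename_succ (a : MvPolynomial (Fin N) ℂ) :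
    MvPolynomial.finSuccEquiv ℂ N (MvPolynomial.rename Fin.succ a) = Polynomial.C a := by
  induction a using MvPolynomial.induction_on with
  | C c => simp [MvPolynomial.finSuccEquiv_apply]
  | add p q hp hq => simp [hp, hq]
  | mul_X p i hp => rw [map_mul, map_mul, hp, MvPolynomial.rename_X,
      MvPolynomial.finSuccEquiv_X_succ, map_mul]

lemma exists_mem_span_independent {ι : Type*} {B : ι → MvPolynomial (Fin (N + 1)) ℂ}
    (hB : ∀ d, (∀ i, d ∣ B i) → IsUnit d) (j : Fin (N + 1)) :
    ∃ R ∈ Ideal.span (range B), R ≠ 0 ∧ ∀ (z : EuclideanSpace ℂ (Fin (N + 1))) (t : ℂ),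
      polyEval R (z + t • EuclideanSpace.single j 1) = polyEval R z := by
  let e : MvPolynomial (Fin (N + 1)) ℂ ≃ₐ[ℂ] Polynomial (MvPolynomial (Fin N) ℂ) :=
    (MvPolynomial.renameEquiv ℂ (Equiv.swap 0 j)).trans (MvPolynomial.finSuccEquiv ℂ N)
  have : NormalizedGCDMonoid (MvPolynomial (Fin N) ℂ) :=
    Classical.choice inferInstance
  obtain ⟨a, ha, hmem⟩ := exists_C_mem_span (p := fun i => e (B i)) (fun d hd => by
    have h1 : IsUnit (e.symm d) := by
      refine hB _ fun i => ?_
      have := map_dvd e.symm (hd i)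
      simpa using this
    simpa using h1.map e)
  refine ⟨e.symm (Polynomial.C a), ?_, ?_, fun z t => ?_⟩
  · have h2 : range (fun i => e (B i)) = e '' range B := by rw [← range_comp]; rfl
    have h3 : Ideal.span (range fun i => e (B i)) = Ideal.map e (Ideal.span (range B)) := by
      rw [Ideal.map_span, h2]
    rw [h3] at hmem
    obtain ⟨x, hx, hxa⟩ := (Ideal.mem_map_of_equiv e _).1 hmem
    rwa [← hxa, AlgEquiv.symm_apply_apply]
  · simpa using ha
  · have h5 : e.symm (Polynomial.C a) =
        MvPolynomial.rename (Equiv.swap 0 j ∘ Fin.succ) a := by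
      rw [AlgEquiv.symm_apply_eq]
      simp only [e, AlgEquiv.trans_apply, MvPolynomial.renameEquiv_apply]
      rw [MvPolynomial.rename_rename, ← Function.comp_assoc, ← Equiv.coe_trans, Equiv.swap_swap,
        Equiv.coe_refl, Function.id_comp, finSuccEquiv_rename_succ]
    rw [h5]
    unfold polyEval
    rw [MvPolynomial.eval_rename, MvPolynomial.eval_rename]
    congr 2
    funext i
    have : Equiv.swap 0 j i.succ ≠ j := by
      rw [Ne, Equiv.swap_apply_eq_iff, Equiv.swap_apply_right]
      exact Fin.succ_ne_zero i
    simp [this]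

end CommonDivisors

section CommonZeros

variable {E : Type*} [NormedAddCommGroup E] [NormedSpace ℂ E]

lemma eq_zero_on_line {b : E → ℂ} (hb : Differentiable ℂ b) {z e : E}
    (h0 : ∀ᶠ t : ℂ in 𝓝 0, b (z + t • e) = 0) (t : ℂ) : b (z + t • e) = 0 := by
  have hd : Differentiable ℂ fun t : ℂ => b (z + t • e) :=
    hb.comp ((differentiable_id.smul_const e).const_add z)
  exact eqOn_zero_of_eventually_eq_zero isOpen_univ convex_univ hd.differentiableOn
    (mem_univ 0) h0 t (mem_univ t)

/-- Persistence of zeros along parallel lines. -/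
lemma eventually_exists_zero_on_line {b : E → ℂ} (hb : Differentiable ℂ b) {z₀ e : E}
    (hz₀ : b z₀ = 0) (hne : ¬ ∀ᶠ t : ℂ in 𝓝 0, b (z₀ + t • e) = 0) {U : Set E} (hU : U ∈ 𝓝 z₀) :
    ∀ᶠ z in 𝓝 z₀, ∃ t : ℂ, z + t • e ∈ U ∧ b (z + t • e) = 0 := by
  have hd : ∀ z, Differentiable ℂ fun t : ℂ => b (z + t • e) := fun z =>
    hb.comp ((differentiable_id.smul_const e).const_add z)
  have hiso : ∀ᶠ t : ℂ in 𝓝[≠] 0, b (z₀ + t • e) ≠ 0 :=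
    ((hd z₀).analyticAt 0).eventually_eq_zero_or_eventually_ne_zero.resolve_left hne
  have hcont : Continuous fun p : E × ℂ => p.1 + p.2 • e := by fun_prop
  have hUev : ∀ᶠ p : E × ℂ in 𝓝 z₀ ×ˢ 𝓝 (0 : ℂ), p.1 + p.2 • e ∈ U := by
    rw [← nhds_prod_eq]
    refine hcont.continuousAt.eventually ?_
    simpa using hU
  obtain ⟨p₁, hp₁, p₂, hp₂, hp⟩ := eventually_prod_iff.1 hUev
  obtain ⟨δ₁, hδ₁, h₁⟩ := Metric.eventually_nhds_iff.1 hp₂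
  obtain ⟨δ₂, hδ₂, h₂⟩ := Metric.eventually_nhds_iff.1 (eventually_nhdsWithin_iff.1 hiso)
  set δ := min δ₁ δ₂ / 2 with hδ
  have hδ0 : 0 < δ := by positivity
  have hδ1 : δ < δ₁ := by have := min_le_left δ₁ δ₂; linarith
  have hδ2 : δ < δ₂ := by have := min_le_right δ₁ δ₂; linarith
  have hcomp : IsCompact (sphere (0 : ℂ) δ) := isCompact_sphere _ _
  obtain ⟨t₀, ht₀, hmin⟩ := hcomp.exists_isMinOn (NormedSpace.sphere_nonempty.2 hδ0.le)
    (hd z₀).continuous.norm.continuousOn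
  set m := ‖b (z₀ + t₀ • e)‖ with hm
  have hm0 : 0 < m := by
    refine norm_pos_iff.2 (h₂ ?_ ?_)
    · rw [mem_sphere.1 ht₀]; exact hδ2
    · rintro rfl
      simp at ht₀
      linarith
  have hsph : ∀ᶠ z in 𝓝 z₀, ∀ t ∈ sphere (0 : ℂ) δ, m / 2 < ‖b (z + t • e)‖ := by
    refine hcomp.eventually_forall_of_forall_eventually fun t ht => ?_
    have hc : Continuous fun p : E × ℂ => ‖b (p.1 + p.2 • e)‖ :=
      (hb.continuous.comp hcont).norm
    refine hc.continuousAt.eventually (lt_mem_nhds ?_)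
    have := isMinOn_iff.1 hmin t ht
    dsimp only at this ⊢
    linarith
  have hsmall : ∀ᶠ z in 𝓝 z₀, ‖b z‖ < m / 16 := by
    refine hb.continuous.norm.continuousAt.eventually (gt_mem_nhds ?_)
    simpa [hz₀] using hm0
  filter_upwards [hsph, hsmall, hp₁] with z hz1 hz2 hz3
  have himg := DiffContOnCl.ball_subset_image_closedBall (f := fun t : ℂ => b (z + t • e))
    (z₀ := 0) (ε := m / 4) (hd z).diffContOnCl hδ0 (fun t ht => by
      have h3 := norm_sub_norm_le (b (z + t • e)) (b (z + (0 : ℂ) • e))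
      have h4 := hz1 t ht
      simp only [zero_smul, add_zero] at h3 ⊢
      linarith) (fun hcon => by
      have hconst : ∀ t : ℂ, b (z + t • e) - b z = 0 := by
        intro t
        refine eq_zero_on_line (b := fun w => b w - b z) (hb.sub_const _) ?_ t
        simpa [sub_eq_zero] using hcon
      have h4 := hz1 t₀ ht₀
      rw [sub_eq_zero.1 (hconst t₀)] at h4
      linarith)
  obtain ⟨t, ht, ht0⟩ := himg (show (0 : ℂ) ∈ _ by
    simp only [zero_smul, add_zero, mem_ball, dist_zero_left]
    linarith)
  refine ⟨t, hp hz3 (h₁ ?_), ht0⟩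
  exact (mem_closedBall.1 ht).trans_lt hδ1

variable {N : ℕ}

lemma eventually_eq_zero_of_lines {b : EuclideanSpace ℂ (Fin N) → ℂ} (hb : Differentiable ℂ b)
    {z₁ : EuclideanSpace ℂ (Fin N)} (hz₁ : b z₁ = 0) {U : Set (EuclideanSpace ℂ (Fin N))}
    (hU : U ∈ 𝓝 z₁) (hlines : ∀ z ∈ U, b z = 0 → ∀ j, ∀ᶠ t : ℂ in 𝓝 0,
      b (z + t • EuclideanSpace.single j 1) = 0) : ∀ᶠ z in 𝓝 z₁, b z = 0 := by
  obtain ⟨ρ, hρ, hρU⟩ := Metric.mem_nhds_iff.1 hU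
  have hev : ∀ᶠ z in 𝓝 z₁, ∑ j, ‖z j - z₁ j‖ < ρ := by
    have hc : Continuous fun z : EuclideanSpace ℂ (Fin N) => ∑ j, ‖z j - z₁ j‖ := by fun_prop
    refine hc.continuousAt.eventually (gt_mem_nhds ?_)
    simpa using hρ
  filter_upwards [hev] with z hz
  have key : ∀ s : Finset (Fin N),
      b (z₁ + ∑ j ∈ s, (z j - z₁ j) • EuclideanSpace.single j (1 : ℂ)) = 0 := by
    intro s
    induction s using Finset.induction_on with
    | empty => simpa using hz₁
    | insert j s hj ih =>
      rw [Finset.sum_insert hj, add_comm (_ • _), ← add_assoc]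
      refine eq_zero_on_line hb (hlines _ (hρU ?_) ih j) _
      rw [mem_ball, dist_eq_norm, add_sub_cancel_left]
      refine lt_of_le_of_lt (norm_sum_le _ _) (lt_of_le_of_lt ?_ hz)
      refine (Finset.sum_le_sum_of_subset_of_nonneg (Finset.subset_univ s)
        fun _ _ _ => norm_nonneg _).trans (Finset.sum_le_sum fun i _ => ?_)
      simp [norm_smul]
  convert key Finset.univ
  ext i
  simp [Finset.sum_apply, Pi.single_apply]

/-- The common zeros of polynomials without common divisor are not cut out by one of them. -/
lemma polyEval_ne_zero_of_common_divisors {B : Fin (N + 1) → MvPolynomial (Fin (N + 1)) ℂ}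
    (hB : ∀ d, (∀ i, d ∣ B i) → IsUnit d) {z₁ : EuclideanSpace ℂ (Fin (N + 1))}
    {U : Set (EuclideanSpace ℂ (Fin (N + 1)))} (hU : IsOpen U) (hz₁ : z₁ ∈ U) (i : Fin (N + 1))
    (hBU : ∀ z ∈ U, polyEval (B i) z = 0 → ∀ j, polyEval (B j) z = 0) :
    polyEval (B i) z₁ ≠ 0 := by
  intro h0
  by_cases hlines : ∀ z ∈ U, polyEval (B i) z = 0 → ∀ j, ∀ᶠ t : ℂ in 𝓝 0,
      polyEval (B i) (z + t • EuclideanSpace.single j 1) = 0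
  · have h1 := eventually_eq_zero_of_lines (differentiable_polyEval (B i)) h0 (hU.mem_nhds hz₁)
      hlines
    refine not_isUnit_zero (hB 0 fun j => ?_)
    rw [zero_dvd_iff]
    refine eq_zero_of_eventually_polyEval (p := z₁) ?_
    filter_upwards [h1, hU.mem_nhds hz₁] with z hz hzU using hBU z hzU hz j
  · push Not at hlines
    obtain ⟨z₂, hz₂, hb₂, j, hj⟩ := hlines
    obtain ⟨R, hR, hR0, hRj⟩ := exists_mem_span_independent hB j
    refine hR0 (eq_zero_of_eventually_polyEval (p := z₂) ?_)
    filter_upwards [eventually_exists_zero_on_line (differentiable_polyEval (B i)) hb₂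
      (by simpa using hj) (hU.mem_nhds hz₂)] with z ⟨t, htU, ht⟩
    rw [← hRj z t]
    exact polyEval_eq_zero_of_mem_span hR (hBU _ htU ht)

end CommonZeros

variable {n : ℕ}

lemma polyEval_smul_eq_sum {P : MvPolynomial (Fin n) ℂ} {d : ℕ} (hd : P.totalDegree < d) (c : ℂ)
    (z : EuclideanSpace ℂ (Fin n)) :
    polyEval P (c • z) = ∑ k ∈ Finset.range d,
      c ^ k * polyEval (MvPolynomial.homogeneousComponent k P) z := by
  have h1 : ∑ k ∈ Finset.range d, MvPolynomial.homogeneousComponent k P = P := by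
    conv_rhs => rw [← MvPolynomial.sum_homogeneousComponent P]
    refine (Finset.sum_subset (Finset.range_subset_range.2 hd) fun k _ hk => ?_).symm
    exact MvPolynomial.homogeneousComponent_eq_zero _ _ (by simpa using hk)
  have h2 : polyEval P (c • z) = ∑ k ∈ Finset.range d,
      polyEval (MvPolynomial.homogeneousComponent k P) (c • z) := by
    conv_lhs => rw [← h1]
    simp [polyEval]
  rw [h2]
  exact Finset.sum_congr rfl fun k _ =>
    polyEval_smul (MvPolynomial.homogeneousComponent_isHomogeneous _ _) c z

lemma eq_zero_of_sum_pow_eq_zero {d : ℕ} {a : ℕ → ℂ}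
    (h : ∀ c : ℂ, c ≠ 0 → ∑ k ∈ Finset.range d, c ^ k * a k = 0) : ∀ k < d, a k = 0 := by
  set p : Polynomial ℂ := ∑ k ∈ Finset.range d, Polynomial.monomial k (a k) with hp
  have hp0 : p = 0 := by
    refine Polynomial.eq_zero_of_infinite_isRoot p ?_
    refine Set.Infinite.mono (s := {0}ᶜ) (fun c hc => ?_) (Set.finite_singleton 0).infinite_compl
    have := h c hc
    simpa [hp, Polynomial.eval_finsetSum, Polynomial.IsRoot, mul_comm] using this
  intro k hk
  have := congrArg (Polynomial.coeff · k) hp0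
  simpa [hp, Polynomial.finsetSum_coeff, Polynomial.coeff_monomial, hk] using this

namespace ConicFoliation

variable {M : Set (EuclideanSpace ℂ (Fin (n + 1)))} {r C : ℝ}
  {f : EuclideanSpace ℂ (Fin (n + 1)) → EuclideanSpace ℂ (Fin (n + 1)) → ℂ}

/-- The polynomial one-form with coefficients `B` is proportional to the defining forms. -/
def IsParallel (M : Set (EuclideanSpace ℂ (Fin (n + 1)))) (r : ℝ)
    (f : EuclideanSpace ℂ (Fin (n + 1)) → EuclideanSpace ℂ (Fin (n + 1)) → ℂ)
    (B : Fin (n + 1) → MvPolynomial (Fin (n + 1)) ℂ) : Prop :=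
  ∀ q ∈ M, ∀ z ∈ ball q (r * ‖q‖), ∀ i j,
    polyEval (B i) z * fderiv ℂ (f q) z (EuclideanSpace.single j 1) =
      polyEval (B j) z * fderiv ℂ (f q) z (EuclideanSpace.single i 1)

lemma exists_single_ne_zero (h : ConicFoliation M r C f) {q z : EuclideanSpace ℂ (Fin (n + 1))}
    (hq : q ∈ M) (hz : z ∈ ball q (r * ‖q‖)) :
    ∃ i, fderiv ℂ (f q) z (EuclideanSpace.single i 1) ≠ 0 := by
  by_contra! hcon
  have h0 : fderiv ℂ (f q) z = 0 := by
    refine ContinuousLinearMap.coe_injective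
      ((EuclideanSpace.basisFun (Fin (n + 1)) ℂ).toBasis.ext fun i => ?_)
    simpa using hcon i
  have := h.fderiv_norm_pos hq hz
  simp [h0] at this

lemma exists_isParallel (h : ConicFoliation M r C f) (hn : 2 ≤ n) :
    ∃ B, B ≠ 0 ∧ IsParallel M r f B := by
  obtain ⟨q₀, hq₀⟩ := h.nonempty
  have hz₀ := h.mem_ball_self hq₀
  obtain ⟨v, hv⟩ := h.exists_single_ne_zero hq₀ hz₀
  choose c P hc hcP using fun i : Fin (n + 1) =>
    h.exists_rational hn (EuclideanSpace.single i 1) (EuclideanSpace.single v 1) hq₀ hz₀ hv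
  set B : Fin (n + 1) → MvPolynomial (Fin (n + 1)) ℂ :=
    fun i => P i * ∏ k ∈ Finset.univ.erase i, c k with hB
  have hBΓ : ∀ q ∈ M, ∀ z ∈ ball q (r * ‖q‖), ∀ i,
      polyEval (B i) z * fderiv ℂ (f q) z (EuclideanSpace.single v 1) =
        polyEval (∏ k, c k) z * fderiv ℂ (f q) z (EuclideanSpace.single i 1) := by
    intro q hq z hz i
    rw [hB, polyEval_mul, ← Finset.mul_prod_erase _ c (Finset.mem_univ i), polyEval_mul]
    linear_combination -polyEval (∏ k ∈ Finset.univ.erase i, c k) z * hcP i q hq z hz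
  refine ⟨B, ?_, fun q hq z hz i j => ?_⟩
  · intro hB0
    have hprod : ∏ k, c k ≠ 0 := Finset.prod_ne_zero_iff.2 fun k _ => hc k
    refine hprod (eq_zero_of_eventually_polyEval (p := q₀) ?_)
    have hcont := ((h.differentiableOn_form (EuclideanSpace.single v 1) q₀
      hq₀).continuousOn.continuousAt (isOpen_ball.mem_nhds hz₀)).eventually_ne hv
    filter_upwards [hcont, isOpen_ball.mem_nhds hz₀] with z hz0 hz
    have h1 := hBΓ q₀ hq₀ z hz v
    rw [hB0] at h1
    have h2 : polyEval (∏ k, c k) z * fderiv ℂ (f q₀) z (EuclideanSpace.single v 1) = 0 := by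
      rw [← h1]; simp [polyEval]
    exact (mul_eq_zero.1 h2).resolve_right hz0
  · refine sub_eq_zero.1 (h.eq_zero_of_mul_eq_zero
      (φ := fun q z => fderiv ℂ (f q) z (EuclideanSpace.single v 1))
      (ψ := fun q z => polyEval (B i) z * fderiv ℂ (f q) z (EuclideanSpace.single j 1) -
        polyEval (B j) z * fderiv ℂ (f q) z (EuclideanSpace.single i 1))
      (h.differentiableOn_form _) (fun q hq => ?_) ?_ hq₀ hz₀ hv ?_ q hq z hz)
    · exact ((differentiable_polyEval _).differentiableOn.fun_mul
        (h.differentiableOn_form _ q hq)).fun_sub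
        ((differentiable_polyEval _).differentiableOn.fun_mul (h.differentiableOn_form _ q hq))
    · intro q hq q' hq' z hz hz' h1
      obtain ⟨k, -, hk⟩ := h.exists_ne_zero_smul' hq hq' hz hz'
      simp only [hk, smul_apply, smul_eq_mul]
      linear_combination k * h1
    · intro q hq z hz
      linear_combination fderiv ℂ (f q) z (EuclideanSpace.single j 1) * hBΓ q hq z hz i -
        fderiv ℂ (f q) z (EuclideanSpace.single i 1) * hBΓ q hq z hz j

lemma IsParallel.homogeneousComponent (h : ConicFoliation M r C f)
    {B : Fin (n + 1) → MvPolynomial (Fin (n + 1)) ℂ} (hB : IsParallel M r f B) (k : ℕ) :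
    IsParallel M r f fun i => MvPolynomial.homogeneousComponent k (B i) := by
  intro q hq z hz i j
  set d := (B i).totalDegree + (B j).totalDegree + k + 1 with hd
  refine sub_eq_zero.1 (eq_zero_of_sum_pow_eq_zero (d := d) (a := fun k =>
    polyEval (MvPolynomial.homogeneousComponent k (B i)) z *
      fderiv ℂ (f q) z (EuclideanSpace.single j 1) -
    polyEval (MvPolynomial.homogeneousComponent k (B j)) z *
      fderiv ℂ (f q) z (EuclideanSpace.single i 1)) (fun c hc => ?_) k (by omega))
  have hz' := smul_mem_ball hz hc
  have hq' := h.smul_mem c hc q hq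
  obtain ⟨a, ha, hk⟩ := h.exists_ne_zero_smul hq hq' hc hz hz'
  have h1 := hB _ hq' _ hz' i j
  simp only [hk, smul_apply, smul_eq_mul] at h1
  rw [polyEval_smul_eq_sum (d := d) (by omega), polyEval_smul_eq_sum (d := d) (by omega)] at h1
  simp only [mul_sub, Finset.sum_sub_distrib, ← mul_assoc, ← Finset.sum_mul]
  refine mul_left_cancel₀ ha ?_
  linear_combination h1

lemma exists_homogeneousComponent_ne_zero {P : MvPolynomial (Fin (n + 1)) ℂ} (hP : P ≠ 0) :
    ∃ k ≤ P.totalDegree, MvPolynomial.homogeneousComponent k P ≠ 0 := by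
  by_contra! hcon
  refine hP ?_
  rw [← MvPolynomial.sum_homogeneousComponent P]
  exact Finset.sum_eq_zero fun k hk => hcon k (Nat.lt_succ_iff.1 (Finset.mem_range.1 hk))

/-- A parallel homogeneous form of minimal degree has coefficients without common divisor. -/
lemma exists_isParallel_coprime (h : ConicFoliation M r C f) (hn : 2 ≤ n) :
    ∃ (D : ℕ) (B : Fin (n + 1) → MvPolynomial (Fin (n + 1)) ℂ), IsParallel M r f B ∧
      (∀ i, (B i).IsHomogeneous D) ∧ ∀ d, (∀ i, d ∣ B i) → IsUnit d := by
  classical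
  have hcomp : ∀ B : Fin (n + 1) → MvPolynomial (Fin (n + 1)) ℂ, IsParallel M r f B →
      ∀ i, B i ≠ 0 → ∃ k ≤ (B i).totalDegree, ∃ B' : Fin (n + 1) → MvPolynomial (Fin (n + 1)) ℂ,
        B' ≠ 0 ∧ IsParallel M r f B' ∧ ∀ i, (B' i).IsHomogeneous k := by
    intro B hB i hi
    obtain ⟨k, hk, hk0⟩ := exists_homogeneousComponent_ne_zero hi
    exact ⟨k, hk, _, fun h0 => hk0 (congrFun h0 i), hB.homogeneousComponent h k,
      fun i => MvPolynomial.homogeneousComponent_isHomogeneous _ _⟩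
  have hex : ∃ k, ∃ B' : Fin (n + 1) → MvPolynomial (Fin (n + 1)) ℂ,
      B' ≠ 0 ∧ IsParallel M r f B' ∧ ∀ i, (B' i).IsHomogeneous k := by
    obtain ⟨B, hB0, hB⟩ := h.exists_isParallel hn
    obtain ⟨i, hi⟩ := Function.ne_iff.1 hB0
    obtain ⟨k, -, hk⟩ := hcomp B hB i hi
    exact ⟨k, hk⟩
  obtain ⟨B, hB0, hB, hBD⟩ := Nat.find_spec hex
  refine ⟨Nat.find hex, B, hB, hBD, fun d hd => ?_⟩
  choose B' hB' using hd
  obtain ⟨i, hi⟩ := Function.ne_iff.1 hB0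
  have hi : B i ≠ 0 := hi
  have hd0 : d ≠ 0 := by
    rintro rfl
    exact hi (by rw [hB', zero_mul])
  have hB'i : B' i ≠ 0 := fun h0 => hi (by rw [hB', h0, mul_zero])
  have hpar : IsParallel M r f B' := by
    have hnz : ∃ q₀ ∈ M, ∃ z₀ ∈ ball q₀ (r * ‖q₀‖), polyEval d z₀ ≠ 0 := by
      by_contra! hcon
      obtain ⟨q₀, hq₀⟩ := h.nonempty
      refine hd0 (eq_zero_of_eventually_polyEval (p := q₀) ?_)
      filter_upwards [isOpen_ball.mem_nhds (h.mem_ball_self hq₀)] with z hz using hcon q₀ hq₀ z hz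
    obtain ⟨q₀, hq₀, z₀, hz₀, h0⟩ := hnz
    intro q hq z hz i j
    refine sub_eq_zero.1 (h.eq_zero_of_mul_eq_zero (φ := fun _ z => polyEval d z)
      (ψ := fun q z => polyEval (B' i) z * fderiv ℂ (f q) z (EuclideanSpace.single j 1) -
        polyEval (B' j) z * fderiv ℂ (f q) z (EuclideanSpace.single i 1))
      (fun q hq => (differentiable_polyEval d).differentiableOn) (fun q hq => ?_) ?_ hq₀ hz₀ h0
      ?_ q hq z hz)
    · exact ((differentiable_polyEval _).differentiableOn.fun_mul
        (h.differentiableOn_form _ q hq)).fun_sub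
        ((differentiable_polyEval _).differentiableOn.fun_mul (h.differentiableOn_form _ q hq))
    · intro q hq q' hq' z hz hz' h1
      obtain ⟨k, -, hk⟩ := h.exists_ne_zero_smul' hq hq' hz hz'
      simp only [hk, smul_apply, smul_eq_mul]
      linear_combination k * h1
    · intro q hq z hz
      have h1 := hB q hq z hz i j
      rw [hB' i, hB' j, polyEval_mul, polyEval_mul] at h1
      linear_combination h1
  obtain ⟨k, hk, hkB⟩ := hcomp B' hpar i hB'i
  have hle : Nat.find hex ≤ k := Nat.find_min' hex hkB
  have hdeg : (B i).totalDegree = d.totalDegree + (B' i).totalDegree := by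
    rw [hB' i, MvPolynomial.totalDegree_mul_of_isDomain hd0 hB'i]
  rw [(hBD i).totalDegree hi] at hdeg
  have hd1 : d.totalDegree = 0 := by omega
  rw [MvPolynomial.totalDegree_eq_zero_iff_eq_C] at hd1
  rw [hd1]
  refine IsUnit.map MvPolynomial.C (isUnit_iff_ne_zero.2 fun h0 => hd0 ?_)
  rw [hd1, h0, map_zero]

/-- There is no such foliation in dimension at least four. -/
theorem false_of_three_le (h : ConicFoliation M r C f) (hn : 3 ≤ n) : False := by
  obtain ⟨D, B, hB, hBD, hBc⟩ := h.exists_isParallel_coprime (by omega)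
  refine h.false_of_form (by simp; omega)
    (A := fun z => ∑ j, polyEval (B j) z • EuclideanSpace.proj (𝕜 := ℂ) j) (D := D) ?_ ?_ ?_ ?_
  · exact Differentiable.fun_sum fun j _ => (differentiable_polyEval (B j)).smul_const _
  · intro c z
    rw [Finset.smul_sum]
    exact Finset.sum_congr rfl fun j _ => by rw [polyEval_smul (hBD j), mul_smul]
  · intro z hz hA
    have hz' := h.mem_ball_self hz
    obtain ⟨i, hi⟩ := h.exists_single_ne_zero hz hz'
    have hcont := ((h.differentiableOn_form (EuclideanSpace.single i 1) z
      hz).continuousOn.continuousAt (isOpen_ball.mem_nhds hz')).eventually_ne hi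
    obtain ⟨U, hU, hUo, hzU⟩ := _root_.eventually_nhds_iff.1
      (hcont.and (isOpen_ball.mem_nhds hz'))
    refine polyEval_ne_zero_of_common_divisors hBc hUo hzU i (fun w hw hw0 j => ?_) ?_
    · have h1 := hB z hz w (hU w hw).2 i j
      rw [hw0, zero_mul] at h1
      exact (mul_eq_zero.1 h1.symm).resolve_right (hU w hw).1
    · have := congrArg (fun L => L (EuclideanSpace.single i (1 : ℂ))) hA
      simpa [Pi.single_apply] using this
  · intro q hq z hz
    obtain ⟨i, hi⟩ := h.exists_single_ne_zero hq hz
    refine ⟨polyEval (B i) z / fderiv ℂ (f q) z (EuclideanSpace.single i 1), ?_⟩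
    refine ContinuousLinearMap.coe_injective
      ((EuclideanSpace.basisFun (Fin (n + 1)) ℂ).toBasis.ext fun j => ?_)
    have h1 := hB q hq z hz i j
    simp
    field_simp
    exact h1.symm

end ConicFoliation

section Complexification

variable {W F : Type*} [NormedAddCommGroup W] [NormedSpace ℝ W] [NormedAddCommGroup F]
  [NormedSpace ℂ F] {K : Type*} [Fintype K]

/-- The complex power series with the same coefficients as a real one, in terms of vectors `b` and
complex coordinates `T`. -/
def complexifySeries (b : K → W) (T : K → F →L[ℂ] ℂ) (p : FormalMultilinearSeries ℝ W ℝ) :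
    FormalMultilinearSeries ℂ F ℂ := fun n =>
  ∑ κ : Fin n → K, ((p n fun i => b (κ i) : ℝ) : ℂ) •
    (ContinuousMultilinearMap.mkPiAlgebra ℂ (Fin n) ℂ).compContinuousLinearMap fun i => T (κ i)

lemma complexifySeries_apply (b : K → W) (T : K → F →L[ℂ] ℂ) (p : FormalMultilinearSeries ℝ W ℝ)
    (n : ℕ) (w : F) : (complexifySeries b T p n fun _ => w) =
      ∑ κ : Fin n → K, ((p n fun i => b (κ i) : ℝ) : ℂ) * ∏ i, T (κ i) w := by
  simp [complexifySeries]

lemma complexifySeries_apply_real {b : K → W} {T : K → F →L[ℂ] ℂ}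
    (p : FormalMultilinearSeries ℝ W ℝ) (n : ℕ) {y : W} {w : F} {t : K → ℝ}
    (hy : y = ∑ k, t k • b k) (hw : ∀ k, T k w = t k) :
    (complexifySeries b T p n fun _ => w) = ((p n fun _ => y : ℝ) : ℂ) := by
  classical
  rw [complexifySeries_apply, hy]
  have h1 := (p n).toMultilinearMap.map_sum (fun (_ : Fin n) k => t k • b k)
  rw [ContinuousMultilinearMap.coe_coe] at h1
  rw [h1, Complex.ofReal_sum]
  refine Finset.sum_congr rfl fun κ _ => ?_
  have h2 := (p n).map_smul_univ (fun i => t (κ i)) (fun i => b (κ i))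
  rw [h2, smul_eq_mul, Complex.ofReal_mul, Complex.ofReal_prod, mul_comm]
  simp [hw]

lemma complexifySeries_radius_pos (b : K → W) (T : K → F →L[ℂ] ℂ)
    {p : FormalMultilinearSeries ℝ W ℝ} (hp : 0 < p.radius) :
    0 < (complexifySeries b T p).radius := by
  obtain ⟨r, hr0, hr⟩ := ENNReal.lt_iff_exists_nnreal_btwn.1 hp
  obtain ⟨C, hC, hbound⟩ := p.norm_mul_pow_le_of_lt_radius hr
  have hr0 : 0 < r := by exact_mod_cast hr0
  set β := ∑ k, ‖b k‖ with hβ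
  set τ := ∑ k, ‖T k‖ with hτ
  have hβ0 : 0 ≤ β := Finset.sum_nonneg fun _ _ => norm_nonneg _
  have hτ0 : 0 ≤ τ := Finset.sum_nonneg fun _ _ => norm_nonneg _
  set A : ℝ := Fintype.card K * (β * τ) with hA
  have hA0 : 0 ≤ A := by positivity
  have hnorm : ∀ n, ‖complexifySeries b T p n‖ ≤ A ^ n * ‖p n‖ := by
    intro n
    have hterm : ∀ κ : Fin n → K, ‖((p n fun i => b (κ i) : ℝ) : ℂ) •
        (ContinuousMultilinearMap.mkPiAlgebra ℂ (Fin n) ℂ).compContinuousLinearMap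
          fun i => T (κ i)‖ ≤ ‖p n‖ * (β * τ) ^ n := by
      intro κ
      rw [norm_smul, Complex.norm_real, mul_pow, ← mul_assoc]
      have h1 : ‖p n fun i => b (κ i)‖ ≤ ‖p n‖ * β ^ n := by
        refine ((p n).le_opNorm _).trans ?_
        gcongr
        calc ∏ i, ‖b (κ i)‖ ≤ ∏ _i : Fin n, β := Finset.prod_le_prod
              (fun _ _ => norm_nonneg _) fun i _ => Finset.single_le_sum
                (f := fun k => ‖b k‖) (fun _ _ => norm_nonneg _) (Finset.mem_univ (κ i))
          _ = β ^ n := by simp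
      have h2 : ‖(ContinuousMultilinearMap.mkPiAlgebra ℂ (Fin n) ℂ).compContinuousLinearMap
          fun i => T (κ i)‖ ≤ τ ^ n := by
        refine (ContinuousMultilinearMap.norm_compContinuousLinearMap_le _ _).trans ?_
        rw [ContinuousMultilinearMap.norm_mkPiAlgebra, one_mul]
        calc ∏ i, ‖T (κ i)‖ ≤ ∏ _i : Fin n, τ := Finset.prod_le_prod
              (fun _ _ => norm_nonneg _) fun i _ => Finset.single_le_sum
                (f := fun k => ‖T k‖) (fun _ _ => norm_nonneg _) (Finset.mem_univ (κ i))
          _ = τ ^ n := by simp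
      gcongr
    refine (norm_sum_le _ _).trans ((Finset.sum_le_sum fun κ _ => hterm κ).trans ?_)
    rw [Finset.sum_const, Finset.card_univ, Fintype.card_fun, Fintype.card_fin, nsmul_eq_mul, hA,
      mul_pow]
    push_cast
    exact le_of_eq (by ring)
  have hpos : (0 : ℝ) < r / (A + 1) := by positivity
  set s : NNReal := ⟨r / (A + 1), hpos.le⟩ with hs
  refine lt_of_lt_of_le (b := (s : ENNReal)) (by
    rw [ENNReal.coe_pos]; exact_mod_cast hpos) ?_
  refine FormalMultilinearSeries.le_radius_of_bound _ C fun n => ?_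
  have h3 : (s : ℝ) = r / (A + 1) := rfl
  rw [h3, div_pow]
  calc ‖complexifySeries b T p n‖ * ((r : ℝ) ^ n / (A + 1) ^ n)
      ≤ A ^ n * ‖p n‖ * ((r : ℝ) ^ n / (A + 1) ^ n) := by gcongr; exact hnorm n
    _ = (A / (A + 1)) ^ n * (‖p n‖ * (r : ℝ) ^ n) := by rw [div_pow]; ring
    _ ≤ 1 * C := by
        gcongr
        · exact pow_le_one₀ (by positivity) (by rw [div_le_one (by positivity)]; linarith)
        · exact hbound n
    _ = C := one_mul C

lemma exists_complexification {ρ : W → ℝ} {x₀ : W} (hρ : AnalyticAt ℝ ρ x₀) (b : K → W)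
    (T : K → F →L[ℂ] ℂ) (j : W → F)
    (hj : ∀ y, ∃ t : K → ℝ, y = ∑ k, t k • b k ∧ ∀ k, T k (j y) = t k) :
    ∃ P : F → ℂ, AnalyticAt ℂ P 0 ∧ (∀ᶠ y in 𝓝 0, P (j y) = ρ (x₀ + y)) ∧
      ∀ w w', (∀ k, T k w' = star (T k w)) → P w' = star (P w) := by
  obtain ⟨p, r, hp⟩ := hρ
  set q := complexifySeries b T p with hq
  have hrad := complexifySeries_radius_pos b T (hp.r_pos.trans_le hp.r_le)
  refine ⟨q.sum, (q.hasFPowerSeriesOnBall hrad).analyticAt, ?_, fun w w' hww => ?_⟩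
  · filter_upwards [Metric.eball_mem_nhds (0 : W) hp.r_pos] with y hy
    have h1 := Complex.hasSum_ofReal.2 (hp.hasSum hy)
    obtain ⟨t, ht, htj⟩ := hj y
    unfold FormalMultilinearSeries.sum
    refine Eq.trans (tsum_congr fun n => ?_) h1.tsum_eq
    exact complexifySeries_apply_real p n ht htj
  · unfold FormalMultilinearSeries.sum
    rw [tsum_star]
    refine tsum_congr fun n => ?_
    rw [hq, complexifySeries_apply, complexifySeries_apply, star_sum]
    refine Finset.sum_congr rfl fun κ _ => ?_
    simp [hww]

end Complexification

section Diagonal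

variable {N : ℕ}

lemma exists_complexification_pi {ρ : (Fin N → ℂ) → ℝ} {p : Fin N → ℂ} (hρ : AnalyticAt ℝ ρ p) :
    ∃ P : (Fin N → ℂ) × (Fin N → ℂ) → ℂ, ∃ R > 0, DifferentiableOn ℂ P (ball (p, star p) R) ∧
      (∀ z ∈ ball p R, P (z, star z) = ρ z) ∧ ∀ u v, P (star v, star u) = star (P (u, v)) := by
  let b : Fin N ⊕ Fin N → Fin N → ℂ := Sum.elim (fun i => Pi.single i 1) fun i => Pi.single i I
  let T : Fin N ⊕ Fin N → (Fin N → ℂ) × (Fin N → ℂ) →L[ℂ] ℂ := Sum.elim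
    (fun i => (1 / 2 : ℂ) • (ContinuousLinearMap.proj i ∘L .fst ℂ _ _ +
      ContinuousLinearMap.proj i ∘L .snd ℂ _ _))
    fun i => (-I / 2 : ℂ) • (ContinuousLinearMap.proj i ∘L .fst ℂ _ _ -
      ContinuousLinearMap.proj i ∘L .snd ℂ _ _)
  obtain ⟨P, hP, hPρ, hPs⟩ := exists_complexification hρ b T (fun z => (z, star z)) (fun y => by
    refine ⟨Sum.elim (fun i => (y i).re) fun i => (y i).im, ?_, ?_⟩
    · ext i
      simp [b, Finset.sum_apply, Pi.single_apply]
    · rintro (i | i)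
      · simp [T, Complex.ext_iff]
        ring
      · simp [T, Complex.ext_iff]
        ring)
  obtain ⟨R₁, hR₁, h₁⟩ := Metric.eventually_nhds_iff_ball.1
    hP.eventually_analyticAt
  obtain ⟨R₂, hR₂, h₂⟩ := Metric.eventually_nhds_iff_ball.1 hPρ
  refine ⟨fun ω => P (ω - (p, star p)), min R₁ R₂, lt_min hR₁ hR₂, fun ω hω => ?_,
    fun z hz => ?_, fun u v => ?_⟩
  · have h3 : DifferentiableAt ℂ P (ω - (p, star p)) := by
      refine (h₁ _ ?_).differentiableAt
      rw [mem_ball_zero_iff, ← dist_eq_norm]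
      exact (mem_ball.1 hω).trans_le (min_le_left _ _)
    exact (h3.comp ω (differentiableAt_id.sub_const _)).differentiableWithinAt
  · have h4 := h₂ (z - p) (by
      rw [mem_ball_zero_iff, ← dist_eq_norm]
      exact (mem_ball.1 hz).trans_le (min_le_right _ _))
    simpa using h4
  · refine hPs _ _ ?_
    rintro (i | i)
    · simp [T]
      ring
    · simp [T]
      ring

/-- A holomorphic function is determined by its values on the totally real diagonal. -/
lemma eq_zero_of_diagonal {h : (Fin N → ℂ) × (Fin N → ℂ) → ℂ} {p : Fin N → ℂ} {δ : ℝ}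
    (hd : DifferentiableOn ℂ h (ball (p, star p) δ)) (h0 : ∀ z ∈ ball p δ, h (z, star z) = 0) :
    ∀ ω ∈ ball (p, star p) δ, h ω = 0 := by
  rintro ⟨u, v⟩ hω
  have hdist : ∀ z : Fin N → ℂ, dist (z, star z) (p, star p) = dist z p := by
    intro z
    rw [Prod.dist_eq, dist_star_star, max_self]
  rw [mem_ball, Prod.dist_eq, max_lt_iff] at hω
  have hv : dist (star v) p < δ := by
    rw [← star_star p, dist_star_star]; exact hω.2
  set y : Fin N → ℂ := (1 / 2 : ℂ) • (u + star v) with hy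
  set y' : Fin N → ℂ := (-I / 2 : ℂ) • (u - star v) with hy'
  let L : ℂ → (Fin N → ℂ) × (Fin N → ℂ) := fun t => (y, star y) + t • (y', star y')
  have hL : Differentiable ℂ L := (differentiable_id.smul_const _).const_add _
  set Ω := L ⁻¹' ball (p, star p) δ with hΩ
  have hΩo : IsOpen Ω := isOpen_ball.preimage hL.continuous
  have hreal : ∀ t : ℝ, L t = (y + (t : ℂ) • y', star (y + (t : ℂ) • y')) := by
    intro t
    simp [L]
  have hyb : y ∈ ball p δ := by
    rw [mem_ball, dist_eq_norm]
    have e : y - p = (1 / 2 : ℂ) • ((u - p) + (star v - p)) := by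
      rw [hy]; ext i; simp; ring
    rw [e, norm_smul]
    have h1 := norm_add_le (u - p) (star v - p)
    rw [← dist_eq_norm, ← dist_eq_norm] at h1
    have : ‖(1 / 2 : ℂ)‖ = 1 / 2 := by norm_num
    rw [this]
    linarith [hω.1]
  have h0Ω : (0 : ℂ) ∈ Ω := by
    rw [hΩ, mem_preimage, mem_ball, ← Complex.ofReal_zero, hreal, hdist]
    simpa using hyb
  have hLI : L I = (u, v) := by
    have hI : I * I = -1 := Complex.I_mul_I
    ext i
    · simp [L, hy, hy']; linear_combination -(u i - (starRingEnd ℂ) (v i)) / 2 * hI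
    · simp [L, hy, hy']; linear_combination ((starRingEnd ℂ) (u i) - v i) / 2 * hI
  have hIΩ : I ∈ Ω := by
    rw [hΩ, mem_preimage, hLI, mem_ball, Prod.dist_eq, max_lt_iff]
    exact hω
  have hconv : Convex ℝ Ω := by
    intro s hs t ht a b ha hb hab
    rw [hΩ, mem_preimage]
    have e : L (a • s + b • t) = a • L s + b • L t := by
      have : (y, star y) = (a + b) • (y, star y) := by rw [hab, one_smul]
      simp only [L]
      rw [smul_add, smul_add, add_add_add_comm, ← add_smul a b, ← this, add_smul, smul_assoc,
        smul_assoc]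
    rw [e]
    exact convex_ball _ _ hs ht ha hb hab
  have han : AnalyticOnNhd ℂ (fun t => h (L t)) Ω := by
    refine DifferentiableOn.analyticOnNhd ?_ hΩo
    exact hd.comp hL.differentiableOn fun t ht => ht
  have hfreq : ∃ᶠ t in 𝓝[≠] (0 : ℂ), h (L t) = 0 := by
    have h1 : ∀ᶠ t : ℝ in 𝓝 0, h (L t) = 0 := by
      have hc : Tendsto (fun t : ℝ => (t : ℂ)) (𝓝 0) (𝓝 0) := by
        simpa using Complex.continuous_ofReal.tendsto 0
      filter_upwards [hc.eventually (hΩo.mem_nhds h0Ω)] with t ht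
      rw [hreal]
      refine h0 _ ?_
      rw [mem_ball, ← hdist, ← hreal]
      exact ht
    have h2 : Tendsto (fun t : ℝ => (t : ℂ)) (𝓝[≠] 0) (𝓝[≠] 0) := by
      refine tendsto_nhdsWithin_of_tendsto_nhds_of_eventually_within _ ?_ ?_
      · simpa using (Complex.continuous_ofReal.tendsto 0).mono_left nhdsWithin_le_nhds
      · filter_upwards [self_mem_nhdsWithin] with t ht
        simpa using ht
    exact h2.frequently (h1.filter_mono nhdsWithin_le_nhds).frequently
  have := han.eqOn_zero_of_preconnected_of_frequently_eq_zero hconv.isPreconnected h0Ω hfreq hIΩ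
  simpa [hLI] using this

end Diagonal

section Implicit

variable {X : Type*} [NormedAddCommGroup X] [NormedSpace ℂ X] [FiniteDimensional ℂ X]

/-- The zero of a holomorphic function in a transverse direction. -/
lemma exists_implicit_along {P : X → ℂ} {U : Set X} (hU : IsOpen U) (hP : DifferentiableOn ℂ P U)
    {ω₀ d : X} (h₀ : ω₀ ∈ U) (hP0 : P ω₀ = 0) (hne : fderiv ℂ P ω₀ d ≠ 0) :
    ∃ S : X → ℂ, ∃ ε > 0, DifferentiableOn ℂ S (ball ω₀ ε) ∧ S ω₀ = 0 ∧
      (∀ ω ∈ ball ω₀ ε, ω + S ω • d ∈ U ∧ P (ω + S ω • d) = 0) ∧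
      ∀ ω ∈ ball ω₀ ε, ∀ s ∈ ball (0 : ℂ) ε, P (ω + s • d) = 0 → s = S ω := by
  let L : X × ℂ → X := fun y => y.1 + y.2 • d
  have hL : Differentiable ℂ L := differentiable_fst.add (differentiable_snd.smul_const d)
  have hL0 : L (ω₀, 0) = ω₀ := by simp [L]
  have hF : DifferentiableOn ℂ (P ∘ L) (L ⁻¹' U) := hP.comp hL.differentiableOn fun _ h => h
  have hLd : HasFDerivAt L (ContinuousLinearMap.fst ℂ X ℂ +
      (ContinuousLinearMap.snd ℂ X ℂ).smulRight d) (ω₀, 0) :=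
    (hasFDerivAt_fst).add ((hasFDerivAt_snd).smul_const d)
  have hPd : HasFDerivAt P (fderiv ℂ P ω₀) (L (ω₀, 0)) := by
    rw [hL0]; exact (hP.differentiableAt (hU.mem_nhds h₀)).hasFDerivAt
  obtain ⟨S, ε, hε, hS, hS0, hSz, hSu⟩ := exists_implicit_function (x₀ := ω₀) (s₀ := (0 : ℂ))
    (hU.preimage hL.continuous) hF (by rw [mem_preimage, hL0]; exact h₀)
    (by rw [(hPd.comp _ hLd).fderiv]; simpa using hne)
  simp only [Function.comp_apply, hL0, hP0] at hSz hSu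
  exact ⟨S, ε, hε, hS, hS0, hSz, hSu⟩

lemma eq_of_fderiv_apply_eq_zero {φ : X → ℂ} {s : Set X} (hs : IsOpen s) (hc : Convex ℝ s)
    (hφ : DifferentiableOn ℂ φ s) {a b : X} (ha : a ∈ s) (hb : b ∈ s)
    (h0 : ∀ x ∈ s, fderiv ℂ φ x (b - a) = 0) : φ a = φ b := by
  have hmem : ∀ t ∈ Icc (0 : ℝ) 1, a + (t : ℂ) • (b - a) ∈ s := by
    intro t ht
    have := hc.add_smul_sub_mem ha hb ht
    rwa [Complex.coe_smul]
  have hder : ∀ t ∈ Icc (0 : ℝ) 1,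
      HasDerivWithinAt (fun t : ℝ => φ (a + (t : ℂ) • (b - a))) 0 (Icc 0 1) t := by
    intro t ht
    have h1 : HasDerivAt (fun t : ℂ => a + t • (b - a)) (b - a) (t : ℂ) := by
      simpa using ((hasDerivAt_id (t : ℂ)).smul_const (b - a)).const_add a
    have h2 := (hφ.differentiableAt (hs.mem_nhds (hmem t ht))).hasFDerivAt.comp_hasDerivAt _ h1
    rw [h0 _ (hmem t ht)] at h2
    exact h2.comp_ofReal.hasDerivWithinAt
  have := constant_of_has_deriv_right_zero (f := fun t : ℝ => φ (a + (t : ℂ) • (b - a)))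
    (a := 0) (b := 1) (fun t ht => (hder t ht).continuousWithinAt)
    (fun t ht => (hder t (Ico_subset_Icc_self ht)).mono_of_mem_nhdsWithin
      (Icc_mem_nhdsGE_of_mem ht)) 1 (by simp)
  simpa using this.symm

end Implicit

section FirstIntegral

variable {E E' : Type*} [NormedAddCommGroup E] [NormedSpace ℂ E] [FiniteDimensional ℂ E]
  [NormedAddCommGroup E'] [NormedSpace ℂ E'] [FiniteDimensional ℂ E']

lemma exists_ball_mapsTo {X : Type*} [NormedAddCommGroup X] [NormedSpace ℂ X] {S : X → ℂ}
    {ω₀ d : X} {ε κ : ℝ} (hε : 0 < ε) (hS : DifferentiableOn ℂ S (ball ω₀ ε)) (hS0 : S ω₀ = 0)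
    (hκ : 0 < κ) : ∃ κ' > 0, κ' ≤ κ ∧ ∀ ω ∈ ball ω₀ κ', ω + S ω • d ∈ ball ω₀ κ ∧
      S ω ∈ ball (0 : ℂ) κ := by
  have hSc : ContinuousAt S ω₀ := (hS.differentiableAt (ball_mem_nhds _ hε)).continuousAt
  have hA : ContinuousAt (fun ω => ω + S ω • d) ω₀ :=
    continuousAt_id.add (hSc.smul continuousAt_const)
  have h1 : ∀ᶠ ω in 𝓝 ω₀, ω + S ω • d ∈ ball ω₀ κ := by
    refine hA.eventually_mem ?_
    simpa [hS0] using ball_mem_nhds ω₀ hκ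
  have h2 : ∀ᶠ ω in 𝓝 ω₀, S ω ∈ ball (0 : ℂ) κ := by
    refine hSc.eventually_mem ?_
    simpa [hS0] using ball_mem_nhds (0 : ℂ) hκ
  obtain ⟨κ', hκ', h⟩ := Metric.eventually_nhds_iff_ball.1 (h1.and h2)
  exact ⟨min κ κ', lt_min hκ hκ', min_le_left _ _,
    fun ω hω => h ω (ball_subset_ball (min_le_right _ _) hω)⟩

lemma hasFDerivAt_add_smul {X : Type*} [NormedAddCommGroup X] [NormedSpace ℂ X] {S : X → ℂ}
    {ω : X} (d : X) (hS : DifferentiableAt ℂ S ω) : HasFDerivAt (fun ω => ω + S ω • d)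
      (ContinuousLinearMap.id ℂ X + (fderiv ℂ S ω).smulRight d) ω :=
  (hasFDerivAt_id ω).add (hS.hasFDerivAt.smul_const d)

lemma fderiv_mul_inv_apply_eq_zero {X : Type*} [NormedAddCommGroup X] [NormedSpace ℂ X]
    {u v : X → ℂ} {u' v' : X →L[ℂ] ℂ} {x d : X} (hu : HasFDerivAt u u' x)
    (hv : HasFDerivAt v v' x) (h0 : v x ≠ 0) (h : u' d * v x = u x * v' d) :
    fderiv ℂ (fun y => u y * (v y)⁻¹) x d = 0 := by
  have h1 : HasFDerivAt (fun y => (v y)⁻¹) (-(v x ^ 2)⁻¹ • v') x :=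
    (hasDerivAt_inv h0).comp_hasFDerivAt x hv
  rw [(hu.fun_mul h1).fderiv]
  simp only [add_apply, smul_apply, smul_eq_mul]
  field_simp
  linear_combination h

/-- If the mixed second derivatives of `P` vanish on the kernels of the partial derivatives along
`{P = 0}`, then `{P = 0}` is of the form `{f z = g w}`. -/
lemma exists_first_integrals {P : E × E' → ℂ} {U : Set (E × E')} (hU : IsOpen U)
    (hP : DifferentiableOn ℂ P U) {p : E} {p' : E'} (h₀ : (p, p') ∈ U) (hP0 : P (p, p') = 0)
    {e : E} {e' : E'} (he : fderiv ℂ P (p, p') (e, 0) ≠ 0) (he' : fderiv ℂ P (p, p') (0, e') ≠ 0)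
    (hQ : ∀ ω ∈ U, P ω = 0 → ∀ ξ η, fderiv ℂ P ω (ξ, 0) = 0 → fderiv ℂ P ω (0, η) = 0 →
      fderiv ℂ (fderiv ℂ P) ω (0, η) (ξ, 0) = 0) :
    ∃ f : E → ℂ, ∃ g : E' → ℂ, ∃ δ > 0, DifferentiableOn ℂ f (ball p δ) ∧
      (∀ z ∈ ball p δ, fderiv ℂ f z ≠ 0) ∧ f p = 0 ∧
      (∀ z ∈ ball p δ, (z, p' + f z • e') ∈ U ∧ P (z, p' + f z • e') = 0) ∧
      ∀ z ∈ ball p δ, ∀ w ∈ ball p' δ, P (z, w) = 0 ↔ f z = g w := by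
  set ω₀ : E × E' := (p, p') with hω₀
  set G := fderiv ℂ P with hGdef
  have hGd : DifferentiableOn ℂ G U := differentiableOn_fderiv hU hP
  obtain ⟨S, ε₁, hε₁, hS, hS0, hSU, hSu⟩ := exists_implicit_along hU hP h₀ hP0 he'
  obtain ⟨T, ε₂, hε₂, hT, hT0, hTU, hTu⟩ := exists_implicit_along hU hP h₀ hP0 he
  have hcont : ∀ v, ContinuousAt (fun ω => G ω v) ω₀ := fun v =>
    ((hGd.differentiableAt (hU.mem_nhds h₀)).clm_apply (differentiableAt_const v)).continuousAt
  obtain ⟨ε₃, hε₃, hne⟩ := Metric.eventually_nhds_iff_ball.1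
    (((hcont _).eventually_ne he).and (((hcont _).eventually_ne he').and (hU.mem_nhds h₀)))
  set κ₀ := min ε₁ (min ε₂ ε₃) with hκ₀d
  have hκ₀ : 0 < κ₀ := lt_min hε₁ (lt_min hε₂ hε₃)
  have hb₁ : ball ω₀ κ₀ ⊆ ball ω₀ ε₁ := ball_subset_ball (min_le_left _ _)
  have hb₂ : ball ω₀ κ₀ ⊆ ball ω₀ ε₂ :=
    ball_subset_ball ((min_le_right _ _).trans (min_le_left _ _))
  have hb₃ : ball ω₀ κ₀ ⊆ ball ω₀ ε₃ :=
    ball_subset_ball ((min_le_right _ _).trans (min_le_right _ _))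
  have hs₁ : ball (0 : ℂ) κ₀ ⊆ ball 0 ε₁ := ball_subset_ball (min_le_left _ _)
  have hs₂ : ball (0 : ℂ) κ₀ ⊆ ball 0 ε₂ :=
    ball_subset_ball ((min_le_right _ _).trans (min_le_left _ _))
  have hstep : ∀ κ > 0, ∃ κ' > 0, κ' ≤ κ ∧ (∀ ω ∈ ball ω₀ κ', ω + S ω • ((0 : E), e') ∈ ball ω₀ κ ∧
      S ω ∈ ball (0 : ℂ) κ) ∧ ∀ ω ∈ ball ω₀ κ', ω + T ω • (e, (0 : E')) ∈ ball ω₀ κ ∧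
      T ω ∈ ball (0 : ℂ) κ := by
    intro κ hκ
    obtain ⟨a, ha, hak, hA⟩ := exists_ball_mapsTo (d := ((0 : E), e')) hε₁ hS hS0 hκ
    obtain ⟨b, hb, hbk, hB⟩ := exists_ball_mapsTo (d := (e, (0 : E'))) hε₂ hT hT0 hκ
    exact ⟨min a b, lt_min ha hb, (min_le_left _ _).trans hak,
      fun ω hω => hA ω (ball_subset_ball (min_le_left _ _) hω),
      fun ω hω => hB ω (ball_subset_ball (min_le_right _ _) hω)⟩
  obtain ⟨κ₁, hκ₁, hκ₁₀, hA₁, hB₁⟩ := hstep κ₀ hκ₀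
  obtain ⟨κ₂, hκ₂, hκ₂₁, hA₂, hB₂⟩ := hstep κ₁ hκ₁
  obtain ⟨κ₃, hκ₃, hκ₃₂, hA₃, hB₃⟩ := hstep κ₂ hκ₂
  have hprod : ∀ {κ : ℝ} {z : E} {w : E'}, (z, w) ∈ ball ω₀ κ ↔ z ∈ ball p κ ∧ w ∈ ball p' κ := by
    intro κ z w
    rw [mem_ball, Prod.dist_eq, max_lt_iff]
    rfl
  have hSd : ∀ ω ∈ ball ω₀ κ₁, DifferentiableAt ℂ S ω := fun ω hω =>
    hS.differentiableAt (isOpen_ball.mem_nhds (hb₁ (ball_subset_ball hκ₁₀ hω)))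
  have hTd : ∀ ω ∈ ball ω₀ κ₁, DifferentiableAt ℂ T ω := fun ω hω =>
    hT.differentiableAt (isOpen_ball.mem_nhds (hb₂ (ball_subset_ball hκ₁₀ hω)))
  have hPd : ∀ ω ∈ ball ω₀ κ₀, HasFDerivAt P (G ω) ω := fun ω hω =>
    (hP.differentiableAt (hU.mem_nhds (hne ω (hb₃ hω)).2.2)).hasFDerivAt
  have hSder : ∀ ω ∈ ball ω₀ κ₁, ∀ d, G (ω + S ω • ((0 : E), e'))
      (d + fderiv ℂ S ω d • ((0 : E), e')) = 0 := by
    intro ω hω d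
    have h1 := (hPd _ (hA₁ ω hω).1).comp ω (hasFDerivAt_add_smul ((0 : E), e') (hSd ω hω))
    have h2 : HasFDerivAt (P ∘ fun ω => ω + S ω • ((0 : E), e')) (0 : E × E' →L[ℂ] ℂ) ω := by
      refine (hasFDerivAt_const (0 : ℂ) ω).congr_of_eventuallyEq ?_
      filter_upwards [isOpen_ball.mem_nhds hω] with y hy
      exact (hSU y (hb₁ (ball_subset_ball hκ₁₀ hy))).2
    have h3 := congrArg (fun L : E × E' →L[ℂ] ℂ => L d) (h1.unique h2)
    simpa using h3
  have hTder : ∀ ω ∈ ball ω₀ κ₁, ∀ d, G (ω + T ω • (e, (0 : E')))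
      (d + fderiv ℂ T ω d • (e, (0 : E'))) = 0 := by
    intro ω hω d
    have h1 := (hPd _ (hB₁ ω hω).1).comp ω (hasFDerivAt_add_smul (e, (0 : E')) (hTd ω hω))
    have h2 : HasFDerivAt (P ∘ fun ω => ω + T ω • (e, (0 : E'))) (0 : E × E' →L[ℂ] ℂ) ω := by
      refine (hasFDerivAt_const (0 : ℂ) ω).congr_of_eventuallyEq ?_
      filter_upwards [isOpen_ball.mem_nhds hω] with y hy
      exact (hTU y (hb₂ (ball_subset_ball hκ₁₀ hy))).2
    have h3 := congrArg (fun L : E × E' →L[ℂ] ℂ => L d) (h1.unique h2)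
    simpa using h3
  -- the ratio of two partial derivatives along the leaves
  have hratio : ∀ z w ζ, (z, w) ∈ ball ω₀ κ₁ → P (z, w) = 0 → G (z, w) (ζ, 0) = 0 →
      G ((z, p') + S (z, p') • ((0 : E), e')) (ζ, 0) = 0 := by
    intro z w ζ hzw hPzw hζ
    have hzp : (z, p') ∈ ball ω₀ κ₁ := hprod.2 ⟨(hprod.1 hzw).1, mem_ball_self hκ₁⟩
    have hGA : ∀ ω ∈ ball ω₀ κ₁, ∀ v, HasFDerivAt (fun ω => G (ω + S ω • ((0 : E), e')) v)
        (((fderiv ℂ G (ω + S ω • ((0 : E), e'))).flip v).comp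
          (ContinuousLinearMap.id ℂ (E × E') + (fderiv ℂ S ω).smulRight ((0 : E), e'))) ω := by
      intro ω hω v
      have h1 : HasFDerivAt G (fderiv ℂ G (ω + S ω • ((0 : E), e'))) (ω + S ω • ((0 : E), e')) :=
        (hGd.differentiableAt (hU.mem_nhds (hne _ (hb₃ (hA₁ ω hω).1)).2.2)).hasFDerivAt
      have h2 := (h1.clm_apply (hasFDerivAt_const v _)).comp ω
        (hasFDerivAt_add_smul ((0 : E), e') (hSd ω hω))
      refine h2.congr_fderiv (ContinuousLinearMap.ext fun d => ?_)
      simp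
    have hn : ∀ ω ∈ ball ω₀ κ₁, G (ω + S ω • ((0 : E), e')) (e, 0) ≠ 0 := fun ω hω =>
      (hne _ (hb₃ (hA₁ ω hω).1)).1
    have key := eq_of_fderiv_apply_eq_zero (φ := fun ω => G (ω + S ω • ((0 : E), e')) (ζ, 0) *
      (G (ω + S ω • ((0 : E), e')) (e, 0))⁻¹) isOpen_ball (convex_ball ω₀ κ₁) ?_ hzw hzp ?_
    · have hS0' : S (z, w) = 0 := by
        refine (hSu (z, w) (hb₁ (ball_subset_ball hκ₁₀ hzw)) 0 (mem_ball_self hε₁) ?_).symm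
        rw [zero_smul, add_zero, hPzw]
      simp only [hS0', zero_smul, add_zero, hζ, zero_mul] at key
      exact (mul_eq_zero.1 key.symm).resolve_right (inv_ne_zero (hn _ hzp))
    · intro ω hω
      exact ((hGA ω hω _).differentiableAt.fun_mul
        ((hGA ω hω _).differentiableAt.fun_inv (hn ω hω))).differentiableWithinAt
    · intro ω hω
      refine fderiv_mul_inv_apply_eq_zero (hGA ω hω _) (hGA ω hω _) (hn ω hω) ?_
      set ω' := ω + S ω • ((0 : E), e') with hω'
      set d : E × E' := (z, p') - (z, w) with hd
      set η : E' := (p' - w) + fderiv ℂ S ω d • e' with hη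
      have hd' : d + fderiv ℂ S ω d • ((0 : E), e') = (0, η) := by
        rw [hη]
        ext <;> simp [hd]
      have hη0 : G ω' (0, η) = 0 := by rw [← hd']; exact hSder ω hω d
      have hP' : P ω' = 0 := (hSU ω (hb₁ (ball_subset_ball hκ₁₀ hω))).2
      have hk : G ω' (G ω' (e, 0) • ζ - G ω' (ζ, 0) • e, 0) = 0 := by
        have : ((G ω' (e, 0) • ζ - G ω' (ζ, 0) • e, 0) : E × E') =
            G ω' (e, 0) • (ζ, 0) - G ω' (ζ, 0) • (e, 0) := by ext <;> simp
        rw [this, map_sub, map_smul, map_smul, smul_eq_mul, smul_eq_mul]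
        ring
      have hq := hQ ω' (hne _ (hb₃ (hA₁ ω hω).1)).2.2 hP' _ η hk hη0
      have : ((G ω' (e, 0) • ζ - G ω' (ζ, 0) • e, 0) : E × E') =
            G ω' (e, 0) • (ζ, 0) - G ω' (ζ, 0) • (e, 0) := by ext <;> simp
      rw [this, map_sub, map_smul, map_smul, smul_eq_mul, smul_eq_mul] at hq
      simp only [ContinuousLinearMap.comp_apply, add_apply, ContinuousLinearMap.id_apply,
        ContinuousLinearMap.smulRight_apply, hd', ContinuousLinearMap.flip_apply]
      linear_combination hq
  set f : E → ℂ := fun z => S (z, p') with hf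
  have hzp : ∀ {κ : ℝ} (_ : 0 < κ) {z : E}, z ∈ ball p κ → (z, p') ∈ ball ω₀ κ := fun hκ _ hz =>
    hprod.2 ⟨hz, mem_ball_self hκ⟩
  have hfz : ∀ z, (z, p') + S (z, p') • ((0 : E), e') = (z, p' + f z • e') := by
    intro z
    ext <;> simp [hf]
  have hfd : ∀ z ∈ ball p κ₁, HasFDerivAt f ((fderiv ℂ S (z, p')).comp
      (ContinuousLinearMap.inl ℂ E E')) z := by
    intro z hz
    exact (hSd _ (hzp hκ₁ hz)).hasFDerivAt.comp z (hasFDerivAt_prodMk_left z p')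
  have hfder : ∀ z ∈ ball p κ₁, ∀ ζ, G (z, p' + f z • e') (ζ, 0) +
      fderiv ℂ f z ζ * G (z, p' + f z • e') (0, e') = 0 := by
    intro z hz ζ
    have := hSder (z, p') (hzp hκ₁ hz) (ζ, 0)
    rw [hfz, map_add, map_smul, smul_eq_mul] at this
    rw [(hfd z hz).fderiv]
    simpa using this
  have hfU : ∀ z ∈ ball p κ₁, (z, p' + f z • e') ∈ ball ω₀ κ₀ ∧ P (z, p' + f z • e') = 0 := by
    intro z hz
    rw [← hfz]
    exact ⟨(hA₁ _ (hzp hκ₁ hz)).1, (hSU _ (hb₁ (ball_subset_ball hκ₁₀ (hzp hκ₁ hz)))).2⟩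
  have hBz : ∀ y w, (y, w) + T (y, w) • (e, (0 : E')) = (y + T (y, w) • e, w) := by
    intro y w
    ext <;> simp
  have hφ : ∀ y w, (y, w) ∈ ball ω₀ κ₂ → f (y + T (y, w) • e) = f (p + T (p, w) • e) := by
    intro y w hyw
    have hpw : (p, w) ∈ ball ω₀ κ₂ := hprod.2 ⟨mem_ball_self hκ₂, (hprod.1 hyw).2⟩
    have hmem : ∀ ω ∈ ball ω₀ κ₂, ω.1 + T ω • e ∈ ball p κ₁ := by
      intro ω hω
      have := (hB₂ ω hω).1
      exact (hprod (z := ω.1 + T ω • e) (w := ω.2).1 (by convert this using 1; ext <;> simp)).1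
    have hder : ∀ ω ∈ ball ω₀ κ₂, HasFDerivAt (fun ω : E × E' => f (ω.1 + T ω • e))
        ((fderiv ℂ f (ω.1 + T ω • e)).comp (ContinuousLinearMap.fst ℂ E E' +
          (fderiv ℂ T ω).smulRight e)) ω := by
      intro ω hω
      have h1 : HasFDerivAt f (fderiv ℂ f (ω.1 + T ω • e)) (ω.1 + T ω • e) :=
        (hfd _ (hmem ω hω)).differentiableAt.hasFDerivAt
      exact h1.comp ω (hasFDerivAt_fst.add
        ((hTd ω (ball_subset_ball hκ₂₁ hω)).hasFDerivAt.smul_const e))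
    refine eq_of_fderiv_apply_eq_zero (φ := fun ω : E × E' => f (ω.1 + T ω • e)) isOpen_ball
      (convex_ball ω₀ κ₂) (fun ω hω => (hder ω hω).differentiableAt.differentiableWithinAt)
      hyw hpw fun ω hω => ?_
    obtain ⟨x, u⟩ := ω
    set d : E × E' := (p, w) - (y, w) with hd
    set ζ : E := (p - y) + fderiv ℂ T (x, u) d • e with hζ
    have hω₁ := ball_subset_ball hκ₂₁ hω
    have h1 := hTder _ hω₁ d
    have hd' : d + fderiv ℂ T (x, u) d • (e, (0 : E')) = (ζ, 0) := by
      rw [hζ]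
      ext <;> simp [hd]
    rw [hd', hBz] at h1
    have h2 : P (x + T (x, u) • e, u) = 0 := by
      rw [← hBz]
      exact (hTU _ (hb₂ (ball_subset_ball hκ₁₀ hω₁))).2
    have h3 := hratio _ u ζ (by rw [← hBz]; exact (hB₂ _ hω).1) h2 h1
    have h4 := hfder _ (hmem _ hω) ζ
    rw [hfz] at h3
    simp only at h4
    rw [h3, zero_add] at h4
    have h5 := (mul_eq_zero.1 h4).resolve_right (hne _ (hb₃ (hfU _ (hmem _ hω)).1)).2.1
    rw [(hder _ hω).fderiv]
    simp only [ContinuousLinearMap.comp_apply, add_apply, ContinuousLinearMap.smulRight_apply]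
    have : (ContinuousLinearMap.fst ℂ E E') d = p - y := rfl
    rw [this]
    exact h5
  refine ⟨f, fun w => f (p + T (p, w) • e), κ₃, hκ₃, fun z hz => ?_, fun z hz h0 => ?_, ?_,
    fun z hz => ?_, fun z hz w hw => ?_⟩
  · exact (hfd z (ball_subset_ball (hκ₃₂.trans hκ₂₁) hz)).differentiableAt.differentiableWithinAt
  · have hz₁ := ball_subset_ball (hκ₃₂.trans hκ₂₁) hz
    have := hfder z hz₁ e
    rw [h0, zero_apply, zero_mul, add_zero] at this
    exact (hne _ (hb₃ (hfU z hz₁).1)).1 this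
  · exact hS0
  · have := hfU z (ball_subset_ball (hκ₃₂.trans hκ₂₁) hz)
    exact ⟨(hne _ (hb₃ this.1)).2.2, this.2⟩
  · have hzw : (z, w) ∈ ball ω₀ κ₃ := hprod.2 ⟨hz, hw⟩
    have hzw₂ := ball_subset_ball hκ₃₂ hzw
    have hzw₁ := ball_subset_ball hκ₂₁ hzw₂
    have hz₁ := (hprod.1 hzw₁).1
    constructor
    · intro h
      have hT' : T (z, w) = 0 := by
        refine (hTu (z, w) (hb₂ (ball_subset_ball hκ₁₀ hzw₁)) 0 (mem_ball_self hε₂) ?_).symm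
        rw [zero_smul, add_zero, h]
      have := hφ z w hzw₂
      rwa [hT', zero_smul, add_zero] at this
    · intro h
      set s := T (z, w) with hs
      have h1 : f (z + s • e) = f z := by rw [h, hφ z w hzw₂]
      have hz1 : z + s • e ∈ ball p κ₁ := by
        have := (hB₃ _ hzw).1
        rw [hBz] at this
        exact ball_subset_ball hκ₂₁ (hprod.1 this).1
      have h2 : P (z + s • e, p' + f z • e') = 0 := by
        rw [← h1]
        exact (hfU _ hz1).2
      have hw' : (z, p' + f z • e') ∈ ball ω₀ κ₀ := (hfU z hz₁).1
      have h3 := hTu _ (hb₂ hw') 0 (mem_ball_self hε₂) (by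
        rw [zero_smul, add_zero]; exact (hfU z hz₁).2)
      have h4 := hTu _ (hb₂ hw') s (hs₂ (hB₁ _ hzw₁).2) (by
        have : (z, p' + f z • e') + s • (e, (0 : E')) = (z + s • e, p' + f z • e') := by
          ext <;> simp
        rw [this, h2])
      have h5 : s = 0 := h4.trans h3.symm
      have h6 := (hTU (z, w) (hb₂ (ball_subset_ball hκ₁₀ hzw₁))).2
      rwa [← hs, h5, zero_smul, add_zero] at h6

end FirstIntegral

section LocalLeviFlat

variable {N : ℕ}

/-- The antidiagonal embedding `z ↦ (z, z̄)`. -/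
def diagEmb (N : ℕ) : (Fin N → ℂ) →L[ℝ] (Fin N → ℂ) × (Fin N → ℂ) :=
  (ContinuousLinearMap.id ℝ _).prod (starL' ℝ : (Fin N → ℂ) ≃L[ℝ] (Fin N → ℂ))

lemma diagEmb_apply (z : Fin N → ℂ) : diagEmb N z = (z, star z) := rfl

lemma diagEmb_mem_ball {z p : Fin N → ℂ} {R : ℝ} :
    (z, star z) ∈ ball (p, star p) R ↔ z ∈ ball p R := by
  rw [mem_ball, Prod.dist_eq, dist_star_star, max_self, mem_ball]

lemma prod_mem_ball {E E' : Type*} [PseudoMetricSpace E] [PseudoMetricSpace E']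
    {z p : E} {w p' : E'}
    {κ : ℝ} : (z, w) ∈ ball (p, p') κ ↔ z ∈ ball p κ ∧ w ∈ ball p' κ := by
  rw [mem_ball, Prod.dist_eq, max_lt_iff]
  rfl

variable {ρ : (Fin N → ℂ) → ℝ} {P : (Fin N → ℂ) × (Fin N → ℂ) → ℂ} {p : Fin N → ℂ} {R : ℝ}

lemma fderiv_complexified (hP : DifferentiableOn ℂ P (ball (p, star p) R))
    (hPρ : ∀ z ∈ ball p R, P (z, star z) = ρ z) {z : Fin N → ℂ} (hz : z ∈ ball p R)
    (hρ : DifferentiableAt ℝ ρ z) (v : Fin N → ℂ) :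
    fderiv ℂ P (z, star z) (v, star v) = (fderiv ℝ ρ z v : ℝ) := by
  have h1 : HasFDerivAt P ((fderiv ℂ P (z, star z)).restrictScalars ℝ) (diagEmb N z) :=
    (hP.differentiableAt (isOpen_ball.mem_nhds
      (diagEmb_mem_ball.2 hz))).hasFDerivAt.restrictScalars ℝ
  have h2 := h1.comp z (diagEmb N).hasFDerivAt
  have h3 := (Complex.ofRealCLM.hasFDerivAt (x := ρ z)).comp z hρ.hasFDerivAt
  have h4 := h3.congr_of_eventuallyEq (f₁ := P ∘ diagEmb N) (by
    filter_upwards [isOpen_ball.mem_nhds hz] with y hy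
    exact hPρ y hy)
  have := congrArg (fun L : (Fin N → ℂ) →L[ℝ] ℂ => L v) (h2.unique h4)
  simpa [diagEmb_apply] using this

lemma fderiv_fderiv_complexified (hP : DifferentiableOn ℂ P (ball (p, star p) R))
    (hPρ : ∀ z ∈ ball p R, P (z, star z) = ρ z) (hρ : AnalyticOnNhd ℝ ρ (ball p R))
    {z : Fin N → ℂ} (hz : z ∈ ball p R) (u v : Fin N → ℂ) :
    fderiv ℂ (fderiv ℂ P) (z, star z) (u, star u) (v, star v) =
      (fderiv ℝ (fderiv ℝ ρ) z u v : ℝ) := by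
  have hG := differentiableOn_fderiv isOpen_ball hP
  have h1 : HasFDerivAt (fderiv ℂ P) ((fderiv ℂ (fderiv ℂ P) (z, star z)).restrictScalars ℝ)
      (diagEmb N z) :=
    (hG.differentiableAt (isOpen_ball.mem_nhds
      (diagEmb_mem_ball.2 hz))).hasFDerivAt.restrictScalars ℝ
  have h1' := h1.comp z (diagEmb N).hasFDerivAt
  have h2 : HasFDerivAt (fun y => fderiv ℂ P (diagEmb N y) (v, star v)) _ z :=
    (((ContinuousLinearMap.apply ℂ ℂ (v, star v)).restrictScalars ℝ).hasFDerivAt).comp z h1'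
  have hd : DifferentiableAt ℝ (fderiv ℝ ρ) z := (hρ z hz).fderiv.differentiableAt
  have h3 : HasFDerivAt (fun y => ((fderiv ℝ ρ y v : ℝ) : ℂ)) _ z :=
    (Complex.ofRealCLM.hasFDerivAt).comp z
      ((ContinuousLinearMap.apply ℝ ℝ v).hasFDerivAt.comp z hd.hasFDerivAt)
  have h4 := h3.congr_of_eventuallyEq (f₁ := fun y => fderiv ℂ P (diagEmb N y) (v, star v)) (by
    filter_upwards [isOpen_ball.mem_nhds hz] with y hy
    exact fderiv_complexified hP hPρ hy (hρ y hy).differentiableAt v)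
  have := congrArg (fun L : (Fin N → ℂ) →L[ℝ] ℂ => L u) (h2.unique h4)
  simpa [diagEmb_apply] using this

lemma fderiv_complexified_left_right (hP : DifferentiableOn ℂ P (ball (p, star p) R))
    (hPρ : ∀ z ∈ ball p R, P (z, star z) = ρ z) {z : Fin N → ℂ} (hz : z ∈ ball p R)
    (hρ : DifferentiableAt ℝ ρ z) (w : Fin N → ℂ) :
    fderiv ℂ P (z, star z) (w, 0) = ((fderiv ℝ ρ z w : ℝ) - I * (fderiv ℝ ρ z (I • w) : ℝ)) / 2 ∧
    fderiv ℂ P (z, star z) (0, star w) =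
      ((fderiv ℝ ρ z w : ℝ) + I * (fderiv ℝ ρ z (I • w) : ℝ)) / 2 := by
  have h1 := fderiv_complexified hP hPρ hz hρ w
  have h2 := fderiv_complexified hP hPρ hz hρ (I • w)
  have e1 : (w, star w) = (w, (0 : Fin N → ℂ)) + (0, star w) := by simp
  have e2 : (I • w, star (I • w)) = I • (w, (0 : Fin N → ℂ)) - I • ((0 : Fin N → ℂ), star w) := by
    ext <;> simp
  rw [e1, map_add] at h1
  rw [e2, map_sub, map_smul, map_smul, smul_eq_mul, smul_eq_mul] at h2
  rw [← h1, ← h2]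
  have hI : I * I = -1 := Complex.I_mul_I
  constructor
  · linear_combination (fderiv ℂ P (z, star z) (0, star w) -
      fderiv ℂ P (z, star z) (w, 0)) / 2 * -hI
  · linear_combination (fderiv ℂ P (z, star z) (0, star w) -
      fderiv ℂ P (z, star z) (w, 0)) / 2 * hI

lemma isComplexTangent_of_complexified (hP : DifferentiableOn ℂ P (ball (p, star p) R))
    (hPρ : ∀ z ∈ ball p R, P (z, star z) = ρ z) {z : Fin N → ℂ} (hz : z ∈ ball p R)
    (hρ : DifferentiableAt ℝ ρ z) {w : Fin N → ℂ}
    (hw : fderiv ℂ P (z, star z) (w, 0) = 0 ∨ fderiv ℂ P (z, star z) (0, star w) = 0) :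
    IsComplexTangent ρ z w ∧ fderiv ℂ P (z, star z) (w, 0) = 0 ∧
      fderiv ℂ P (z, star z) (0, star w) = 0 := by
  obtain ⟨h1, h2⟩ := fderiv_complexified_left_right hP hPρ hz hρ w
  have h3 : IsComplexTangent ρ z w := by
    rw [h1, h2] at hw
    rcases hw with hw | hw <;>
    · have hr := congrArg Complex.re hw
      have hi := congrArg Complex.im hw
      simp at hr hi
      exact ⟨hr, hi⟩
  refine ⟨h3, ?_, ?_⟩
  · rw [h1, h3.1, h3.2]; simp
  · rw [h2, h3.1, h3.2]; simp

lemma levi_complexified (hP : DifferentiableOn ℂ P (ball (p, star p) R))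
    (hPρ : ∀ z ∈ ball p R, P (z, star z) = ρ z) (hρ : AnalyticOnNhd ℝ ρ (ball p R))
    {z : Fin N → ℂ} (hz : z ∈ ball p R)
    (hL : ∀ w, IsComplexTangent ρ z w → leviForm ρ z w = 0) {ξ η : Fin N → ℂ}
    (hξ : fderiv ℂ P (z, star z) (ξ, 0) = 0) (hη : fderiv ℂ P (z, star z) (0, η) = 0) :
    fderiv ℂ (fderiv ℂ P) (z, star z) (0, η) (ξ, 0) = 0 := by
  set Q := fderiv ℂ (fderiv ℂ P) (z, star z) with hQ
  have hI : I * I = -1 := Complex.I_mul_I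
  have hρz := (hρ z hz).differentiableAt
  have hsymm : ∀ a b, Q a b = Q b a := by
    have hc : ContDiffAt ℂ (2 : ℕ) P (z, star z) :=
      (contDiffOn_of_differentiableOn_complex isOpen_ball 2 hP).contDiffAt
        (isOpen_ball.mem_nhds (diagEmb_mem_ball.2 hz))
    exact fun a b => (hc.isSymmSndFDerivAt (by simp)) a b
  have hdiag : ∀ w, fderiv ℂ P (z, star z) (w, 0) = 0 → Q (0, star w) (w, 0) = 0 := by
    intro w hw
    have h0 := hL w (isComplexTangent_of_complexified hP hPρ hz hρz (Or.inl hw)).1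
    rw [leviForm, iteratedFDeriv_two_apply, iteratedFDeriv_two_apply] at h0
    have h1 := congrArg (fun x : ℝ => (x : ℂ)) h0
    simp only [Matrix.cons_val_zero, Matrix.cons_val_one, Complex.ofReal_add,
      ← fderiv_fderiv_complexified hP hPρ hρ hz, Complex.ofReal_zero] at h1
    have e1 : (w, star w) = (w, (0 : Fin N → ℂ)) + (0, star w) := by simp
    have e2 : (I • w, star (I • w)) =
        I • (w, (0 : Fin N → ℂ)) - I • ((0 : Fin N → ℂ), star w) := by
      ext <;> simp
    rw [e1, e2, ← hQ] at h1
    simp only [map_add, map_sub, map_smul, add_apply, sub_apply, smul_apply, smul_eq_mul] at h1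
    rw [hsymm (w, 0) (0, star w)] at h1
    linear_combination h1 / 4 + (2 * Q (0, star w) (w, 0) - Q (w, 0) (w, 0) -
      Q (0, star w) (0, star w)) / 4 * hI
  have hη' := (isComplexTangent_of_complexified hP hPρ hz hρz (w := star η)
    (Or.inr (by rwa [star_star]))).2.1
  have key : ∀ c : ℂ, Q (0, star ξ) (c • star η, 0) + Q (0, star (c • star η)) (ξ, 0) = 0 := by
    intro c
    have e1 : (c • star η, (0 : Fin N → ℂ)) = c • (star η, 0) := by simp
    have h1 := hdiag (ξ + c • star η) (by
      have : (ξ + c • star η, (0 : Fin N → ℂ)) = (ξ, 0) + c • (star η, 0) := by simp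
      rw [this, map_add, map_smul, hξ, hη']
      simp)
    have h2 := hdiag ξ hξ
    have h3 := hdiag (c • star η) (by rw [e1, map_smul, hη', smul_zero])
    have e2 : (ξ + c • star η, (0 : Fin N → ℂ)) = (ξ, 0) + (c • star η, 0) := by simp
    have e3 : ((0 : Fin N → ℂ), star (ξ + c • star η)) = (0, star ξ) + (0, star (c • star η)) := by
      rw [star_add]; simp
    rw [e2, e3] at h1
    simp only [map_add, add_apply] at h1
    linear_combination h1 - h2 - h3
  have k1 := key 1
  have k2 := key I
  have e1 : (I • star η, (0 : Fin N → ℂ)) = I • (star η, 0) := by simp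
  have e2 : ((0 : Fin N → ℂ), star (I • star η)) = (-I) • (0, η) := by
    ext <;> simp
  rw [e1, e2] at k2
  simp only [one_smul, star_star] at k1
  simp only [map_smul, smul_apply, smul_eq_mul] at k2
  linear_combination (k1 + I * k2) / 2 - (Q (0, star ξ) (star η, 0) - Q (0, η) (ξ, 0)) / 2 * hI

/-- Projecting onto the zero set of the complexification along a real direction respects the
antidiagonal. -/
lemma exists_diagonal_projection (hP : DifferentiableOn ℂ P (ball (p, star p) R)) (hR : 0 < R)
    (hPρ : ∀ z ∈ ball p R, P (z, star z) = ρ z)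
    (hPs : ∀ u v, P (star v, star u) = star (P (u, v))) (hp : ρ p = 0) {e : Fin N → ℂ}
    (he : fderiv ℂ P (p, star p) (e, star e) ≠ 0) :
    ∃ s : (Fin N → ℂ) × (Fin N → ℂ) → ℂ, ∃ ε > 0, DifferentiableOn ℂ s (ball (p, star p) ε) ∧
      s (p, star p) = 0 ∧ (∀ ω ∈ ball (p, star p) ε, ω + s ω • (e, star e) ∈ ball (p, star p) R) ∧
      (∀ ω ∈ ball (p, star p) ε, P ω = 0 → s ω = 0) ∧
      ∀ z ∈ ball p ε, ∃ z' ∈ ball p R, (z, star z) + s (z, star z) • (e, star e) = (z', star z') ∧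
        ρ z' = 0 := by
  have hpp : (p, star p) ∈ ball (p, star p) R := mem_ball_self hR
  have hP0 : P (p, star p) = 0 := by rw [hPρ p (mem_ball_self hR), hp]; simp
  obtain ⟨s, ε₁, hε₁, hs, hs0, hsU, hsu⟩ := exists_implicit_along isOpen_ball hP hpp hP0 he
  obtain ⟨ε, hε, hεε, hm⟩ := exists_ball_mapsTo (d := (e, star e)) hε₁ hs hs0 hε₁
  have hsub := ball_subset_ball (x := (p, star p)) hεε
  refine ⟨s, ε, hε, hs.mono hsub, hs0, fun ω hω => (hsU ω (hsub hω)).1, fun ω hω h0 => ?_,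
    fun z hz => ?_⟩
  · exact (hsu ω (hsub hω) 0 (mem_ball_self hε₁) (by rw [zero_smul, add_zero, h0])).symm
  · set σ := s (z, star z) with hσ
    have hω := diagEmb_mem_ball.2 hz
    have h1 := hsU _ (hsub hω)
    have h2 : star σ = σ := by
      refine hsu _ (hsub hω) _ ?_ ?_
      · have := (hm _ hω).2
        rw [mem_ball_zero_iff] at this ⊢
        rwa [norm_star]
      · have e1 : (z, star z) + star σ • (e, star e) =
            (star (star z + σ • star e), star (z + σ • e)) := by
          ext <;> simp
        have e2 : (z, star z) + σ • (e, star e) = (z + σ • e, star z + σ • star e) := by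
          ext <;> simp
        rw [e1, hPs, ← e2, h1.2, star_zero]
    have h3 : (z, star z) + σ • (e, star e) = (z + σ • e, star (z + σ • e)) := by
      rw [star_add, star_smul, h2]
      ext <;> simp
    rw [h3] at h1
    refine ⟨z + σ • e, diagEmb_mem_ball.1 h1.1, h3, ?_⟩
    have := hPρ _ (diagEmb_mem_ball.1 h1.1)
    rw [h1.2] at this
    exact_mod_cast this.symm

end LocalLeviFlat

section LocalLeviFlat

variable {N : ℕ}

lemma exists_transverse (ρ' : (Fin N → ℂ) →L[ℝ] ℝ) (h : ρ' ≠ 0) :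
    ∃ e : Fin N → ℂ, ρ' e ≠ 0 ∧ ρ' (I • e) = 0 := by
  obtain ⟨v, hv⟩ : ∃ v, ρ' v ≠ 0 := by
    by_contra! hcon
    exact h (ContinuousLinearMap.ext hcon)
  have hI : I • I • v = -v := by rw [smul_smul, Complex.I_mul_I, neg_one_smul]
  refine ⟨ρ' v • v + ρ' (I • v) • (I • v), ?_, ?_⟩
  · rw [map_add, map_smul, map_smul, smul_eq_mul, smul_eq_mul]
    have : 0 < ρ' v * ρ' v := mul_self_pos.2 hv
    nlinarith [mul_self_nonneg (ρ' (I • v))]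
  · rw [smul_add, smul_comm I (ρ' v), smul_comm I (ρ' (I • v)), hI, map_add, ρ'.map_smul,
      ρ'.map_smul (ρ' (I • v)), map_neg]
    simp only [smul_eq_mul]
    ring

/-- Local leaf functions of a real analytic Levi-flat hypersurface, and unique continuation from
the hypersurface. -/
lemma exists_leaf_function {M : Set (Fin N → ℂ)} (hM : IsAnalyticLeviFlatHypersurface M)
    {p : Fin N → ℂ} (hp : p ∈ M) :
    (∃ δ > 0, ∃ f : (Fin N → ℂ) → ℂ, DifferentiableOn ℂ f (ball p δ) ∧
      (∀ z ∈ ball p δ, fderiv ℂ f z ≠ 0) ∧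
      ∀ q ∈ M, q ∈ ball p δ → ∀ z ∈ ball p δ, f z = f q → z ∈ M) ∧
    ∀ h : (Fin N → ℂ) → ℂ, ∀ ε > 0, DifferentiableOn ℂ h (ball p ε) →
      (∀ z ∈ M, z ∈ ball p ε → h z = 0) → ∀ᶠ z in 𝓝 p, h z = 0 := by
  obtain ⟨V, hVo, hpV, ρ, hρ, hρ', hρM, hlevi⟩ := hM p hp
  obtain ⟨P, R₁, hR₁, hP, hPρ, hPs⟩ := exists_complexification_pi (hρ p hpV)
  obtain ⟨R₂, hR₂, hRV⟩ := Metric.isOpen_iff.1 hVo p hpV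
  set R := min R₁ R₂ with hRdef
  have hR : 0 < R := lt_min hR₁ hR₂
  replace hP : DifferentiableOn ℂ P (ball (p, star p) R) :=
    hP.mono (ball_subset_ball (min_le_left _ _))
  replace hPρ : ∀ z ∈ ball p R, P (z, star z) = ρ z := fun z hz =>
    hPρ z (ball_subset_ball (min_le_left _ _) hz)
  replace hRV : ball p R ⊆ V := (ball_subset_ball (min_le_right _ _)).trans hRV
  have hρR : AnalyticOnNhd ℝ ρ (ball p R) := hρ.mono hRV
  have hpR := mem_ball_self (x := p) hR
  have hρp : ρ p = 0 := (hρM p hpV).1 hp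
  have hρd := (hρR p hpR).differentiableAt
  obtain ⟨e, he, heI⟩ := exists_transverse _ (hρ' p hpV)
  obtain ⟨he₁, he₂⟩ := fderiv_complexified_left_right hP hPρ hpR hρd e
  have he₃ := fderiv_complexified hP hPρ hpR hρd e
  have hec : ((fderiv ℝ ρ p e : ℝ) : ℂ) ≠ 0 := by exact_mod_cast he
  rw [heI] at he₁ he₂
  replace he₁ : fderiv ℂ P (p, star p) (e, 0) ≠ 0 := by
    rw [he₁]; simpa using he
  replace he₂ : fderiv ℂ P (p, star p) (0, star e) ≠ 0 := by
    rw [he₂]; simpa using he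
  rw [← he₃] at hec
  obtain ⟨s, ε, hε, hs, hs0, hsR, hsu, hsd⟩ :=
    exists_diagonal_projection hP hR hPρ hPs hρp hec
  set G := fderiv ℂ P with hGdef
  have hGd : DifferentiableOn ℂ G (ball (p, star p) R) := differentiableOn_fderiv isOpen_ball hP
  have hQd : DifferentiableOn ℂ (fderiv ℂ G) (ball (p, star p) R) :=
    differentiableOn_fderiv isOpen_ball hGd
  set C : (Fin N → ℂ) × (Fin N → ℂ) → (Fin N → ℂ) × (Fin N → ℂ) :=
    fun ω => ω + s ω • (e, star e) with hC
  have hCd : DifferentiableOn ℂ C (ball (p, star p) ε) :=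
    differentiableOn_id.add (hs.smul_const _)
  have hcont : ∀ v, ContinuousAt (fun ω => G ω v) (p, star p) := fun v =>
    ((hGd.differentiableAt (ball_mem_nhds _ hR)).clm_apply
      (differentiableAt_const v)).continuousAt
  obtain ⟨κ, hκ, hκU⟩ := Metric.eventually_nhds_iff_ball.1
    ((((hcont _).eventually_ne he₁).and ((hcont _).eventually_ne he₂)).and
      ((isOpen_ball.eventually_mem (mem_ball_self hε)).and
        (isOpen_ball.eventually_mem (mem_ball_self hR))))
  have hQ0 : ∀ ω ∈ ball (p, star p) κ, P ω = 0 → ∀ ξ η, G ω (ξ, 0) = 0 → G ω (0, η) = 0 →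
      fderiv ℂ G ω (0, η) (ξ, 0) = 0 := by
    intro ω hω hPω ξ η hξ hη
    obtain ⟨⟨hn₁, hn₂⟩, hωε, hωR⟩ := hκU ω hω
    let ξ' : (Fin N → ℂ) × (Fin N → ℂ) → (Fin N → ℂ) × (Fin N → ℂ) := fun y =>
      G y (e, 0) • (ξ, 0) - G y (ξ, 0) • (e, 0)
    let η' : (Fin N → ℂ) × (Fin N → ℂ) → (Fin N → ℂ) × (Fin N → ℂ) := fun y =>
      G y (0, star e) • (0, η) - G y (0, η) • (0, star e)
    have hGv : ∀ v, DifferentiableOn ℂ (fun y => G y v) (ball (p, star p) R) := fun v =>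
      hGd.clm_apply (differentiableOn_const v)
    have hξd : DifferentiableOn ℂ ξ' (ball (p, star p) R) :=
      ((hGv _).smul_const _).sub ((hGv _).smul_const _)
    have hηd : DifferentiableOn ℂ η' (ball (p, star p) R) :=
      ((hGv _).smul_const _).sub ((hGv _).smul_const _)
    have hd : DifferentiableOn ℂ (fun y => fderiv ℂ G (C y) (η' (C y)) (ξ' (C y)))
        (ball (p, star p) ε) :=
      (DifferentiableOn.clm_apply (hQd.clm_apply hηd) hξd).comp hCd hsR
    have h0 := eq_zero_of_diagonal hd (fun z hz => by
      obtain ⟨z', hz', hzz', hρz'⟩ := hsd z hz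
      have hCz : C (z, star z) = (z', star z') := hzz'
      rw [hCz]
      have e1 : ξ' (z', star z') =
          (G (z', star z') (e, 0) • ξ - G (z', star z') (ξ, 0) • e, 0) := by
        ext <;> simp [ξ']
      have e2 : η' (z', star z') = (0, G (z', star z') (0, star e) • η -
          G (z', star z') (0, η) • star e) := by
        ext <;> simp [η']
      have h1 : G (z', star z') (ξ' (z', star z')) = 0 := by
        simp only [ξ', map_sub, map_smul, smul_eq_mul]
        ring
      have h2 : G (z', star z') (η' (z', star z')) = 0 := by
        simp only [η', map_sub, map_smul, smul_eq_mul]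
        ring
      rw [e1] at h1 ⊢
      rw [e2] at h2 ⊢
      exact levi_complexified hP hPρ hρR hz' (hlevi z' (hRV hz') hρz') h1 h2) ω hωε
    have hCω : C ω = ω := by
      simp only [hC]
      rw [hsu ω hωε hPω, zero_smul, add_zero]
    simp only [hCω, ξ', η', hξ, hη, zero_smul, sub_zero, map_smul, smul_apply, smul_eq_mul] at h0
    simpa [hn₁, hn₂] using h0
  obtain ⟨f, g, δ, hδ, hf, hf', hfp, hfP, hfg⟩ := exists_first_integrals isOpen_ball
    (hP.mono fun ω hω => (hκU ω hω).2.2) (mem_ball_self hκ)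
    (by rw [hPρ p hpR, hρp]; simp) he₁ he₂ hQ0
  have hstar : ∀ {z : Fin N → ℂ} {r : ℝ}, z ∈ ball p r → star z ∈ ball (star p) r := by
    intro z r hz
    rwa [mem_ball, dist_star_star]
  refine ⟨⟨min δ R, lt_min hδ hR, f, hf.mono (ball_subset_ball (min_le_left _ _)),
    fun z hz => hf' z (ball_subset_ball (min_le_left _ _) hz), fun q hqM hq z hz hzq => ?_⟩,
    fun h ε₁ hε₁ hh hhM => ?_⟩
  · have hqδ := ball_subset_ball (min_le_left _ _) hq
    have hqR := ball_subset_ball (min_le_right _ _) hq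
    have hzδ := ball_subset_ball (min_le_left _ _) hz
    have hzR := ball_subset_ball (min_le_right _ _) hz
    have h1 : P (q, star q) = 0 := by
      rw [hPρ q hqR, (hρM q (hRV hqR)).1 hqM]; simp
    have h2 := (hfg q hqδ _ (hstar hqδ)).1 h1
    have h3 := (hfg z hzδ _ (hstar hqδ)).2 (hzq.trans h2)
    have h4 : P (q, star z) = 0 := by
      have := hPs z (star q)
      rw [star_star] at this
      rw [this, h3, star_zero]
    have h5 := (hfg q hqδ _ (hstar hzδ)).1 h4
    have h6 := (hfg z hzδ _ (hstar hzδ)).2 (hzq.trans h5)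
    rw [hPρ z hzR] at h6
    exact (hρM z (hRV hzR)).2 (by exact_mod_cast h6)
  · obtain ⟨ε₂, hε₂, hε₂ε₁, hm⟩ := exists_ball_mapsTo (d := (e, star e)) hε hs hs0
      (lt_min hε₁ hε)
    have hε₂ε : ε₂ ≤ ε := hε₂ε₁.trans (min_le_right _ _)
    have hhd : DifferentiableOn ℂ (fun y : (Fin N → ℂ) × (Fin N → ℂ) => h (C y).1)
        (ball (p, star p) ε₂) := by
      refine hh.comp (differentiable_fst.comp_differentiableOn
        (hCd.mono (ball_subset_ball hε₂ε))) fun y hy => ?_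
      exact ball_subset_ball (min_le_left _ _) (prod_mem_ball.1 (hm y hy).1).1
    have h0 := eq_zero_of_diagonal hhd (fun z hz => by
      obtain ⟨z', hz', hzz', hρz'⟩ := hsd z (ball_subset_ball hε₂ε hz)
      have hCz : C (z, star z) = (z', star z') := hzz'
      rw [hCz]
      refine hhM z' ((hρM z' (hRV hz')).2 hρz') ?_
      have := (hm (z, star z) (diagEmb_mem_ball.2 hz)).1
      rw [hzz'] at this
      exact ball_subset_ball (min_le_left _ _) (prod_mem_ball.1 this).1)
    have hfc : ContinuousAt (fun z => (z, star p + f z • star e)) p := by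
      have := (hf.differentiableAt (ball_mem_nhds _ hδ)).continuousAt
      exact continuousAt_id.prodMk (continuousAt_const.add (this.smul continuousAt_const))
    have hev : ∀ᶠ z in 𝓝 p, (z, star p + f z • star e) ∈ ball (p, star p) ε₂ := by
      refine hfc.eventually_mem ?_
      simpa [hfp] using ball_mem_nhds (p, star p) hε₂
    filter_upwards [hev, ball_mem_nhds p hδ] with z hz hzδ
    have h1 := h0 _ hz
    have hCz : C (z, star p + f z • star e) = (z, star p + f z • star e) := by
      simp only [hC]
      rw [hsu _ (ball_subset_ball hε₂ε hz) (hfP z hzδ).2, zero_smul, add_zero]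
    rwa [hCz] at h1

/-- The kernel of the derivative of a leaf function is the complex tangent space. -/
lemma fderiv_apply_eq_zero_iff {ρ : (Fin N → ℂ) → ℝ} {q : Fin N → ℂ} {ε : ℝ} (hε : 0 < ε)
    (hρ : DifferentiableAt ℝ ρ q) (hρ' : fderiv ℝ ρ q ≠ 0) {f : (Fin N → ℂ) → ℂ}
    (hf : DifferentiableOn ℂ f (ball q ε)) (hf' : fderiv ℂ f q ≠ 0)
    (hleaf : ∀ z ∈ ball q ε, f z = f q → ρ z = 0) (w : Fin N → ℂ) :
    fderiv ℂ f q w = 0 ↔ IsComplexTangent ρ q w := by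
  obtain ⟨e, he⟩ : ∃ e, fderiv ℂ f q e ≠ 0 := by
    by_contra! hcon
    exact hf' (ContinuousLinearMap.ext hcon)
  have hfq : HasFDerivAt f (fderiv ℂ f q) q :=
    (hf.differentiableAt (ball_mem_nhds _ hε)).hasFDerivAt
  obtain ⟨S, ε₁, hε₁, hS, hS0, hSU, -⟩ := exists_implicit_along (P := fun z => f z - f q)
    isOpen_ball (hf.sub (differentiableOn_const _)) (mem_ball_self hε) (sub_self _)
    (d := e) (by rw [(hfq.sub_const _).fderiv]; exact he)
  have hSd : DifferentiableAt ℂ S q := hS.differentiableAt (ball_mem_nhds _ hε₁)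
  have hA := hasFDerivAt_add_smul e hSd
  have hAq : q + S q • e = q := by rw [hS0, zero_smul, add_zero]
  have hSder : ∀ v, fderiv ℂ f q (v + fderiv ℂ S q v • e) = 0 := by
    intro v
    have h1 : HasFDerivAt f (fderiv ℂ f q) (q + S q • e) := by rwa [hAq]
    have h2 : HasFDerivAt (f ∘ fun y => y + S y • e) (0 : (Fin N → ℂ) →L[ℂ] ℂ) q := by
      refine (hasFDerivAt_const (f q) q).congr_of_eventuallyEq ?_
      filter_upwards [ball_mem_nhds q hε₁] with y hy
      exact sub_eq_zero.1 (hSU y hy).2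
    have := congrArg (fun L : (Fin N → ℂ) →L[ℂ] ℂ => L v) ((h1.comp q hA).unique h2)
    simpa using this
  have hρder : ∀ v, fderiv ℝ ρ q (v + fderiv ℂ S q v • e) = 0 := by
    intro v
    have h1 : HasFDerivAt ρ (fderiv ℝ ρ q) (q + S q • e) := by rw [hAq]; exact hρ.hasFDerivAt
    have h2 : HasFDerivAt (ρ ∘ fun y => y + S y • e) (0 : (Fin N → ℂ) →L[ℝ] ℝ) q := by
      refine (hasFDerivAt_const (0 : ℝ) q).congr_of_eventuallyEq ?_
      filter_upwards [ball_mem_nhds q hε₁] with y hy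
      exact hleaf _ (hSU y hy).1 (sub_eq_zero.1 (hSU y hy).2)
    have := congrArg (fun L : (Fin N → ℂ) →L[ℝ] ℝ => L v)
      ((h1.comp q (hA.restrictScalars ℝ)).unique h2)
    simpa using this
  have hker : ∀ v, fderiv ℂ f q v = 0 → fderiv ℝ ρ q v = 0 := by
    intro v hv
    have h1 := hSder v
    rw [map_add, hv, map_smul, zero_add, smul_eq_mul] at h1
    have h2 := hρder v
    rwa [(mul_eq_zero.1 h1).resolve_right he, zero_smul, add_zero] at h2
  constructor
  · intro h
    exact ⟨hker w h, hker _ (by rw [map_smul, h, smul_zero])⟩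
  · intro h
    by_contra hne
    apply hρ'
    ext v
    set a := fderiv ℂ f q v / fderiv ℂ f q w with ha
    have h1 := hker (v - a • w) (by
      rw [map_sub, map_smul, smul_eq_mul, ha, div_mul_cancel₀ _ hne, sub_self])
    have h2 : a • w = a.re • w + a.im • (I • w) := by
      conv_lhs => rw [← Complex.re_add_im a]
      rw [add_smul, mul_smul, Complex.coe_smul, Complex.coe_smul]
    have h3 : fderiv ℝ ρ q (a • w) = 0 := by
      rw [h2, map_add, map_smul, map_smul, h.1, h.2]
      simp
    rw [map_sub, h3, sub_zero] at h1
    simpa using h1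

end LocalLeviFlat

section Atlas

variable {V W : Type*} [NormedAddCommGroup V] [NormedSpace ℂ V]
  [NormedAddCommGroup W] [NormedSpace ℂ W]

/-- A closed cone which locally is a union of leaves of holomorphic foliations, is a uniqueness
set for holomorphic functions, and determines the tangent spaces of the leaves. -/
structure LeafAtlas (M : Set V) : Prop where
  nonempty : M.Nonempty
  zero_notMem : (0 : V) ∉ M
  smul_mem : ∀ c : ℂ, c ≠ 0 → ∀ z ∈ M, c • z ∈ M
  mem_of_closure : ∀ z ∈ closure M, z ≠ 0 → z ∈ M
  exists_leaf : ∀ p ∈ M, ∃ f : V → ℂ, (∀ᶠ z in 𝓝 p, DifferentiableAt ℂ f z) ∧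
    fderiv ℂ f p ≠ 0 ∧ ∃ U ∈ 𝓝 p, ∀ q ∈ M, q ∈ U → ∀ z ∈ U, f z = f q → z ∈ M
  eventually_eq_zero : ∀ p ∈ M, ∀ h : V → ℂ, (∀ᶠ z in 𝓝 p, DifferentiableAt ℂ h z) →
    (∀ᶠ z in 𝓝 p, z ∈ M → h z = 0) → ∀ᶠ z in 𝓝 p, h z = 0
  exists_tangent : ∀ q ∈ M, ∃ T : Set V, q ∈ T ∧ ∀ f : V → ℂ,
    (∀ᶠ z in 𝓝 q, DifferentiableAt ℂ f z) → fderiv ℂ f q ≠ 0 →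
    (∀ᶠ z in 𝓝 q, f z = f q → z ∈ M) → ∀ w, fderiv ℂ f q w = 0 ↔ w ∈ T

lemma LeafAtlas.preimage {M : Set W} (h : LeafAtlas M) (L : V ≃L[ℂ] W) :
    LeafAtlas (L ⁻¹' M) := by
  have ht : ∀ p, Tendsto L (𝓝 p) (𝓝 (L p)) := fun p => L.continuous.tendsto p
  have hts : ∀ p, Tendsto L.symm (𝓝 (L p)) (𝓝 p) := fun p => by
    simpa using L.symm.continuous.tendsto (L p)
  have hd : ∀ {f : V → ℂ} {p : V}, (∀ᶠ z in 𝓝 p, DifferentiableAt ℂ f z) →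
      ∀ᶠ y in 𝓝 (L p), DifferentiableAt ℂ (f ∘ L.symm) y := by
    intro f p hf
    filter_upwards [(hts p).eventually hf] with y hy
    exact hy.comp y L.symm.differentiableAt
  refine ⟨?_, ?_, ?_, ?_, ?_, ?_, ?_⟩
  · obtain ⟨z, hz⟩ := h.nonempty
    exact ⟨L.symm z, by simpa using hz⟩
  · simpa using h.zero_notMem
  · intro c hc z hz
    rw [mem_preimage, map_smul]
    exact h.smul_mem c hc _ hz
  · intro z hz hz0
    refine h.mem_of_closure _ ?_ (by simpa using hz0)
    exact L.continuous.closure_preimage_subset _ hz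
  · intro p hp
    obtain ⟨f, hf, hf', U, hU, hleaf⟩ := h.exists_leaf _ hp
    refine ⟨f ∘ L, ?_, ?_, L ⁻¹' U, (ht p) hU, fun q hq hqU z hz hzq =>
      hleaf _ hq hqU _ hz hzq⟩
    · filter_upwards [(ht p).eventually hf] with y hy
      exact hy.comp y L.differentiableAt
    · rw [L.comp_right_fderiv]
      intro h0
      apply hf'
      ext v
      have := congrArg (fun A : V →L[ℂ] ℂ => A (L.symm v)) h0
      simpa using this
  · intro p hp g hg hgM
    have h1 := h.eventually_eq_zero _ hp (g ∘ L.symm) (hd hg) (by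
      filter_upwards [(hts p).eventually hgM] with y hy hyM
      exact hy (by simpa using hyM))
    filter_upwards [(ht p).eventually h1] with z hz
    simpa using hz
  · intro q hq
    obtain ⟨T, hT, hTf⟩ := h.exists_tangent _ hq
    refine ⟨L ⁻¹' T, hT, fun f hf hf' hfM w => ?_⟩
    have hfq : DifferentiableAt ℂ f q := hf.self_of_nhds
    have hder : ∀ v, fderiv ℂ (f ∘ L.symm) (L q) v = fderiv ℂ f q (L.symm v) := by
      intro v
      rw [L.symm.comp_right_fderiv]
      simp
    have := hTf (f ∘ L.symm) (hd hf) (fun h0 => hf' (by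
      ext v
      have := hder (L v)
      rw [h0] at this
      simpa using this.symm)) (by
      filter_upwards [(hts q).eventually hfM] with y hy hyq
      have := hy (by simpa using hyq)
      simpa using this) (L w)
    rw [hder] at this
    simpa using this

/-- The cone over a closed real analytic Levi-flat hypersurface of projective space. -/
lemma leafAtlas_of_isAnalyticLeviFlatHypersurface {m : ℕ} {M : Set (Fin m → ℂ)}
    (hM : IsProjectiveClosedSet M) (hL : IsAnalyticLeviFlatHypersurface M) : LeafAtlas M := by
  obtain ⟨hne, h0, hcone, hcl⟩ := hM
  refine ⟨hne, fun h => h0 0 h rfl, hcone, hcl, ?_, ?_, ?_⟩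
  · intro p hp
    obtain ⟨⟨δ, hδ, f, hf, hf', hleaf⟩, -⟩ := exists_leaf_function hL hp
    refine ⟨f, ?_, hf' p (mem_ball_self hδ), ball p δ, ball_mem_nhds p hδ, hleaf⟩
    filter_upwards [isOpen_ball.mem_nhds (mem_ball_self hδ)] with z hz
    exact hf.differentiableAt (isOpen_ball.mem_nhds hz)
  · intro p hp h hh hhM
    obtain ⟨ε, hε, H⟩ := Metric.eventually_nhds_iff_ball.1 (hh.and hhM)
    exact (exists_leaf_function hL hp).2 h ε hε
      (fun z hz => (H z hz).1.differentiableWithinAt) fun z hzM hz => (H z hz).2 hzM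
  · intro q hq
    obtain ⟨V, hVo, hqV, ρ, hρ, hρ', hρM, -⟩ := hL q hq
    have hρd := (hρ q hqV).differentiableAt
    refine ⟨{w | IsComplexTangent ρ q w}, ?_, fun f hf hf' hfM w => ?_⟩
    · have hcurve : ∀ a : ℂ, fderiv ℝ ρ q (a • q) = 0 := by
        intro a
        have h1 : HasDerivAt (fun t : ℝ => q + t • (a • q)) (a • q) 0 := by
          simpa using ((hasDerivAt_id (0 : ℝ)).smul_const (a • q)).const_add q
        have h2 : HasFDerivAt ρ (fderiv ℝ ρ q) (q + (0 : ℝ) • (a • q)) := by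
          simpa using hρd.hasFDerivAt
        have h3 := h2.comp_hasDerivAt (0 : ℝ) h1
        refine h3.unique ((hasDerivAt_const (0 : ℝ) (0 : ℝ)).congr_of_eventuallyEq ?_)
        have h4 : ∀ᶠ t : ℝ in 𝓝 0, q + t • (a • q) ∈ V := by
          refine h1.continuousAt.eventually_mem ?_
          simpa using hVo.mem_nhds hqV
        have h5 : ∀ᶠ t : ℝ in 𝓝 0, 1 + (t : ℂ) * a ≠ 0 := by
          have : ContinuousAt (fun t : ℝ => 1 + (t : ℂ) * a) 0 := by fun_prop
          exact this.eventually_ne (by simp)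
        filter_upwards [h4, h5] with t ht ht'
        refine (hρM _ ht).1 ?_
        have : q + t • (a • q) = (1 + (t : ℂ) * a) • q := by
          rw [add_smul, one_smul, mul_smul, Complex.coe_smul]
        rw [this]
        exact hcone _ ht' q hq
      exact ⟨by simpa using hcurve 1, hcurve I⟩
    · obtain ⟨ε, hε, H⟩ := Metric.eventually_nhds_iff_ball.1
        (hf.and (hfM.and (hVo.eventually_mem hqV)))
      exact fderiv_apply_eq_zero_iff hε hρd (hρ' q hqV)
        (fun z hz => (H z hz).1.differentiableWithinAt) hf'
        (fun z hz hzq => (hρM z (H z hz).2.2).1 ((H z hz).2.1 hzq)) w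

end Atlas

section Uniform

variable {V : Type*} [NormedAddCommGroup V] [NormedSpace ℂ V] [FiniteDimensional ℂ V]

/-- A holomorphic function with leaves in `M` and controlled derivative. -/
structure IsLeafFunction (M : Set V) (f : V → ℂ) (U : Set V) : Prop where
  differentiableOn : DifferentiableOn ℂ f U
  one_le : ∀ z ∈ U, 1 ≤ ‖fderiv ℂ f z‖
  le_three : ∀ z ∈ U, ‖fderiv ℂ f z‖ ≤ 3
  leaf : ∀ q ∈ M, q ∈ U → ∀ z ∈ U, f z = f q → z ∈ M

lemma IsLeafFunction.mono {M : Set V} {f : V → ℂ} {U U' : Set V} (h : IsLeafFunction M f U)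
    (hU : U' ⊆ U) : IsLeafFunction M f U' :=
  ⟨h.differentiableOn.mono hU, fun z hz => h.one_le z (hU hz), fun z hz => h.le_three z (hU hz),
    fun q hq hqU z hz => h.leaf q hq (hU hqU) z (hU hz)⟩

lemma LeafAtlas.exists_isLeafFunction {M : Set V} (h : LeafAtlas M) {p : V} (hp : p ∈ M) :
    ∃ δ > 0, ∃ f, IsLeafFunction M f (ball p δ) := by
  obtain ⟨f, hf, hf', U, hU, hleaf⟩ := h.exists_leaf p hp
  obtain ⟨δ₁, hδ₁, H₁⟩ := Metric.eventually_nhds_iff_ball.1 hf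
  obtain ⟨δ₂, hδ₂, H₂⟩ := Metric.mem_nhds_iff.1 hU
  have hfd : DifferentiableOn ℂ f (ball p δ₁) := fun z hz => (H₁ z hz).differentiableWithinAt
  have hc : ContinuousAt (fun z => ‖fderiv ℂ f z‖) p :=
    ((continuousOn_fderiv_of_differentiableOn isOpen_ball hfd).continuousAt
      (ball_mem_nhds p hδ₁)).norm
  set a := ‖fderiv ℂ f p‖ with ha
  have ha0 : 0 < a := norm_pos_iff.2 hf'
  have h1 : ∀ᶠ z in 𝓝 p, a / 2 < ‖fderiv ℂ f z‖ :=
    hc.eventually (lt_mem_nhds (by linarith : a / 2 < a))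
  have h2 : ∀ᶠ z in 𝓝 p, ‖fderiv ℂ f z‖ < 3 * a / 2 :=
    hc.eventually (gt_mem_nhds (by linarith : a < 3 * a / 2))
  obtain ⟨δ₃, hδ₃, H₃⟩ := Metric.eventually_nhds_iff_ball.1 (h1.and h2)
  set δ := min δ₁ (min δ₂ δ₃) with hδ
  have hs₁ : ball p δ ⊆ ball p δ₁ := ball_subset_ball (min_le_left _ _)
  have hs₂ : ball p δ ⊆ ball p δ₂ :=
    ball_subset_ball ((min_le_right _ _).trans (min_le_left _ _))
  have hs₃ : ball p δ ⊆ ball p δ₃ :=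
    ball_subset_ball ((min_le_right _ _).trans (min_le_right _ _))
  set c : ℂ := ((2 / a : ℝ) : ℂ) with hcdef
  have hc0 : c ≠ 0 := by
    rw [hcdef, Complex.ofReal_ne_zero]; positivity
  have hder : ∀ z ∈ ball p δ, ‖fderiv ℂ (fun y => c * f y) z‖ = 2 / a * ‖fderiv ℂ f z‖ := by
    intro z hz
    rw [fderiv_const_mul (H₁ z (hs₁ hz)), norm_smul, hcdef, Complex.norm_real,
      Real.norm_of_nonneg (by positivity)]
  refine ⟨δ, lt_min hδ₁ (lt_min hδ₂ hδ₃), fun y => c * f y, ?_, fun z hz => ?_, fun z hz => ?_,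
    fun q hq hqU z hz hzq => ?_⟩
  · exact (hfd.mono hs₁).const_mul c
  · rw [hder z hz, div_mul_eq_mul_div, le_div_iff₀ ha0]
    linarith [(H₃ z (hs₃ hz)).1]
  · rw [hder z hz, div_mul_eq_mul_div, div_le_iff₀ ha0]
    linarith [(H₃ z (hs₃ hz)).2]
  · exact hleaf q hq (H₂ (hs₂ hqU)) z (H₂ (hs₂ hz)) (mul_left_cancel₀ hc0 hzq)

lemma hasFDerivAt_rescale {F : V → ℂ} {t : ℂ} (ht : t ≠ 0) {z : V}
    (hF : DifferentiableAt ℂ F (t⁻¹ • z)) :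
    HasFDerivAt (fun y => t * F (t⁻¹ • y)) (fderiv ℂ F (t⁻¹ • z)) z := by
  have h1 : HasFDerivAt (fun y : V => t⁻¹ • y) (t⁻¹ • ContinuousLinearMap.id ℂ V) z :=
    (hasFDerivAt_id z).const_smul t⁻¹
  refine ((hF.hasFDerivAt.comp z h1).const_mul t).congr_fderiv ?_
  ext v
  simp [mul_inv_cancel_left₀ ht]

lemma LeafAtlas.exists_uniform {M : Set V} (h : LeafAtlas M) :
    ∃ R > 0, ∃ f : V → V → ℂ, ∀ q ∈ M, IsLeafFunction M (f q) (ball q (R * ‖q‖)) := by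
  have : ProperSpace V := FiniteDimensional.proper ℂ V
  set K := M ∩ sphere (0 : V) 1 with hK
  have hKc : IsCompact K := by
    refine (isCompact_sphere (0 : V) 1).of_isClosed_subset ?_ inter_subset_right
    refine isClosed_of_closure_subset fun z hz => ?_
    have hzs : z ∈ sphere (0 : V) 1 :=
      isClosed_sphere.closure_subset_iff.2 inter_subset_right hz
    refine ⟨h.mem_of_closure z (closure_mono inter_subset_left hz) ?_, hzs⟩
    rintro rfl
    simp at hzs
  choose! δ hδ F hF using fun p (hp : p ∈ M) => h.exists_isLeafFunction hp
  obtain ⟨R, hR, hRK⟩ := lebesgue_number_lemma_of_metric (c := fun p : K => ball (p : V) (δ p))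
    hKc (fun _ => isOpen_ball) fun x hx =>
      mem_iUnion.2 ⟨⟨x, hx⟩, mem_ball_self (hδ x hx.1)⟩
  have hRK' : ∀ x ∈ K, ∃ g, IsLeafFunction M g (ball x R) := by
    intro x hx
    obtain ⟨p, hp⟩ := hRK x hx
    exact ⟨F p, (hF p p.2.1).mono hp⟩
  choose! g hg using hRK'
  have hscale : ∀ q ∈ M, ∃ f, IsLeafFunction M f (ball q (R * ‖q‖)) := by
    intro q hq
    have hq0 : q ≠ 0 := fun h0 => h.zero_notMem (h0 ▸ hq)
    have hqn : 0 < ‖q‖ := norm_pos_iff.2 hq0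
    set t : ℂ := (‖q‖ : ℂ) with ht
    have ht0 : t ≠ 0 := by rw [ht, Complex.ofReal_ne_zero]; exact hqn.ne'
    have htn : ‖t⁻¹‖ = ‖q‖⁻¹ := by rw [norm_inv, ht, Complex.norm_real, norm_norm]
    have hx : t⁻¹ • q ∈ K := by
      refine ⟨h.smul_mem _ (inv_ne_zero ht0) q hq, ?_⟩
      rw [mem_sphere_zero_iff_norm, norm_smul, htn, inv_mul_cancel₀ hqn.ne']
    have hx' := hg _ hx
    have hmem : ∀ z ∈ ball q (R * ‖q‖), t⁻¹ • z ∈ ball (t⁻¹ • q) R := by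
      intro z hz
      rw [mem_ball, dist_eq_norm] at *
      rw [← smul_sub, norm_smul, htn, inv_mul_lt_iff₀ hqn, mul_comm]
      exact hz
    have hder : ∀ z ∈ ball q (R * ‖q‖), HasFDerivAt (fun y => t * g (t⁻¹ • q) (t⁻¹ • y))
        (fderiv ℂ (g (t⁻¹ • q)) (t⁻¹ • z)) z := fun z hz =>
      hasFDerivAt_rescale ht0 (hx'.differentiableOn.differentiableAt
        (isOpen_ball.mem_nhds (hmem z hz)))
    refine ⟨fun y => t * g (t⁻¹ • q) (t⁻¹ • y),
      fun z hz => (hder z hz).differentiableAt.differentiableWithinAt, fun z hz => ?_,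
      fun z hz => ?_, fun q' hq' hqU z hz hzq => ?_⟩
    · rw [(hder z hz).fderiv]
      exact hx'.one_le _ (hmem z hz)
    · rw [(hder z hz).fderiv]
      exact hx'.le_three _ (hmem z hz)
    · have h1 := hx'.leaf _ (h.smul_mem _ (inv_ne_zero ht0) q' hq') (hmem q' hqU) _ (hmem z hz)
        (mul_left_cancel₀ ht0 hzq)
      have h2 := h.smul_mem t ht0 _ h1
      rwa [smul_inv_smul₀ ht0] at h2
  choose! f hf using hscale
  exact ⟨R, hR, f, hf⟩

end Uniform

section Compatibility

variable {V : Type*} [NormedAddCommGroup V] [NormedSpace ℂ V] [FiniteDimensional ℂ V]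

lemma fderiv_ne_zero_of_isLeafFunction {M : Set V} {f : V → ℂ} {U : Set V}
    (h : IsLeafFunction M f U) {z : V} (hz : z ∈ U) : fderiv ℂ f z ≠ 0 := by
  intro h0
  have := h.one_le z hz
  rw [h0, norm_zero] at this
  linarith

/-- Two leaf functions on a convex open set meeting `M` have parallel derivatives. -/
lemma LeafAtlas.exists_smul_fderiv {M : Set V} (h : LeafAtlas M) {f g : V → ℂ} {O : Set V}
    (hO : IsOpen O) (hOc : Convex ℝ O) {m : V} (hm : m ∈ M) (hmO : m ∈ O)
    (hf : DifferentiableOn ℂ f O) (hf' : ∀ z ∈ O, fderiv ℂ f z ≠ 0)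
    (hfM : ∀ q ∈ M, q ∈ O → ∀ z ∈ O, f z = f q → z ∈ M)
    (hg : DifferentiableOn ℂ g O) (hg' : ∀ z ∈ O, fderiv ℂ g z ≠ 0)
    (hgM : ∀ q ∈ M, q ∈ O → ∀ z ∈ O, g z = g q → z ∈ M) :
    ∀ z ∈ O, ∃ k : ℂ, fderiv ℂ g z = k • fderiv ℂ f z := by
  have hminor : ∀ v w, ∀ z ∈ O,
      fderiv ℂ f z v * fderiv ℂ g z w - fderiv ℂ f z w * fderiv ℂ g z v = 0 := by
    intro v w
    have hd : DifferentiableOn ℂ (fun z => fderiv ℂ f z v * fderiv ℂ g z w -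
        fderiv ℂ f z w * fderiv ℂ g z v) O :=
      ((differentiableOn_fderiv_apply hO hf v).fun_mul
        (differentiableOn_fderiv_apply hO hg w)).fun_sub
        ((differentiableOn_fderiv_apply hO hf w).fun_mul (differentiableOn_fderiv_apply hO hg v))
    refine eqOn_zero_of_eventually_eq_zero hO hOc hd hmO ?_
    refine h.eventually_eq_zero m hm _ ?_ ?_
    · filter_upwards [hO.eventually_mem hmO] with z hz
      exact hd.differentiableAt (hO.mem_nhds hz)
    · filter_upwards [hO.eventually_mem hmO] with q hqO hq
      obtain ⟨T, -, hT⟩ := h.exists_tangent q hq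
      have hev := hO.eventually_mem hqO
      have h1 := hT f (hev.mono fun z hz => hf.differentiableAt (hO.mem_nhds hz)) (hf' q hqO)
        (hev.mono fun z hz => hfM q hq hqO z hz)
      have h2 := hT g (hev.mono fun z hz => hg.differentiableAt (hO.mem_nhds hz)) (hg' q hqO)
        (hev.mono fun z hz => hgM q hq hqO z hz)
      have h3 := (h2 (fderiv ℂ f q v • w - fderiv ℂ f q w • v)).2
        ((h1 _).1 (by
          rw [map_sub, map_smul, map_smul, smul_eq_mul, smul_eq_mul]
          ring))
      rwa [map_sub, map_smul, map_smul, smul_eq_mul, smul_eq_mul] at h3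
  intro z hz
  obtain ⟨v, hv⟩ : ∃ v, fderiv ℂ f z v ≠ 0 := by
    by_contra! hcon
    exact hf' z hz (ContinuousLinearMap.ext hcon)
  refine ⟨fderiv ℂ g z v / fderiv ℂ f z v, ?_⟩
  ext w
  rw [smul_apply, smul_eq_mul]
  field_simp
  linear_combination hminor v w z hz

lemma LeafAtlas.fderiv_self_eq_zero {M : Set V} (h : LeafAtlas M) {f : V → ℂ} {O : Set V}
    (hO : IsOpen O) (hOc : Convex ℝ O) {m : V} (hm : m ∈ M) (hmO : m ∈ O)
    (hf : DifferentiableOn ℂ f O) (hf' : ∀ z ∈ O, fderiv ℂ f z ≠ 0)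
    (hfM : ∀ q ∈ M, q ∈ O → ∀ z ∈ O, f z = f q → z ∈ M) :
    ∀ z ∈ O, fderiv ℂ f z z = 0 := by
  have hd : DifferentiableOn ℂ (fun z => fderiv ℂ f z z) O :=
    (differentiableOn_fderiv hO hf).clm_apply differentiableOn_id
  refine eqOn_zero_of_eventually_eq_zero hO hOc hd hmO ?_
  refine h.eventually_eq_zero m hm _ ?_ ?_
  · filter_upwards [hO.eventually_mem hmO] with z hz
    exact hd.differentiableAt (hO.mem_nhds hz)
  · filter_upwards [hO.eventually_mem hmO] with q hqO hq
    obtain ⟨T, hqT, hT⟩ := h.exists_tangent q hq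
    have hev := hO.eventually_mem hqO
    exact (hT f (hev.mono fun z hz => hf.differentiableAt (hO.mem_nhds hz)) (hf' q hqO)
      (hev.mono fun z hz => hfM q hq hqO z hz) q).2 hqT

end Compatibility

section Conclusion

variable {V : Type*} [NormedAddCommGroup V] [InnerProductSpace ℂ V] [FiniteDimensional ℂ V]

lemma LeafAtlas.exists_conicFoliation {M : Set V} (h : LeafAtlas M) :
    ∃ (M' : Set V) (r C : ℝ) (f : V → V → ℂ), ConicFoliation M' r C f := by
  obtain ⟨R, hR, f, hf⟩ := h.exists_uniform
  set r := min (R / 2) (1 / 10) with hr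
  have hr0 : 0 < r := lt_min (by positivity) (by norm_num)
  have hrR : 2 * r ≤ R := by linarith [min_le_left (R / 2) (1 / 10)]
  have hnorm : ∀ q ∈ M, 0 < ‖q‖ := fun q hq => norm_pos_iff.2 fun h0 => h.zero_notMem (h0 ▸ hq)
  have hsub : ∀ q : V, ball q (r * ‖q‖) ⊆ ball q (R * ‖q‖) := fun q =>
    ball_subset_ball (mul_le_mul_of_nonneg_right (by linarith) (norm_nonneg q))
  have hself : ∀ q ∈ M, q ∈ ball q (r * ‖q‖) := fun q hq =>
    mem_ball_self (mul_pos hr0 (hnorm q hq))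
  have hcompat : ∀ q ∈ M, ∀ q' ∈ M, ∀ c : ℂ, c ≠ 0 → ∀ z ∈ ball q (r * ‖q‖),
      c • z ∈ ball q' (r * ‖q'‖) → ∃ k : ℂ, fderiv ℂ (f q') (c • z) = k • fderiv ℂ (f q) z := by
    intro q hq q' hq' c hc z hz hcz
    have hcn : 0 < ‖c‖ := norm_pos_iff.2 hc
    set L : V →L[ℝ] V := (c • ContinuousLinearMap.id ℂ V).restrictScalars ℝ with hL
    have hLapp : ∀ y, L y = c • y := fun y => rfl
    set O := ball q (R * ‖q‖) ∩ L ⁻¹' ball q' (R * ‖q'‖) with hOdef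
    have hO : IsOpen O := isOpen_ball.inter (isOpen_ball.preimage L.continuous)
    have hOc : Convex ℝ O :=
      (convex_ball _ _).inter ((convex_ball q' (R * ‖q'‖)).linear_preimage L.toLinearMap)
    have hzO : z ∈ O := ⟨hsub q hz, by rw [mem_preimage, hLapp]; exact hsub q' hcz⟩
    have hder : ∀ y ∈ O, HasFDerivAt (fun y => c⁻¹ * f q' (c⁻¹⁻¹ • y))
        (fderiv ℂ (f q') (c • y)) y := by
      intro y hy
      have := hasFDerivAt_rescale (F := f q') (inv_ne_zero hc) (z := y) (by
        rw [inv_inv]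
        exact (hf q' hq').differentiableOn.differentiableAt (isOpen_ball.mem_nhds hy.2))
      rwa [inv_inv] at this ⊢
    obtain ⟨m, hm, hmO⟩ : ∃ m ∈ M, m ∈ O := by
      have hz' : ‖z - q‖ < r * ‖q‖ := by rwa [mem_ball, dist_eq_norm] at hz
      have hcz' : ‖c • z - q'‖ < r * ‖q'‖ := by rwa [mem_ball, dist_eq_norm] at hcz
      have htri : ‖c • q - q'‖ < ‖c‖ * (r * ‖q‖) + r * ‖q'‖ := by
        have e : c • q - q' = (c • z - q') - c • (z - q) := by rw [smul_sub]; abel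
        rw [e]
        refine (norm_sub_le _ _).trans_lt ?_
        rw [norm_smul]
        nlinarith
      rcases le_total (‖c‖ * (r * ‖q‖)) (r * ‖q'‖) with hle | hle
      · refine ⟨q, hq, hsub q (hself q hq), ?_⟩
        rw [mem_preimage, hLapp, mem_ball, dist_eq_norm]
        nlinarith [hnorm q' hq']
      · refine ⟨c⁻¹ • q', h.smul_mem _ (inv_ne_zero hc) q' hq', ?_, ?_⟩
        · rw [mem_ball, dist_eq_norm]
          have e : c⁻¹ • q' - q = c⁻¹ • -(c • q - q') := by
            rw [neg_sub, smul_sub, inv_smul_smul₀ hc]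
          rw [e, norm_smul, norm_neg, norm_inv, inv_mul_lt_iff₀ hcn]
          have : ‖c‖ * (2 * r * ‖q‖) ≤ ‖c‖ * (R * ‖q‖) := by gcongr
          linarith
        · rw [mem_preimage, hLapp, smul_inv_smul₀ hc]
          exact hsub q' (hself q' hq')
    obtain ⟨k, hk⟩ := h.exists_smul_fderiv hO hOc hm hmO
      ((hf q hq).differentiableOn.mono inter_subset_left)
      (fun y hy => fderiv_ne_zero_of_isLeafFunction (hf q hq) hy.1)
      (fun a ha haO y hy => (hf q hq).leaf a ha haO.1 y hy.1)
      (g := fun y => c⁻¹ * f q' (c⁻¹⁻¹ • y))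
      (fun y hy => (hder y hy).differentiableAt.differentiableWithinAt)
      (fun y hy => by
        rw [(hder y hy).fderiv]
        exact fderiv_ne_zero_of_isLeafFunction (hf q' hq') hy.2)
      (fun a ha haO y hy hya => by
        have h1 := mul_left_cancel₀ (inv_ne_zero hc) hya
        rw [inv_inv] at h1
        have h2 := (hf q' hq').leaf _ (h.smul_mem c hc a ha) haO.2 _ hy.2 h1
        have h3 := h.smul_mem c⁻¹ (inv_ne_zero hc) _ h2
        rwa [hLapp, inv_smul_smul₀ hc] at h3) z hzO
    exact ⟨k, by rwa [(hder z hzO).fderiv] at hk⟩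
  have hradial : ∀ q ∈ M, ∀ z ∈ ball q (r * ‖q‖), fderiv ℂ (f q) z z = 0 := by
    intro q hq
    have hF := (hf q hq).mono (hsub q)
    exact h.fderiv_self_eq_zero isOpen_ball (convex_ball _ _) hq (hself q hq) hF.differentiableOn
      (fun z hz => fderiv_ne_zero_of_isLeafFunction hF hz) hF.leaf
  set U := ⋃ q ∈ M, ball q (r * ‖q‖) with hU
  have hballU : ∀ q ∈ M, ball q (r * ‖q‖) ⊆ U := fun q hq _ hz => mem_iUnion₂.2 ⟨q, hq, hz⟩
  obtain ⟨m₀, hm₀⟩ := h.nonempty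
  set U₀ := connectedComponentIn U m₀ with hU₀
  have hU₀c : IsPreconnected U₀ := isPreconnected_connectedComponentIn
  have hadd : ∀ s : Set V, IsPreconnected s → s ⊆ U → (s ∩ U₀).Nonempty → s ⊆ U₀ := by
    rintro s hs hsU ⟨y, hys, hyU⟩
    have := hs.subset_connectedComponentIn hys hsU
    rwa [← connectedComponentIn_eq hyU] at this
  have hball : ∀ q ∈ M, (ball q (r * ‖q‖) ∩ U₀).Nonempty → ball q (r * ‖q‖) ⊆ U₀ := fun q hq =>
    hadd _ (convex_ball _ _).isPreconnected (hballU q hq)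
  have hm₀U : m₀ ∈ U₀ := mem_connectedComponentIn (hballU m₀ hm₀ (hself m₀ hm₀))
  have hball' : ∀ q ∈ M ∩ U₀, ball q (r * ‖q‖) ⊆ U₀ := fun q hq =>
    hball q hq.1 ⟨q, hself q hq.1, hq.2⟩
  refine ⟨M ∩ U₀, r, 3, f, ⟨m₀, hm₀, hm₀U⟩, fun h0 => h.zero_notMem h0.1, ?_, ?_, hr0,
    min_le_right _ _, fun q hq => (hf q hq.1).differentiableOn.mono (hsub q),
    fun q hq z hz => (hf q hq.1).one_le z (hsub q hz),
    fun q hq z hz => (hf q hq.1).le_three z (hsub q hz),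
    fun q hq q' hq' => hcompat q hq.1 q' hq'.1, ?_, fun q hq => hradial q hq.1, ?_⟩
  · intro c hc z hz
    refine ⟨h.smul_mem c hc z hz.1, ?_⟩
    have hpc : IsPreconnected ((fun c : ℂ => c • z) '' {0}ᶜ) := by
      refine IsPreconnected.image ?_ _ (by fun_prop)
      exact (isConnected_compl_singleton_of_one_lt_rank (by simp) 0).isPreconnected
    refine hadd _ hpc ?_ ⟨z, ⟨1, by simp, one_smul _ _⟩, hz.2⟩ ⟨c, hc, rfl⟩
    rintro _ ⟨a, ha, rfl⟩
    have := h.smul_mem a ha z hz.1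
    exact hballU _ this (hself _ this)
  · intro z hz hz0
    have hzM := h.mem_of_closure z (closure_mono inter_subset_left hz) hz0
    refine ⟨hzM, ?_⟩
    obtain ⟨y, hy, hyM⟩ := mem_closure_iff.1 hz _ isOpen_ball (hself z hzM)
    exact hball z hzM ⟨y, hy, hyM.2⟩ (hself z hzM)
  · intro q hq q' hq' hq'b z hz hzq
    exact ⟨(hf q hq.1).leaf q' hq'.1 (hsub q hq'b) z (hsub q hz) hzq, hball' q hq hz⟩
  · have : (⋃ q ∈ M ∩ U₀, ball q (r * ‖q‖)) = U₀ := by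
      refine Subset.antisymm (iUnion₂_subset hball') fun z hz => ?_
      obtain ⟨q, hq, hzq⟩ := mem_iUnion₂.1 (connectedComponentIn_subset _ _ hz)
      have := hball q hq ⟨z, hzq, hz⟩
      exact mem_iUnion₂.2 ⟨q, ⟨hq, this (hself q hq)⟩, hzq⟩
    rw [this]
    exact hU₀c

end Conclusion

end LeviFlat

/-- Nonexistence of closed real analytic Levi-flat hypersurfaces in `ℂℙⁿ`, `n ≥ 3`. -/
theorem no_closed_analytic_leviFlat_hypersurface_in_CPn (n : ℕ) (hn : 3 ≤ n) :
    ¬ ∃ M : Set (Fin (n + 1) → ℂ),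
        IsProjectiveClosedSet M ∧ IsAnalyticLeviFlatHypersurface M := by
  rintro ⟨M, hM, hL⟩
  have hA := LeviFlat.leafAtlas_of_isAnalyticLeviFlatHypersurface hM hL
  obtain ⟨M', r, C, f, hf⟩ :=
    (hA.preimage (EuclideanSpace.equiv (Fin (n + 1)) ℂ)).exists_conicFoliation
  exact hf.false_of_three_le hn
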